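/- arXiv:2605.20705 — 2 statements merged into one kernel-verified Lean document; each statement's English description precedes it below -/
import Mathlib

section
/- For every integer k ≥ 1 there exists a constant c'_k > 0 such that the following holds: if P is a finite set of points in ℝ² and C is a k-intersecting family of simple curves, then I(P,C) ≤ c'_k · ( |P|^((k+1)/(2k+1)) · |C|^((2k)/(2k+1)) + |P| + |C| ). -/
open scoped Classical

/-- A simple curve: the image of an injective continuous map from [0,1] into ℝ². -/
def IsSimpleCurve (γ : Set (ℝ × ℝ)) : Prop :=
  ∃ f : Set.Icc (0:ℝ) 1 → ℝ × ℝ, Continuous f ∧ Function.Injective f ∧ γ = Set.range f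

/-- A k-intersecting family of simple curves: every member is a simple curve and
any two distinct members intersect in at most k points. -/
def KIntersecting (C : Finset (Set (ℝ × ℝ))) (k : ℕ) : Prop :=
  (∀ γ ∈ C, IsSimpleCurve γ) ∧
  ∀ γ ∈ C, ∀ γ' ∈ C, γ ≠ γ' → (γ ∩ γ').Finite ∧ (γ ∩ γ').ncard ≤ k

/-- The number of incidences between a finite point set P and a finite family of curves C. -/
noncomputable def incidences (P : Finset (ℝ × ℝ)) (C : Finset (Set (ℝ × ℝ))) : ℕ :=
  ∑ γ ∈ C, (P.filter (fun p => p ∈ γ)).card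


lemma ps_log2 (g : ℝ × ℝ → ℂ) (hg : Continuous g) (h0 : ∀ x, g x ≠ 0) :
    ∃ f : ℝ × ℝ → ℂ, Continuous f ∧ ∀ x, Complex.exp (f x) = g x := by
  have hs : IsSimplyConnected (Set.univ : Set (ℝ × ℝ)) := by
    have := (convex_univ (𝕜 := ℝ) (E := ℝ × ℝ)).contractibleSpace Set.univ_nonempty
    exact SimplyConnectedSpace.ofContractible _
  obtain ⟨f, hf, he⟩ := Complex.exists_continuousOn_eqOn_exp_comp (U := (Set.univ : Set (ℝ × ℝ)))
    hs isOpen_univ (g := g) hg.continuousOn (by simpa using h0)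
  exact ⟨f, continuousOn_univ.mp hf, fun x => he (Set.mem_univ x)⟩

lemma ps_log1 (g : ℝ → ℂ) (hg : Continuous g) (h0 : ∀ x, g x ≠ 0) :
    ∃ f : ℝ → ℂ, Continuous f ∧ ∀ x, Complex.exp (f x) = g x := by
  obtain ⟨f, hf, he⟩ := ps_log2 (fun x => g x.1) (by fun_prop) (fun x => h0 _)
  exact ⟨fun t => f (t, 0), by fun_prop, fun x => he _⟩

lemma ps_log_unique (f g : ℝ → ℂ) (hf : Continuous f) (hg : Continuous g)
    (h : ∀ x, Complex.exp (f x) = Complex.exp (g x)) : f 1 - f 0 = g 1 - g 0 := by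
  have h1 : f = fun t => g t + (f 0 - g 0) := by
    apply Complex.isCoveringMap_exp.eq_of_comp_eq hf (by fun_prop) _ 0 (by ring)
    funext t
    apply Subtype.ext
    simp [Complex.exp_add, Complex.exp_sub, h, Complex.exp_ne_zero]
  have := congrFun h1 1
  rw [this]; ring

/-- The topological core: `K₅` cannot be mapped to the plane such that vertex-disjoint edges
have disjoint images. -/
lemma ps_K5_complex (v : Fin 5 → ℂ) (γ : Fin 5 → Fin 5 → ℝ → ℂ)
    (hc : ∀ i j, i < j → Continuous (γ i j))
    (h0 : ∀ i j, i < j → γ i j 0 = v i) (h1 : ∀ i j, i < j → γ i j 1 = v j)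
    (hd : ∀ i j k l, i < j → k < l → i ≠ k → i ≠ l → j ≠ k → j ≠ l →
      ∀ s t, γ i j s ≠ γ k l t) : False := by
  -- vertices avoid non-incident edges
  have hv : ∀ c i j, i < j → c ≠ i → c ≠ j → ∀ t, γ i j t - v c ≠ 0 := by
    intro c i j hij hci hcj t
    obtain ⟨d, hd1, hd2, hd3⟩ : ∃ d : Fin 5, d ≠ c ∧ d ≠ i ∧ d ≠ j := by
      revert c i j; decide
    rw [sub_ne_zero]
    rcases lt_or_gt_of_ne hd1 with h | h
    · rw [← h1 d c h]; exact hd i j d c hij h hd2.symm hci.symm hd3.symm hcj.symm _ _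
    · rw [← h0 c d h]; exact hd i j c d hij h hci.symm hd2.symm hcj.symm hd3.symm _ _
  have hvv : ∀ x y, x ≠ y → v y - v x ≠ 0 := by
    intro x y hxy
    obtain ⟨d, hd1, hd2⟩ : ∃ d : Fin 5, d ≠ x ∧ d ≠ y := by
      revert x y; decide
    rcases lt_or_gt_of_ne hd2 with h | h
    · rw [← h1 d y h]; exact hv x d y h hd1.symm hxy _
    · rw [← h0 y d h]; exact hv x y d h hxy hd1.symm _
  obtain ⟨A, hA, hA'⟩ : ∃ A : Fin 5 → Fin 5 → ℂ,
      (∀ x y, x ≠ y → Complex.exp (A x y) = v y - v x) ∧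
      (∀ x y, x < y → A y x = A x y + Real.pi * Complex.I) := by
    refine ⟨fun x y => if x < y then Complex.log (v y - v x) else
      Complex.log (v x - v y) + Real.pi * Complex.I, ?_, ?_⟩
    · intro x y hxy
      rcases lt_or_gt_of_ne hxy with h | h
      · simp [h, Complex.exp_log (hvv x y hxy)]
      · simp [not_lt.mpr h.le, Complex.exp_add, Complex.exp_log (hvv y x hxy.symm)]
    · intro x y hxy
      simp [hxy, not_lt.mpr hxy.le]
  have hpi : (Real.pi : ℂ) * Complex.I ≠ 0 := by simp [Real.pi_ne_zero]
  have hn : ∀ c i j, ∃ n : ℤ, i < j → c ≠ i → c ≠ j → ∀ W : ℝ → ℂ, Continuous W →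
      (∀ t, Complex.exp (W t) = γ i j t - v c) →
      W 1 - W 0 = A c j - A c i + n * (2 * Real.pi * Complex.I) := by
    intro c i j
    by_cases h : i < j ∧ c ≠ i ∧ c ≠ j
    · obtain ⟨hij, hci, hcj⟩ := h
      obtain ⟨W, hW, hWe⟩ := ps_log1 (fun t => γ i j t - v c)
        ((hc i j hij).sub continuous_const) (hv c i j hij hci hcj)
      have e1 : Complex.exp (W 1) = Complex.exp (A c j) := by
        rw [hWe, h1 i j hij, hA c j hcj]
      have e0 : Complex.exp (W 0) = Complex.exp (A c i) := by
        rw [hWe, h0 i j hij, hA c i hci]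
      obtain ⟨n1, hn1⟩ := Complex.exp_eq_exp_iff_exists_int.mp e1
      obtain ⟨n0, hn0⟩ := Complex.exp_eq_exp_iff_exists_int.mp e0
      refine ⟨n1 - n0, fun _ _ _ W' hW' hWe' => ?_⟩
      rw [ps_log_unique W' W hW' hW (fun t => by rw [hWe, hWe']), hn1, hn0]
      push_cast; ring
    · exact ⟨0, fun a b c => absurd ⟨a, b, c⟩ h⟩
  choose n hn using hn
  have hrel : ∀ a b c d, a < b → c < d → a ≠ c → a ≠ d → b ≠ c → b ≠ d →
      A c b - A c a + n c a b * (2 * Real.pi * Complex.I) +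
        (A b d - A b c + n b c d * (2 * Real.pi * Complex.I)) =
      A d b - A d a + n d a b * (2 * Real.pi * Complex.I) +
        (A a d - A a c + n a c d * (2 * Real.pi * Complex.I)) := by
    intro a b c d hab hcd hac had hbc hbd
    have := hc a b hab
    have := hc c d hcd
    obtain ⟨L, hL, hLe⟩ := ps_log2 (fun x => γ a b x.1 - γ c d x.2) (by fun_prop)
      (fun x => sub_ne_zero.mpr (hd a b c d hab hcd hac had hbc hbd _ _))
    have r1 := hn c a b hab hac.symm hbc.symm (fun s => L (s, 0)) (by fun_prop)
      (fun t => by rw [hLe]; simp [h0 c d hcd])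
    have r3 := hn d a b hab had.symm hbd.symm (fun s => L (s, 1)) (by fun_prop)
      (fun t => by rw [hLe]; simp [h1 c d hcd])
    have r2 := hn b c d hcd hbc hbd (fun s => L (1, s) + Real.pi * Complex.I) (by fun_prop)
      (fun t => by rw [Complex.exp_add, hLe]; simp [h1 a b hab])
    have r4 := hn a c d hcd hac had (fun s => L (0, s) + Real.pi * Complex.I) (by fun_prop)
      (fun t => by rw [Complex.exp_add, hLe]; simp [h0 a b hab])
    rw [← r1, ← r2, ← r3, ← r4]
    ring
  have hcan : ∀ m m' : ℤ, (m : ℂ) * (2 * (Real.pi * Complex.I)) =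
      m' * (2 * (Real.pi * Complex.I)) → m = m' := by
    intro m m' h
    have := mul_right_cancel₀ (mul_ne_zero two_ne_zero hpi) h
    exact_mod_cast this
  have c1 : ∀ a b c d, a < b → b < c → c < d →
      n c a b + n b c d - n d a b - n a c d = 0 := by
    intro a b c d hab hbc hcd
    have hac := hab.trans hbc
    have hbd := hbc.trans hcd
    have had := hac.trans hcd
    have := hrel a b c d hab hcd hac.ne had.ne hbc.ne hbd.ne
    rw [hA' a c hac, hA' a d had, hA' b c hbc, hA' b d hbd] at this
    apply hcan; push_cast
    linear_combination this
  have c2 : ∀ a c b d, a < c → c < b → b < d →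
      n c a b + n b c d - n d a b - n a c d = 1 := by
    intro a c b d hac hcb hbd
    have hab := hac.trans hcb
    have hcd := hcb.trans hbd
    have had := hac.trans hcd
    have := hrel a b c d hab hcd hac.ne had.ne hcb.ne' hbd.ne
    rw [hA' a c hac, hA' a d had, hA' c b hcb, hA' b d hbd] at this
    apply hcan; push_cast
    linear_combination this
  have c3 : ∀ a c d b, a < c → c < d → d < b →
      n c a b + n b c d - n d a b - n a c d = 0 := by
    intro a c d b hac hcd hdb
    have hab := hac.trans (hcd.trans hdb)
    have hcb := hcd.trans hdb
    have had := hac.trans hcd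
    have := hrel a b c d hab hcd hac.ne had.ne hcb.ne' hdb.ne'
    rw [hA' a c hac, hA' a d had, hA' c b hcb, hA' d b hdb] at this
    apply hcan; push_cast
    linear_combination this
  have q : ∀ a b c d : Fin 5, a < b → b < c → c < d → 
    (n c a b + n b c d - n d a b - n a c d = 0) ∧
    (n b a c + n c b d - n d a c - n a b d = 1) ∧
    (n b a d + n d b c - n c a d - n a b c = 0) := fun a b c d h1 h2 h3 =>
      ⟨c1 a b c d h1 h2 h3, c2 a b c d h1 h2 h3, c3 a b c d h1 h2 h3⟩
  have q1 := q 0 1 2 3 (by decide) (by decide) (by decide)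
  have q2 := q 0 1 2 4 (by decide) (by decide) (by decide)
  have q3 := q 0 1 3 4 (by decide) (by decide) (by decide)
  have q4 := q 0 2 3 4 (by decide) (by decide) (by decide)
  have q5 := q 1 2 3 4 (by decide) (by decide) (by decide)
  omega

lemma ps_K5 (v : Fin 5 → ℝ × ℝ) (F : Fin 5 → Fin 5 → Set (ℝ × ℝ))
    (hF : ∀ i j, i < j → JoinedIn (F i j) (v i) (v j)) :
    ∃ i j k l, i < j ∧ k < l ∧ i ≠ k ∧ i ≠ l ∧ j ≠ k ∧ j ≠ l ∧ (F i j ∩ F k l).Nonempty := by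
  by_contra hcon
  push Not at hcon
  let φ : ℝ × ℝ → ℂ := Complex.equivRealProdCLM.symm
  have hφ : Continuous φ := Complex.equivRealProdCLM.symm.continuous
  have hinj : Function.Injective φ := Complex.equivRealProdCLM.symm.injective
  have : ∀ i j, ∃ g : ℝ → ℝ × ℝ, i < j → Continuous g ∧ g 0 = v i ∧ g 1 = v j ∧
      ∀ t, g t ∈ F i j := by
    intro i j
    by_cases h : i < j
    · obtain ⟨p, hp⟩ := hF i j h
      refine ⟨p.extend, fun _ => ⟨p.continuous_extend, by simp, by simp, fun t => ?_⟩⟩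
      exact hp _
    · exact ⟨fun _ => 0, fun h' => absurd h' h⟩
  choose g hg using this
  refine ps_K5_complex (fun i => φ (v i)) (fun i j t => φ (g i j t)) ?_ ?_ ?_ ?_
  · intro i j h; exact hφ.comp (hg i j h).1
  · intro i j h; simp only [(hg i j h).2.1]
  · intro i j h; simp only [(hg i j h).2.2.1]
  · intro i j k l h1 h2 h3 h4 h5 h6 s t he
    have he := hinj he
    have hm : g i j s ∈ F i j ∩ F k l :=
      ⟨(hg i j h1).2.2.2 s, by rw [he]; exact (hg k l h2).2.2.2 t⟩
    rw [hcon i j k l h1 h2 h3 h4 h5 h6] at hm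
    exact hm

/-- Number of ordered adjacent pairs inside `S`. -/
noncomputable def psE {V : Type*} (adj : V → V → Prop) (S : Finset V) : ℕ :=
  ∑ x ∈ S, ∑ y ∈ S, if adj x y then 1 else 0

/-- number of neighbours of `y` in `S`. -/
noncomputable def psDeg {V : Type*} (adj : V → V → Prop) (S : Finset V) (y : V) : ℕ :=
  ∑ z ∈ S, if adj y z then 1 else 0

def psConn {V : Type*} (adj : V → V → Prop) (B : Finset V) : Prop :=
  ∀ x ∈ B, ∀ y ∈ B, Relation.ReflTransGen (fun u v => adj u v ∧ u ∈ B ∧ v ∈ B) x y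

lemma psE_insert {V : Type*} (adj : V → V → Prop) (hs : ∀ x y, adj x y → adj y x)
    (hi : ∀ x, ¬ adj x x) (T : Finset V) (y : V) (hy : y ∉ T) :
    psE adj (insert y T) = psE adj T + 2 * psDeg adj T y := by
  unfold psE psDeg
  rw [Finset.sum_insert hy, Finset.sum_insert hy]
  have : ∀ x, (∑ z ∈ insert y T, if adj x z then 1 else 0) =
      (if adj x y then 1 else 0) + ∑ z ∈ T, if adj x z then 1 else 0 :=
    fun x => Finset.sum_insert hy
  simp only [this]
  rw [Finset.sum_add_distrib]
  have h2 : ∀ x, (if adj x y then 1 else 0) = (if adj y x then 1 else 0) := by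
    intro x
    have : adj x y ↔ adj y x := ⟨hs _ _, hs _ _⟩
    simp [this]
  simp only [h2, hi, if_false]
  ring

lemma psConn_insert {V : Type*} (adj : V → V → Prop) (hs : ∀ x y, adj x y → adj y x)
    (B : Finset V) (hB : psConn adj B) (x y : V) (hx : x ∈ B) (hxy : adj x y) :
    psConn adj (insert y B) := by
  have mono : ∀ a b, Relation.ReflTransGen (fun u v => adj u v ∧ u ∈ B ∧ v ∈ B) a b →
      Relation.ReflTransGen (fun u v => adj u v ∧ u ∈ insert y B ∧ v ∈ insert y B) a b := by
    intro a b h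
    refine Relation.ReflTransGen.mono (r := fun u v => adj u v ∧ u ∈ B ∧ v ∈ B) ?_ a b h
    rintro u v ⟨h1, h2, h3⟩
    exact ⟨h1, Finset.mem_insert_of_mem h2, Finset.mem_insert_of_mem h3⟩
  have hx' : x ∈ insert y B := Finset.mem_insert_of_mem hx
  have hy' : y ∈ insert y B := Finset.mem_insert_self _ _
  have tox : ∀ a ∈ insert y B, Relation.ReflTransGen
      (fun u v => adj u v ∧ u ∈ insert y B ∧ v ∈ insert y B) a x := by
    intro a ha
    rcases Finset.mem_insert.mp ha with rfl | ha
    · exact Relation.ReflTransGen.single ⟨hs _ _ hxy, hy', hx'⟩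
    · exact mono _ _ (hB a ha x hx)
  have fromx : ∀ a ∈ insert y B, Relation.ReflTransGen
      (fun u v => adj u v ∧ u ∈ insert y B ∧ v ∈ insert y B) x a := by
    intro a ha
    rcases Finset.mem_insert.mp ha with rfl | ha
    · exact Relation.ReflTransGen.single ⟨hxy, hx', hy'⟩
    · exact mono _ _ (hB x hx a ha)
  intro a ha b hb
  exact (tox a ha).trans (fromx b hb)

/-- Mader-type lemma: dense graphs have a complete minor. -/
lemma ps_minor {V : Type*} (adj : V → V → Prop) (hs : ∀ x y, adj x y → adj y x)
    (hi : ∀ x, ¬ adj x x) (r : ℕ) : ∀ (m : ℕ) (S : Finset V), S.card = m → S.Nonempty →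
    2 ^ r * S.card ≤ psE adj S →
    ∃ B : Fin (r + 1) → Finset V, (∀ i, B i ⊆ S ∧ (B i).Nonempty ∧ psConn adj (B i)) ∧
      (∀ i j, i ≠ j → Disjoint (B i) (B j)) ∧
      (∀ i j, i ≠ j → ∃ x ∈ B i, ∃ y ∈ B j, adj x y) := by
  induction r with
  | zero =>
    intro m S _ ⟨x, hx⟩ _
    refine ⟨fun _ => {x}, fun i => ⟨by simpa using hx, by simp, ?_⟩, ?_, ?_⟩
    · intro a ha b hb
      rw [Finset.mem_singleton.mp ha, Finset.mem_singleton.mp hb]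
    · intro i j h; omega
    · intro i j h; omega
  | succ r ihr =>
    intro m
    induction m using Nat.strong_induction_on with
    | _ m ihm =>
    intro S hm ⟨v, hv⟩ hE
    let N : Finset V → Finset V := fun U => (S \ U).filter (fun y => ∃ x ∈ U, adj x y)
    let good : Finset V → Prop := fun U => U ⊆ S ∧ U.Nonempty ∧ psConn adj U ∧
      2 ^ (r + 1) * ((S \ U).card + 1) ≤ psE adj (S \ U) + 2 * (N U).card
    have hgood : good {v} := by
      refine ⟨by simpa using hv, by simp, ?_, ?_⟩
      · intro a ha b hb
        rw [Finset.mem_singleton.mp ha, Finset.mem_singleton.mp hb]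
      · have hvn : v ∉ S \ {v} := by simp
        have hins : insert v (S \ {v}) = S := by
          ext z; simp only [Finset.mem_insert, Finset.mem_sdiff, Finset.mem_singleton]
          constructor
          · rintro (rfl | h)
            · exact hv
            · exact h.1
          · intro h; by_cases hz : z = v
            · exact Or.inl hz
            · exact Or.inr ⟨h, hz⟩
        have h1 := psE_insert adj hs hi (S \ {v}) v hvn
        have h2 := Finset.card_insert_of_notMem hvn
        rw [hins] at h1 h2
        have h3 : (N {v}).card = psDeg adj (S \ {v}) v := by
          simp only [N, psDeg, Finset.card_filter, Finset.mem_singleton, exists_eq_left]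
        rw [h3, ← h1, ← h2]; exact hE
    obtain ⟨U, hUm⟩ : ∃ U, Maximal (· ∈ S.powerset.filter good) U := by
      have hne : (S.powerset.filter good).Nonempty :=
        ⟨{v}, by simp only [Finset.mem_filter, Finset.mem_powerset]; exact ⟨hgood.1, hgood⟩⟩
      exact (S.powerset.filter good).exists_maximal hne
    have hU : good U := (Finset.mem_filter.mp hUm.1).2
    obtain ⟨hUS, hUne, hUc, hUE⟩ := hU
    by_cases hN : (N U).Nonempty
    · -- every vertex of N U has large degree in N U
      have hdeg : ∀ y ∈ N U, 2 ^ r ≤ psDeg adj (N U) y := by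
        intro y hy
        obtain ⟨hyS, x, hxU, hxy⟩ := Finset.mem_filter.mp hy
        obtain ⟨hyS, hyU⟩ := Finset.mem_sdiff.mp hyS
        have hnot : ¬ good (insert y U) := by
          intro hg
          have := hUm.2 (y := insert y U)
            (Finset.mem_filter.mpr ⟨Finset.mem_powerset.mpr hg.1, hg⟩) (Finset.subset_insert _ _)
          exact hyU (this (Finset.mem_insert_self _ _))
        have hlt : psE adj (S \ insert y U) + 2 * (N (insert y U)).card <
            2 ^ (r + 1) * ((S \ insert y U).card + 1) := by
          by_contra hge
          exact hnot ⟨Finset.insert_subset hyS hUS, Finset.insert_nonempty _ _,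
            psConn_insert adj hs U hUc x y hxU hxy, not_lt.mp hge⟩
        have hyn : y ∉ S \ insert y U := by simp
        have hins : insert y (S \ insert y U) = S \ U := by
          ext z; simp only [Finset.mem_insert, Finset.mem_sdiff, not_or]
          constructor
          · rintro (rfl | h)
            · exact ⟨hyS, hyU⟩
            · exact ⟨h.1, h.2.2⟩
          · intro h; by_cases hz : z = y
            · exact Or.inl hz
            · exact Or.inr ⟨h.1, hz, h.2⟩
        have h1 := psE_insert adj hs hi _ y hyn
        have h2 := Finset.card_insert_of_notMem hyn
        rw [hins] at h1 h2
        -- cardinality of the new neighbourhood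
        have h3 : (N U).card + psDeg adj (S \ insert y U) y ≤
            (N (insert y U)).card + 1 + psDeg adj (N U) y := by
          have e1 : psDeg adj (N U) y = ((N U).filter (adj y)).card := by
            simp only [psDeg, Finset.card_filter]
          have e2 : psDeg adj (S \ insert y U) y = ((S \ insert y U).filter (adj y)).card := by
            simp only [psDeg, Finset.card_filter]
          have hu : N U ∪ (S \ insert y U).filter (adj y) ⊆ insert y (N (insert y U)) := by
            intro z hz
            rcases Finset.mem_union.mp hz with hz | hz
            · obtain ⟨hz1, w, hw, hwz⟩ := Finset.mem_filter.mp hz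
              rw [← hins] at hz1
              rcases Finset.mem_insert.mp hz1 with rfl | hz1
              · exact Finset.mem_insert_self _ _
              · exact Finset.mem_insert_of_mem (Finset.mem_filter.mpr
                  ⟨hz1, w, Finset.mem_insert_of_mem hw, hwz⟩)
            · obtain ⟨hz1, hz2⟩ := Finset.mem_filter.mp hz
              exact Finset.mem_insert_of_mem (Finset.mem_filter.mpr
                  ⟨hz1, y, Finset.mem_insert_self _ _, hz2⟩)
          have hitr : N U ∩ (S \ insert y U).filter (adj y) ⊆ (N U).filter (adj y) := by
            intro z hz
            obtain ⟨hz1, hz2⟩ := Finset.mem_inter.mp hz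
            exact Finset.mem_filter.mpr ⟨hz1, (Finset.mem_filter.mp hz2).2⟩
          have k1 := Finset.card_le_card hu
          have k2 := Finset.card_le_card hitr
          have k3 := Finset.card_union_add_card_inter (N U) ((S \ insert y U).filter (adj y))
          have k4 : y ∉ N (insert y U) := by simp [N]
          rw [Finset.card_insert_of_notMem k4] at k1
          rw [e1, e2]; omega
        rw [h1, h2] at hUE
        have hp : 2 ^ (r + 1) = 2 * 2 ^ r := by ring
        rw [hp] at hUE hlt
        nlinarith
      have hEN : 2 ^ r * (N U).card ≤ psE adj (N U) := by
        unfold psE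
        rw [mul_comm, ← smul_eq_mul]
        exact Finset.card_nsmul_le_sum _ _ _ hdeg
      obtain ⟨B, hB1, hB2, hB3⟩ := ihr _ (N U) rfl hN hEN
      have hNU : ∀ i, Disjoint U (B i) := by
        intro i
        rw [Finset.disjoint_left]
        intro z hz hz'
        have := (Finset.mem_filter.mp ((hB1 i).1 hz')).1
        exact (Finset.mem_sdiff.mp this).2 hz
      have hadj : ∀ i, ∃ x ∈ U, ∃ y ∈ B i, adj x y := by
        intro i
        obtain ⟨y, hy⟩ := (hB1 i).2.1
        obtain ⟨_, x, hx, hxy⟩ := Finset.mem_filter.mp ((hB1 i).1 hy)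
        exact ⟨x, hx, y, hy, hxy⟩
      refine ⟨Fin.cons U B, ?_, ?_, ?_⟩
      · intro i
        refine Fin.cases ?_ (fun i => ?_) i
        · exact ⟨hUS, hUne, hUc⟩
        · refine ⟨?_, (hB1 i).2.1, (hB1 i).2.2⟩
          intro z hz
          exact (Finset.mem_sdiff.mp (Finset.mem_filter.mp ((hB1 i).1 hz)).1).1
      · intro i j
        refine Fin.cases ?_ (fun i => ?_) i <;> refine Fin.cases ?_ (fun j => ?_) j
        · intro h; exact absurd rfl h
        · intro _; exact hNU j
        · intro _; exact (hNU i).symm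
        · intro h; exact hB2 i j (fun h' => h (by rw [h']))
      · intro i j
        refine Fin.cases ?_ (fun i => ?_) i <;> refine Fin.cases ?_ (fun j => ?_) j
        · intro h; exact absurd rfl h
        · intro _; exact hadj j
        · intro _
          obtain ⟨x, hx, y, hy, hxy⟩ := hadj i
          exact ⟨y, hy, x, hx, hs _ _ hxy⟩
        · intro h; exact hB3 i j (fun h' => h (by rw [h']))
    · rw [Finset.not_nonempty_iff_eq_empty] at hN
      rw [hN, Finset.card_empty, mul_zero, add_zero] at hUE
      have hne : (S \ U).Nonempty := by
        rw [Finset.nonempty_iff_ne_empty]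
        intro he
        rw [he] at hUE
        simp [psE] at hUE
      have hlt : (S \ U).card < m := by
        rw [← hm]
        apply Finset.card_lt_card
        refine ⟨Finset.sdiff_subset, fun h => ?_⟩
        obtain ⟨u, hu⟩ := hUne
        exact (Finset.mem_sdiff.mp (h (hUS hu))).2 hu
      obtain ⟨B, hB1, hB2, hB3⟩ := ihm _ hlt (S \ U) rfl hne (by
        refine le_trans ?_ hUE
        gcongr; omega)
      exact ⟨B, fun i => ⟨(hB1 i).1.trans Finset.sdiff_subset, (hB1 i).2⟩, hB2, hB3⟩

/-- Dense drawings have two independent edges which intersect. -/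
lemma ps_planar (adj : ℝ × ℝ → ℝ × ℝ → Prop) (hs : ∀ x y, adj x y → adj y x)
    (hi : ∀ x, ¬ adj x x) (T : ℝ × ℝ → ℝ × ℝ → Set (ℝ × ℝ))
    (hT : ∀ x y, adj x y → JoinedIn (T x y) x y) (S : Finset (ℝ × ℝ)) (hS : S.Nonempty)
    (hE : 16 * S.card ≤ psE adj S) :
    ∃ x ∈ S, ∃ y ∈ S, ∃ z ∈ S, ∃ w ∈ S, adj x y ∧ adj z w ∧ x ≠ z ∧ x ≠ w ∧ y ≠ z ∧ y ≠ w ∧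
      (T x y ∩ T z w).Nonempty := by
  obtain ⟨B, hB1, hB2, hB3⟩ := ps_minor adj hs hi 4 _ S rfl hS (by norm_num; exact hE)
  choose v hv using fun i => (hB1 i).2.1
  let F : Fin 5 → Fin 5 → Set (ℝ × ℝ) := fun i j =>
    {p | ∃ x ∈ B i ∪ B j, ∃ y ∈ B i ∪ B j, adj x y ∧ p ∈ T x y}
  have hF : ∀ i j, i < j → JoinedIn (F i j) (v i) (v j) := by
    intro i j hij
    obtain ⟨x, hx, y, hy, hxy⟩ := hB3 i j hij.ne
    have step : ∀ a ∈ B i ∪ B j, ∀ b ∈ B i ∪ B j, adj a b → JoinedIn (F i j) a b := by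
      intro a ha b hb hab
      exact (hT a b hab).mono (fun p hp => ⟨a, ha, b, hb, hab, hp⟩)
    have hxi : x ∈ B i ∪ B j := Finset.mem_union_left _ hx
    have hyi : y ∈ B i ∪ B j := Finset.mem_union_right _ hy
    have h1 := step x hxi y hyi hxy
    have h2 : JoinedIn (F i j) (v i) x := by
      have := (hB1 i).2.2 (v i) (hv i) x hx
      generalize v i = vi at this
      induction this using Relation.ReflTransGen.head_induction_on with
      | refl => exact JoinedIn.refl h1.source_mem
      | head hab _ ih =>
        exact (step _ (Finset.mem_union_left _ hab.2.1) _
          (Finset.mem_union_left _ hab.2.2) hab.1).trans ih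
    have h3 : JoinedIn (F i j) y (v j) := by
      have := (hB1 j).2.2 y hy (v j) (hv j)
      generalize v j = vj at this
      induction this with
      | refl => exact JoinedIn.refl h1.target_mem
      | tail _ hab ih =>
        exact ih.trans (step _ (Finset.mem_union_right _ hab.2.1) _
          (Finset.mem_union_right _ hab.2.2) hab.1)
    exact (h2.trans h1).trans h3
  obtain ⟨i, j, k, l, hij, hkl, hik, hil, hjk, hjl, p, ⟨x, hx, y, hy, hxy, hp⟩,
    ⟨z, hz, w, hw, hzw, hp'⟩⟩ := ps_K5 v F hF
  have hdis : Disjoint (B i ∪ B j) (B k ∪ B l) := by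
    simp only [Finset.disjoint_union_left, Finset.disjoint_union_right]
    exact ⟨⟨hB2 i k hik, hB2 j k hjk⟩, ⟨hB2 i l hil, hB2 j l hjl⟩⟩
  have hsub : ∀ i j, B i ∪ B j ⊆ S := fun i j => Finset.union_subset (hB1 i).1 (hB1 j).1
  rw [Finset.disjoint_left] at hdis
  refine ⟨x, hsub i j hx, y, hsub i j hy, z, hsub k l hz, w, hsub k l hw, hxy, hzw, ?_, ?_, ?_, ?_,
    p, hp, hp'⟩
  · rintro rfl; exact hdis hx hz
  · rintro rfl; exact hdis hx hw
  · rintro rfl; exact hdis hy hz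
  · rintro rfl; exact hdis hy hw

/-- Ordered pairs of independent intersecting edges. -/
noncomputable def psX {ι : Type} (A : Finset ι) (p q : ι → ℝ × ℝ) (T : ι → Set (ℝ × ℝ)) :
    Finset (ι × ι) :=
  (A ×ˢ A).filter (fun ab => p ab.1 ≠ p ab.2 ∧ p ab.1 ≠ q ab.2 ∧ q ab.1 ≠ p ab.2 ∧
    q ab.1 ≠ q ab.2 ∧ (T ab.1 ∩ T ab.2).Nonempty)

lemma ps_simple_exists {ι : Type} (A : Finset ι) (p q : ι → ℝ × ℝ) (T : ι → Set (ℝ × ℝ))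
    (hpq : ∀ a ∈ A, p a ≠ q a) (hT : ∀ a ∈ A, JoinedIn (T a) (p a) (q a))
    (hsimple : ∀ a ∈ A, ∀ b ∈ A, s(p a, q a) = s(p b, q b) → a = b)
    (S : Finset (ℝ × ℝ)) (hS : S.Nonempty) (hAS : ∀ a ∈ A, p a ∈ S ∧ q a ∈ S)
    (hE : 8 * S.card ≤ A.card) : (psX A p q T).Nonempty := by
  let adj : ℝ × ℝ → ℝ × ℝ → Prop := fun x y => ∃ a ∈ A, s(p a, q a) = s(x, y)
  have hs : ∀ x y, adj x y → adj y x := by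
    rintro x y ⟨a, ha, h⟩; exact ⟨a, ha, h.trans Sym2.eq_swap⟩
  have hi : ∀ x, ¬ adj x x := by
    rintro x ⟨a, ha, h⟩
    rw [Sym2.eq_iff] at h
    rcases h with ⟨h1, h2⟩ | ⟨h1, h2⟩ <;> exact hpq a ha (h1.trans h2.symm)
  let T' : ℝ × ℝ → ℝ × ℝ → Set (ℝ × ℝ) := fun x y =>
    {z | ∃ a ∈ A, s(p a, q a) = s(x, y) ∧ z ∈ T a}
  have hT' : ∀ x y, adj x y → JoinedIn (T' x y) x y := by
    rintro x y ⟨a, ha, h⟩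
    have h0 : JoinedIn (T a) x y := by
      have := hT a ha
      rw [Sym2.eq_iff] at h
      rcases h with ⟨h1, h2⟩ | ⟨h1, h2⟩
      · rwa [h1, h2] at this
      · rw [h1, h2] at this; exact this.symm
    exact h0.mono (fun z hz => ⟨a, ha, h, hz⟩)
  have hcount : 16 * S.card ≤ psE adj S := by
    have e1 : psE adj S = ((S ×ˢ S).filter (fun xy => adj xy.1 xy.2)).card := by
      rw [Finset.card_filter, Finset.sum_product]
      unfold psE
      refine Finset.sum_congr rfl fun x _ => Finset.sum_congr rfl fun y _ => ?_
      congr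
    have hsub : A.image (fun a => (p a, q a)) ∪ A.image (fun a => (q a, p a)) ⊆
        (S ×ˢ S).filter (fun xy => adj xy.1 xy.2) := by
      intro z hz
      rcases Finset.mem_union.mp hz with hz | hz <;>
        obtain ⟨a, ha, rfl⟩ := Finset.mem_image.mp hz
      · exact Finset.mem_filter.mpr ⟨Finset.mem_product.mpr (hAS a ha), a, ha, rfl⟩
      · exact Finset.mem_filter.mpr ⟨Finset.mem_product.mpr (hAS a ha).symm, a, ha, Sym2.eq_swap⟩
    have hdisj : Disjoint (A.image (fun a => (p a, q a))) (A.image (fun a => (q a, p a))) := by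
      rw [Finset.disjoint_left]
      intro z hz hz'
      obtain ⟨a, ha, rfl⟩ := Finset.mem_image.mp hz
      obtain ⟨b, hb, h⟩ := Finset.mem_image.mp hz'
      rw [Prod.mk.injEq] at h
      have hab : a = b := hsimple a ha b hb (by rw [← h.1, ← h.2]; exact Sym2.eq_swap)
      subst hab
      exact hpq a ha h.2
    have c1 : (A.image (fun a => (p a, q a))).card = A.card := by
      apply Finset.card_image_of_injOn
      intro a ha b hb h
      rw [Prod.mk.injEq] at h
      exact hsimple a ha b hb (by rw [h.1, h.2])
    have c2 : (A.image (fun a => (q a, p a))).card = A.card := by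
      apply Finset.card_image_of_injOn
      intro a ha b hb h
      rw [Prod.mk.injEq] at h
      exact hsimple a ha b hb (by rw [h.1, h.2])
    have := Finset.card_le_card hsub
    rw [Finset.card_union_of_disjoint hdisj, c1, c2, ← e1] at this
    omega
  obtain ⟨x, hx, y, hy, z, hz, w, hw, -, -, hxz, hxw, hyz, hyw, u, ⟨a, ha, hae, hua⟩,
    ⟨b, hb, hbe, hub⟩⟩ := ps_planar adj hs hi T' hT' S hS hcount
  refine ⟨(a, b), Finset.mem_filter.mpr ⟨Finset.mem_product.mpr ⟨ha, hb⟩, ?_⟩⟩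
  rw [Sym2.eq_iff] at hae hbe
  have hne : (T a ∩ T b).Nonempty := ⟨u, hua, hub⟩
  rcases hae with ⟨h1, h2⟩ | ⟨h1, h2⟩ <;> rcases hbe with ⟨h3, h4⟩ | ⟨h3, h4⟩ <;>
    simp only [h1, h2, h3, h4]
  · exact ⟨hxz, hxw, hyz, hyw, hne⟩
  · exact ⟨hxw, hxz, hyw, hyz, hne⟩
  · exact ⟨hyz, hyw, hxz, hxw, hne⟩
  · exact ⟨hyw, hyz, hxw, hxz, hne⟩

lemma ps_simple_cross {ι : Type} (p q : ι → ℝ × ℝ) (T : ι → Set (ℝ × ℝ))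
    (S : Finset (ℝ × ℝ)) (n : ℕ) : ∀ (A : Finset ι), A.card = n →
    (∀ a ∈ A, p a ≠ q a) → (∀ a ∈ A, JoinedIn (T a) (p a) (q a)) →
    (∀ a ∈ A, ∀ b ∈ A, s(p a, q a) = s(p b, q b) → a = b) →
    (∀ a ∈ A, p a ∈ S ∧ q a ∈ S) →
    A.card ≤ 8 * S.card + (psX A p q T).card := by
  induction n with
  | zero => intro A hA _ _ _ _; omega
  | succ n ih =>
    intro A hA hpq hT hsimple hAS
    by_cases hE : A.card < 8 * S.card
    · omega
    have hS : S.Nonempty := by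
      obtain ⟨a, ha⟩ : A.Nonempty := by rw [← Finset.card_pos]; omega
      exact ⟨_, (hAS a ha).1⟩
    obtain ⟨⟨a, b⟩, hab⟩ := ps_simple_exists A p q T hpq hT hsimple S hS hAS (not_lt.mp hE)
    have ha : a ∈ A := (Finset.mem_product.mp (Finset.mem_filter.mp hab).1).1
    have hc : (A.erase a).card = n := by rw [Finset.card_erase_of_mem ha, hA]; rfl
    have hsub : ∀ x ∈ A.erase a, x ∈ A := fun x hx => Finset.mem_of_mem_erase hx
    have := ih (A.erase a) hc (fun x hx => hpq x (hsub x hx)) (fun x hx => hT x (hsub x hx))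
      (fun x hx y hy => hsimple x (hsub x hx) y (hsub y hy)) (fun x hx => hAS x (hsub x hx))
    have hlt : (psX (A.erase a) p q T).card < (psX A p q T).card := by
      apply Finset.card_lt_card
      refine ⟨?_, fun h => ?_⟩
      · intro xy hxy
        obtain ⟨h1, h2⟩ := Finset.mem_filter.mp hxy
        obtain ⟨h3, h4⟩ := Finset.mem_product.mp h1
        exact Finset.mem_filter.mpr ⟨Finset.mem_product.mpr ⟨hsub _ h3, hsub _ h4⟩, h2⟩
      · have := (Finset.mem_product.mp (Finset.mem_filter.mp (h hab)).1).1
        simp at this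
    omega

lemma ps_count {κ : Type*} [Fintype κ] (t : ℕ) (K : Finset κ) (g : κ → Fin t) :
    ((Finset.univ : Finset (κ → Fin t)).filter (fun f => ∀ x ∈ K, f x = g x)).card * t ^ K.card
      = t ^ Fintype.card κ := by
  have h1 : (Finset.univ : Finset (κ → Fin t)).filter (fun f => ∀ x ∈ K, f x = g x) =
      Fintype.piFinset (fun x => if x ∈ K then {g x} else Finset.univ) := by
    ext f
    simp only [Finset.mem_filter, Finset.mem_univ, true_and, Fintype.mem_piFinset]
    refine forall_congr' fun x => ?_
    by_cases hx : x ∈ K <;> simp [hx]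
  rw [h1, Fintype.card_piFinset]
  have h2 : t ^ K.card = ∏ x : κ, if x ∈ K then t else 1 := by
    rw [Finset.prod_ite_mem, Finset.univ_inter, Finset.prod_const]
  rw [h2, ← Finset.prod_mul_distrib, ← Finset.card_univ, ← Finset.prod_const]
  apply Finset.prod_congr rfl
  intro x _
  by_cases hx : x ∈ K <;> simp [hx]

lemma ps_inj_fin {ι : Type*} (F : Finset ι) (M : ℕ) (hM : 0 < M) (h : F.card ≤ M) :
    ∃ f : ι → Fin M, Set.InjOn f F := by
  obtain ⟨e⟩ : Nonempty (F ↪ Fin M) := by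
    apply Function.Embedding.nonempty_of_card_le; simpa using h
  refine ⟨fun x => if hx : x ∈ F then e ⟨x, hx⟩ else ⟨0, hM⟩, ?_⟩
  intro x hx y hy hxy
  have hx' : x ∈ F := hx
  have hy' : y ∈ F := hy
  simp only [hx', hy', dif_pos] at hxy
  exact congrArg Subtype.val (e.injective hxy)

/-- Swap of summation used for averaging. -/
lemma ps_swap {α β : Type*} (A : Finset α) (H : Finset β) (R : α → β → Prop)
    [∀ h, DecidablePred (fun a => R a h)] [∀ a, DecidablePred (fun h => R a h)] :
    ∑ h ∈ H, (A.filter (fun a => R a h)).card = ∑ a ∈ A, (H.filter (fun h => R a h)).card := by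
  simp only [Finset.card_filter]
  rw [Finset.sum_comm]

lemma ps_multi_cross {ι : Type} (p q : ι → ℝ × ℝ) (T : ι → Set (ℝ × ℝ))
    (S : Finset (ℝ × ℝ)) (A : Finset ι) (M : ℕ) (hM : 0 < M)
    (hpq : ∀ a ∈ A, p a ≠ q a) (hT : ∀ a ∈ A, JoinedIn (T a) (p a) (q a))
    (hmult : ∀ a ∈ A, (A.filter (fun b => s(p b, q b) = s(p a, q a))).card ≤ M)
    (hAS : ∀ a ∈ A, p a ∈ S ∧ q a ∈ S) :
    M * A.card ≤ 8 * M ^ 2 * S.card + (psX A p q T).card := by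
  have hcol : ∀ z : Sym2 (ℝ × ℝ), ∃ f : ι → Fin M,
      Set.InjOn f (A.filter (fun b => s(p b, q b) = z)) := by
    intro z
    apply ps_inj_fin _ M hM
    by_cases h : ∃ a ∈ A, s(p a, q a) = z
    · obtain ⟨a, ha, rfl⟩ := h
      exact hmult a ha
    · rw [Finset.filter_eq_empty_iff.mpr (fun a ha h' => h ⟨a, ha, h'⟩)]; simp
  choose col hcol using hcol
  let κ := {z // z ∈ A.image (fun a => s(p a, q a))}
  have hmem : ∀ a ∈ A, s(p a, q a) ∈ A.image (fun a => s(p a, q a)) :=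
    fun a ha => Finset.mem_image_of_mem _ ha
  -- the relation: edge a survives in h
  obtain ⟨R, hR⟩ : ∃ R : ι → (κ → Fin M) → Prop, ∀ a h, R a h ↔
      ∀ z : κ, z.1 = s(p a, q a) → h z = col (s(p a, q a)) a := ⟨_, fun _ _ => Iff.rfl⟩
  have key : ∀ h : κ → Fin M, (A.filter (fun a => R a h)).card ≤
      8 * S.card + ((psX A p q T).filter (fun ab => R ab.1 h ∧ R ab.2 h)).card := by
    intro h
    have hf : ∀ a ∈ A.filter (fun a => R a h), a ∈ A := fun a ha => (Finset.mem_filter.mp ha).1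
    have := ps_simple_cross p q T S _ (A.filter (fun a => R a h)) rfl
      (fun a ha => hpq a (hf a ha)) (fun a ha => hT a (hf a ha)) ?_ (fun a ha => hAS a (hf a ha))
    · refine this.trans (Nat.add_le_add_left (Finset.card_le_card ?_) _)
      intro ab hab
      obtain ⟨h1, h2⟩ := Finset.mem_filter.mp hab
      obtain ⟨h3, h4⟩ := Finset.mem_product.mp h1
      obtain ⟨h5, h6⟩ := Finset.mem_filter.mp h3
      obtain ⟨h7, h8⟩ := Finset.mem_filter.mp h4
      exact Finset.mem_filter.mpr
        ⟨Finset.mem_filter.mpr ⟨Finset.mem_product.mpr ⟨h5, h7⟩, h2⟩, h6, h8⟩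
    · intro a ha b hb hab
      obtain ⟨ha, hRa⟩ := Finset.mem_filter.mp ha
      obtain ⟨hb, hRb⟩ := Finset.mem_filter.mp hb
      have e1 := (hR _ _).mp hRa ⟨_, hmem a ha⟩ rfl
      have e2 := (hR _ _).mp hRb ⟨_, hmem a ha⟩ hab
      rw [e1, ← hab] at e2
      exact hcol (s(p a, q a)) (by simp [ha]) (by simp [hb, hab]) e2
  have hsum := Finset.sum_le_sum (s := (Finset.univ : Finset (κ → Fin M))) (fun h _ => key h)
  rw [Finset.sum_add_distrib, ps_swap A, ps_swap (psX A p q T)] at hsum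
  set W := M ^ Fintype.card κ with hW
  have hcard : (Finset.univ : Finset (κ → Fin M)).card = W := by
    rw [Finset.card_univ, Fintype.card_fun, Fintype.card_fin]
  have s1 : ∀ a ∈ A, ((Finset.univ : Finset (κ → Fin M)).filter (fun h => R a h)).card * M = W := by
    intro a ha
    have := ps_count M ({⟨_, hmem a ha⟩} : Finset κ) (fun _ => col (s(p a, q a)) a)
    rw [Finset.card_singleton, pow_one] at this
    rw [hW, ← this]
    congr 2
    ext h
    simp only [Finset.mem_filter, Finset.mem_univ, true_and, hR, Finset.mem_singleton]
    constructor
    · intro H z hz; exact H z (by rw [hz])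
    · intro H z hz; exact H z (Subtype.ext hz)
  have s2 : ∀ ab ∈ psX A p q T, ((Finset.univ : Finset (κ → Fin M)).filter
      (fun h => R ab.1 h ∧ R ab.2 h)).card * M ^ 2 = W := by
    rintro ⟨a, b⟩ hab
    obtain ⟨h1, h2⟩ := Finset.mem_filter.mp hab
    obtain ⟨ha, hb⟩ := Finset.mem_product.mp h1
    simp only at ha hb h2
    have hne : s(p a, q a) ≠ s(p b, q b) := by
      intro h
      rw [Sym2.eq_iff] at h
      rcases h with h | h
      · exact h2.1 h.1
      · exact h2.2.1 h.1
    have := ps_count M ({⟨_, hmem a ha⟩, ⟨_, hmem b hb⟩} : Finset κ)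
      (fun z => if z.1 = s(p a, q a) then col (s(p a, q a)) a else col (s(p b, q b)) b)
    rw [Finset.card_pair (fun h => hne (congrArg Subtype.val h))] at this
    rw [hW, ← this]
    congr 2
    ext h
    simp only [Finset.mem_filter, Finset.mem_univ, true_and, hR, Finset.mem_insert,
      Finset.mem_singleton]
    constructor
    · rintro ⟨H1, H2⟩ z (rfl | rfl)
      · simp only [if_true]; exact H1 _ rfl
      · simp only [hne.symm, if_false]; exact H2 _ rfl
    · intro H
      constructor
      · intro z hz
        have := H z (Or.inl (Subtype.ext hz))
        rwa [if_pos hz] at this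
      · intro z hz
        have := H z (Or.inr (Subtype.ext hz))
        rwa [if_neg (by rw [hz]; exact hne.symm)] at this
  have t1 : (∑ a ∈ A, ((Finset.univ : Finset (κ → Fin M)).filter (fun h => R a h)).card) * M =
      A.card * W := by
    rw [Finset.sum_mul, Finset.sum_congr rfl s1, Finset.sum_const, smul_eq_mul]
  have t2 : (∑ ab ∈ psX A p q T, ((Finset.univ : Finset (κ → Fin M)).filter
      (fun h => R ab.1 h ∧ R ab.2 h)).card) * M ^ 2 = (psX A p q T).card * W := by
    rw [Finset.sum_mul, Finset.sum_congr rfl s2, Finset.sum_const, smul_eq_mul]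
  rw [Finset.sum_const, smul_eq_mul, hcard] at hsum
  have hWpos : 0 < W := pow_pos hM _
  apply Nat.le_of_mul_le_mul_right _ hWpos
  have := Nat.mul_le_mul_right (M ^ 2) hsum
  rw [add_mul, t2] at this
  calc M * A.card * W = M * (A.card * W) := by ring
    _ = (∑ a ∈ A, ((Finset.univ : Finset (κ → Fin M)).filter (fun h => R a h)).card) * M ^ 2 := by
        rw [← t1]; ring
    _ ≤ _ := this
    _ = _ := by ring

lemma ps_sample_cross {ι : Type} (p q : ι → ℝ × ℝ) (T : ι → Set (ℝ × ℝ))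
    (P : Finset (ℝ × ℝ)) (A : Finset ι) (M : ℕ) (hM : 0 < M)
    (hpq : ∀ a ∈ A, p a ≠ q a) (hT : ∀ a ∈ A, JoinedIn (T a) (p a) (q a))
    (hmult : ∀ a ∈ A, (A.filter (fun b => s(p b, q b) = s(p a, q a))).card ≤ M)
    (hAS : ∀ a ∈ A, p a ∈ P ∧ q a ∈ P) (t : ℕ) (ht : 0 < t) :
    M * A.card * t ^ 2 ≤ 8 * M ^ 2 * P.card * t ^ 3 + (psX A p q T).card := by
  let o : Fin t := ⟨0, ht⟩
  let κ := {z // z ∈ P}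
  -- the event that x survives
  obtain ⟨R, hR⟩ : ∃ R : ℝ × ℝ → (κ → Fin t) → Prop, ∀ x f, R x f ↔
      ∀ z : κ, z.1 = x → f z = o := ⟨_, fun _ _ => Iff.rfl⟩
  have key : ∀ f : κ → Fin t, M * (A.filter (fun a => R (p a) f ∧ R (q a) f)).card ≤
      8 * M ^ 2 * (P.filter (fun x => R x f)).card + ((psX A p q T).filter (fun ab =>
        (R (p ab.1) f ∧ R (q ab.1) f) ∧ (R (p ab.2) f ∧ R (q ab.2) f))).card := by
    intro f
    set A' := A.filter (fun a => R (p a) f ∧ R (q a) f) with hA'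
    have hf : ∀ a ∈ A', a ∈ A := fun a ha => (Finset.mem_filter.mp ha).1
    have := ps_multi_cross p q T (P.filter (fun x => R x f)) A' M hM
      (fun a ha => hpq a (hf a ha)) (fun a ha => hT a (hf a ha))
      (fun a ha => (Finset.card_le_card
        (Finset.filter_subset_filter _ (Finset.filter_subset _ _))).trans (hmult a (hf a ha)))
      (fun a ha => by
        obtain ⟨h1, h2, h3⟩ := Finset.mem_filter.mp ha
        exact ⟨Finset.mem_filter.mpr ⟨(hAS a h1).1, h2⟩, Finset.mem_filter.mpr ⟨(hAS a h1).2, h3⟩⟩)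
    refine this.trans (Nat.add_le_add_left (Finset.card_le_card ?_) _)
    intro ab hab
    obtain ⟨h1, h2⟩ := Finset.mem_filter.mp hab
    obtain ⟨h3, h4⟩ := Finset.mem_product.mp h1
    obtain ⟨h5, h6⟩ := Finset.mem_filter.mp h3
    obtain ⟨h7, h8⟩ := Finset.mem_filter.mp h4
    exact Finset.mem_filter.mpr
      ⟨Finset.mem_filter.mpr ⟨Finset.mem_product.mpr ⟨h5, h7⟩, h2⟩, h6, h8⟩
  have hsum := Finset.sum_le_sum (s := (Finset.univ : Finset (κ → Fin t))) (fun h _ => key h)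
  rw [Finset.sum_add_distrib, ← Finset.mul_sum, ← Finset.mul_sum, ps_swap A, ps_swap P, ps_swap (psX A p q T)] at hsum
  set W := t ^ Fintype.card κ with hW
  have cnt : ∀ K : Finset (ℝ × ℝ), K ⊆ P → ((Finset.univ : Finset (κ → Fin t)).filter
      (fun f => ∀ x ∈ K, R x f)).card * t ^ K.card = W := by
    intro K hK
    have := ps_count t (K.subtype (· ∈ P)) (fun _ => o)
    rw [Finset.card_subtype, Finset.filter_true_of_mem (fun x hx => hK hx)] at this
    rw [hW, ← this]
    congr 2
    ext f
    simp only [Finset.mem_filter, Finset.mem_univ, true_and, hR, Finset.mem_subtype]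
    constructor
    · intro H x hx; exact H x.1 hx x rfl
    · rintro H x hx z rfl; exact H z hx
  have s0 : ∀ x ∈ P, ((Finset.univ : Finset (κ → Fin t)).filter (fun f => R x f)).card * t = W := by
    intro x hx
    have := cnt {x} (by simpa using hx)
    simpa using this
  have s1 : ∀ a ∈ A, ((Finset.univ : Finset (κ → Fin t)).filter
      (fun f => R (p a) f ∧ R (q a) f)).card * t ^ 2 = W := by
    intro a ha
    have := cnt {p a, q a} (by
      intro x hx
      simp only [Finset.mem_insert, Finset.mem_singleton] at hx
      rcases hx with rfl | rfl
      · exact (hAS a ha).1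
      · exact (hAS a ha).2)
    rw [Finset.card_pair (hpq a ha)] at this
    simpa using this
  have s2 : ∀ ab ∈ psX A p q T, ((Finset.univ : Finset (κ → Fin t)).filter
      (fun f => (R (p ab.1) f ∧ R (q ab.1) f) ∧ (R (p ab.2) f ∧ R (q ab.2) f))).card * t ^ 4
        = W := by
    rintro ⟨a, b⟩ hab
    obtain ⟨h1, h2, h3, h4, h5, -⟩ := Finset.mem_filter.mp hab
    obtain ⟨ha, hb⟩ := Finset.mem_product.mp h1
    simp only at ha hb h2 h3 h4 h5
    have := cnt {p a, q a, p b, q b} (by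
      intro x hx
      simp only [Finset.mem_insert, Finset.mem_singleton] at hx
      rcases hx with rfl | rfl | rfl | rfl
      · exact (hAS a ha).1
      · exact (hAS a ha).2
      · exact (hAS b hb).1
      · exact (hAS b hb).2)
    have hc : ({p a, q a, p b, q b} : Finset (ℝ × ℝ)).card = 4 := by
      rw [Finset.card_insert_of_notMem, Finset.card_insert_of_notMem, Finset.card_pair (hpq b hb)]
      · simp [h4, h5]
      · simp [h2, h3, hpq a ha]
    rw [hc] at this
    simpa [and_assoc] using this
  have t0 : (∑ x ∈ P, ((Finset.univ : Finset (κ → Fin t)).filter (fun f => R x f)).card) * t =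
      P.card * W := by
    rw [Finset.sum_mul, Finset.sum_congr rfl s0, Finset.sum_const, smul_eq_mul]
  have t1 : (∑ a ∈ A, ((Finset.univ : Finset (κ → Fin t)).filter
      (fun f => R (p a) f ∧ R (q a) f)).card) * t ^ 2 = A.card * W := by
    rw [Finset.sum_mul, Finset.sum_congr rfl s1, Finset.sum_const, smul_eq_mul]
  have t2 : (∑ ab ∈ psX A p q T, ((Finset.univ : Finset (κ → Fin t)).filter
      (fun f => (R (p ab.1) f ∧ R (q ab.1) f) ∧ (R (p ab.2) f ∧ R (q ab.2) f))).card) * t ^ 4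
        = (psX A p q T).card * W := by
    rw [Finset.sum_mul, Finset.sum_congr rfl s2, Finset.sum_const, smul_eq_mul]
  have hWpos : 0 < W := pow_pos ht _
  apply Nat.le_of_mul_le_mul_right _ hWpos
  have := Nat.mul_le_mul_right (t ^ 4) hsum
  rw [add_mul, t2] at this
  calc M * A.card * t ^ 2 * W = M * t ^ 2 * (A.card * W) := by ring
    _ = _ := by rw [← t1]; ring
    _ ≤ _ := this
    _ = 8 * M ^ 2 * t ^ 3 * ((∑ x ∈ P, ((Finset.univ : Finset (κ → Fin t)).filter
        (fun f => R x f)).card) * t) + (psX A p q T).card * W := by ring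
    _ = _ := by rw [t0]; ring

/-- Crossing lemma for multigraphs with multiplicity at most `M`. -/
lemma ps_crossing {ι : Type} (p q : ι → ℝ × ℝ) (T : ι → Set (ℝ × ℝ))
    (P : Finset (ℝ × ℝ)) (A : Finset ι) (M : ℕ) (hM : 0 < M)
    (hpq : ∀ a ∈ A, p a ≠ q a) (hT : ∀ a ∈ A, JoinedIn (T a) (p a) (q a))
    (hmult : ∀ a ∈ A, (A.filter (fun b => s(p b, q b) = s(p a, q a))).card ≤ M)
    (hAS : ∀ a ∈ A, p a ∈ P ∧ q a ∈ P) :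
    A.card ≤ 16 * M * P.card ∨
      A.card ^ 3 ≤ 2048 * M * P.card ^ 2 * (psX A p q T).card := by
  by_cases h : A.card ≤ 16 * M * P.card
  · exact Or.inl h
  right
  push Not at h
  by_cases hP : P.card = 0
  · have : A = ∅ := by
      rw [Finset.eq_empty_iff_forall_notMem]
      intro a ha
      have := (hAS a ha).1
      rw [Finset.card_eq_zero.mp hP] at this
      simp at this
    simp [this]
  set m := P.card
  set e := A.card
  set X := (psX A p q T).card
  have hD : 0 < 16 * M * m := by positivity
  obtain ⟨t, ht1, ht2⟩ : ∃ t : ℕ, 16 * M * m * t ≤ e ∧ e < 16 * M * m * (t + 1) :=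
    ⟨e / (16 * M * m), Nat.mul_div_le _ _, by
      have := Nat.lt_mul_div_succ e hD; simpa using this⟩
  have ht : 0 < t := by
    rcases Nat.eq_zero_or_pos t with rfl | h'
    · simp at ht2; omega
    · exact h'
  have hs := ps_sample_cross p q T P A M hM hpq hT hmult hAS t ht
  change M * e * t ^ 2 ≤ 8 * M ^ 2 * m * t ^ 3 + X at hs
  have h1 : M * e * t ^ 2 ≤ 2 * X := by
    have : 2 * (8 * M ^ 2 * m * t ^ 3) ≤ M * e * t ^ 2 := by
      calc 2 * (8 * M ^ 2 * m * t ^ 3) = M * t ^ 2 * (16 * M * m * t) := by ring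
        _ ≤ M * t ^ 2 * e := Nat.mul_le_mul_left _ ht1
        _ = _ := by ring
    omega
  have h2 : e ≤ 32 * M * m * t := by
    have : 16 * M * m * (t + 1) ≤ 16 * M * m * (2 * t) := Nat.mul_le_mul_left _ (by omega)
    calc e ≤ 16 * M * m * (2 * t) := (ht2.le).trans this
      _ = _ := by ring
  calc e ^ 3 = e * e ^ 2 := by ring
    _ ≤ e * (32 * M * m * t) ^ 2 := by gcongr
    _ = 1024 * M * m ^ 2 * (M * e * t ^ 2) := by ring
    _ ≤ 1024 * M * m ^ 2 * (2 * X) := by gcongr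
    _ = _ := by ring

/-- For a fixed point `p`, few of the sets through `p` consist of points `q` only such that the
pair `p, q` is contained in many sets. -/
lemma ps_bad {ι : Type} (k : ℕ) (P : Finset (ℝ × ℝ)) (A : Finset ι) (Sp : ι → Finset (ℝ × ℝ))
    (hcard : ∀ a ∈ A, (Sp a).card = k + 1) (hsub : ∀ a ∈ A, Sp a ⊆ P)
    (hinj : ∀ a ∈ A, ∀ b ∈ A, Sp a = Sp b → a = b) (p : ℝ × ℝ) (M : ℕ) (hM : 0 < M) :
    ((A.filter (fun a => p ∈ Sp a ∧ ∀ q ∈ Sp a, q ≠ p →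
      M < (A.filter (fun b => p ∈ Sp b ∧ q ∈ Sp b)).card)).card : ℝ) ≤
      (k * ((A.filter (fun a => p ∈ Sp a)).card : ℝ) / M) ^ k := by
  set B := A.filter (fun a => p ∈ Sp a ∧ ∀ q ∈ Sp a, q ≠ p →
      M < (A.filter (fun b => p ∈ Sp b ∧ q ∈ Sp b)).card) with hB
  set Ap := A.filter (fun a => p ∈ Sp a) with hAp
  set Hv := (P.erase p).filter (fun q => M < (A.filter (fun b => p ∈ Sp b ∧ q ∈ Sp b)).card) with hHv
  have h1 : Hv.card * M ≤ k * Ap.card := by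
    calc Hv.card * M ≤ ∑ q ∈ Hv, (A.filter (fun b => p ∈ Sp b ∧ q ∈ Sp b)).card := by
          rw [← smul_eq_mul]
          exact Finset.card_nsmul_le_sum _ _ _ (fun q hq => (Finset.mem_filter.mp hq).2.le)
      _ ≤ ∑ q ∈ P.erase p, (A.filter (fun b => p ∈ Sp b ∧ q ∈ Sp b)).card :=
          Finset.sum_le_sum_of_subset (Finset.filter_subset _ _)
      _ = ∑ q ∈ P.erase p, (Ap.filter (fun b => q ∈ Sp b)).card := by
          refine Finset.sum_congr rfl fun q _ => ?_
          rw [hAp, Finset.filter_filter]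
      _ = ∑ b ∈ Ap, ((P.erase p).filter (fun q => q ∈ Sp b)).card :=
          ps_swap Ap (P.erase p) (fun b q => q ∈ Sp b)
      _ ≤ ∑ b ∈ Ap, k := by
          refine Finset.sum_le_sum fun b hb => ?_
          obtain ⟨hbA, hpb⟩ := Finset.mem_filter.mp hb
          have : (P.erase p).filter (fun q => q ∈ Sp b) ⊆ (Sp b).erase p := by
            intro q hq
            obtain ⟨h1, h2⟩ := Finset.mem_filter.mp hq
            exact Finset.mem_erase.mpr ⟨(Finset.mem_erase.mp h1).1, h2⟩
          have h3 := Finset.card_le_card this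
          rw [Finset.card_erase_of_mem hpb, hcard b hbA] at h3
          simpa using h3
      _ = k * Ap.card := by rw [Finset.sum_const, smul_eq_mul, mul_comm]
  have h2 : B.card ≤ Hv.card ^ k := by
    have : B.card ≤ (Finset.powersetCard k Hv).card := by
      apply Finset.card_le_card_of_injOn (fun a => (Sp a).erase p)
      · intro a ha
        obtain ⟨haA, hpa, hq⟩ := Finset.mem_filter.mp ha
        refine Finset.mem_powersetCard.mpr ⟨?_, ?_⟩
        · intro q hq'
          obtain ⟨h4, h5⟩ := Finset.mem_erase.mp hq'
          exact Finset.mem_filter.mpr ⟨Finset.mem_erase.mpr ⟨h4, hsub a haA h5⟩, hq q h5 h4⟩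
        · rw [Finset.card_erase_of_mem hpa, hcard a haA]; simp
      · intro a ha b hb hab
        obtain ⟨haA, hpa, -⟩ := Finset.mem_filter.mp ha
        obtain ⟨hbA, hpb, -⟩ := Finset.mem_filter.mp hb
        apply hinj a haA b hbA
        rw [← Finset.insert_erase hpa, ← Finset.insert_erase hpb]
        exact congrArg _ hab
    rw [Finset.card_powersetCard] at this
    exact this.trans (Nat.choose_le_pow _ _)
  have hM' : (0 : ℝ) < M := by exact_mod_cast hM
  have h3 : (Hv.card : ℝ) ≤ k * (Ap.card : ℝ) / M := by
    rw [le_div_iff₀ hM']; exact_mod_cast h1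
  calc (B.card : ℝ) ≤ (Hv.card : ℝ) ^ k := by exact_mod_cast h2
    _ ≤ _ := by gcongr

set_option maxHeartbeats 2000000 in
lemma ps_chunks (k : ℕ) (hk : 1 ≤ k) {ι : Type} (T : ι → Set (ℝ × ℝ))
    (Sp : ι → Finset (ℝ × ℝ)) (X : ℕ) (n : ℕ) : ∀ (P : Finset (ℝ × ℝ)) (A : Finset ι), P.card = n →
    (∀ a ∈ A, (Sp a).card = k + 1) → (∀ a ∈ A, Sp a ⊆ P) →
    (∀ a ∈ A, ∀ x ∈ Sp a, ∀ y ∈ Sp a, JoinedIn (T a) x y) →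
    (∀ a ∈ A, ∀ b ∈ A, Sp a = Sp b → a = b) →
    ((A ×ˢ A).filter (fun ab => ab.1 ≠ ab.2 ∧ (T ab.1 ∩ T ab.2).Nonempty)).card ≤ X →
    (A.card : ℝ) ≤ (262144 * (16 * (k + 1) * k)) ^ k * P.card ∨
    (A.card : ℝ) ^ (2 * k + 1) ≤
      (262144 * (16 * (k + 1) * k)) ^ k * (P.card : ℝ) ^ (k + 1) * (X : ℝ) ^ k := by
  induction n using Nat.strong_induction_on with
  | _ n ih =>
  intro P A hPn hcard hsub hjoin hinj hX
  have hk' : (1 : ℝ) ≤ k := by exact_mod_cast hk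
  set K : ℝ := 16 * (k + 1) * k with hK
  have hK1 : 1 ≤ K := by rw [hK]; nlinarith
  set C : ℝ := (262144 * K) ^ k with hC
  have hC1 : 1 ≤ C := one_le_pow₀ (by linarith)
  clear_value C K
  set N := A.card with hN
  set m := P.card with hm
  clear_value N m
  by_cases hNm : N ≤ m
  · left
    have : (N : ℝ) ≤ m := by exact_mod_cast hNm
    have h0 : (0 : ℝ) ≤ m := Nat.cast_nonneg _
    nlinarith
  push Not at hNm
  have hNpos : 0 < N := by omega
  have hmpos : 0 < m := by
    obtain ⟨a, ha⟩ := Finset.card_pos.mp (hN ▸ hNpos)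
    have := Finset.card_le_card (hsub a ha)
    rw [hcard a ha] at this; omega
  have hmR : (0 : ℝ) < m := by exact_mod_cast hmpos
  have hNR : (0 : ℝ) < N := by exact_mod_cast hNpos
  have hNmR : (m : ℝ) < N := by exact_mod_cast hNm
  let deg : ℝ × ℝ → ℕ := fun p => (A.filter (fun a => p ∈ Sp a)).card
  have hdegsum : ∑ p ∈ P, deg p = (k + 1) * N := by
    calc ∑ p ∈ P, deg p = ∑ a ∈ A, (P.filter (fun p => p ∈ Sp a)).card :=
          ps_swap A P (fun a p => p ∈ Sp a)
      _ = ∑ a ∈ A, (k + 1) := by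
          refine Finset.sum_congr rfl fun a ha => ?_
          rw [← hcard a ha]; congr 1
          ext x; simp only [Finset.mem_filter]
          exact ⟨fun h => h.2, fun h => ⟨hsub a ha h, h⟩⟩
      _ = _ := by rw [Finset.sum_const, smul_eq_mul, mul_comm, ← hN]
  set H := P.filter (fun p => 4 * (k + 1) * N < deg p * m) with hH
  have hHcard : 4 * H.card ≤ m := by
    have h1 : H.card * (4 * (k + 1) * N) ≤ ∑ p ∈ H, deg p * m := by
      rw [← smul_eq_mul]
      exact Finset.card_nsmul_le_sum _ _ _ (fun q hq => (Finset.mem_filter.mp hq).2.le)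
    have h2 : ∑ p ∈ H, deg p * m ≤ (k + 1) * N * m := by
      rw [← hdegsum, Finset.sum_mul]
      exact Finset.sum_le_sum_of_subset (Finset.filter_subset _ _)
    have h3 : ((k + 1) * N) * (4 * H.card) ≤ ((k + 1) * N) * m := by
      calc _ = H.card * (4 * (k + 1) * N) := by ring
        _ ≤ _ := h1.trans h2
    exact Nat.le_of_mul_le_mul_left h3 (by positivity)
  have hHR : (H.card : ℝ) ≤ m / 4 := by
    rw [le_div_iff₀ (by norm_num)]; rw [mul_comm]; exact_mod_cast hHcard
  set A' := A.filter (fun a => Sp a ⊆ H) with hA'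
  by_cases hcase : N ≤ 2 * A'.card
  · have hcR : (N : ℝ) ≤ 2 * A'.card := by exact_mod_cast hcase
    have hmem : ∀ a ∈ A', a ∈ A := fun a ha => (Finset.mem_filter.mp ha).1
    have := ih H.card (by omega) H A' rfl (fun a ha => hcard a (hmem a ha))
      (fun a ha => (Finset.mem_filter.mp ha).2) (fun a ha => hjoin a (hmem a ha))
      (fun a ha b hb => hinj a (hmem a ha) b (hmem b hb)) (by
        refine le_trans (Finset.card_le_card ?_) hX
        apply Finset.filter_subset_filter
        exact Finset.product_subset_product (Finset.filter_subset _ _) (Finset.filter_subset _ _))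
    rcases this with h | h
    · left
      have : C * H.card ≤ C * (m / 4) := by gcongr
      nlinarith
    · right
      calc (N : ℝ) ^ (2 * k + 1) ≤ (2 * A'.card) ^ (2 * k + 1) := by gcongr
        _ = 2 ^ (2 * k + 1) * (A'.card : ℝ) ^ (2 * k + 1) := by rw [mul_pow]
        _ ≤ 2 ^ (2 * k + 1) * (C * (H.card : ℝ) ^ (k + 1) * (X : ℝ) ^ k) := by gcongr
        _ ≤ 2 ^ (2 * k + 1) * (C * (m / 4 : ℝ) ^ (k + 1) * (X : ℝ) ^ k) := by gcongr
        _ = (1 / 2) * (C * (m : ℝ) ^ (k + 1) * (X : ℝ) ^ k) := by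
            have : (2 : ℝ) ^ (2 * k + 1) * (1 / 4) ^ (k + 1) = 1 / 2 := by
              rw [pow_succ, pow_mul, pow_succ]
              have : ((2:ℝ) ^ 2) ^ k * (1 / 4) ^ k = 1 := by
                rw [← mul_pow]; norm_num
              linear_combination (1/2) * this
            rw [div_eq_mul_one_div (m : ℝ) 4, mul_pow]
            linear_combination (C * (m : ℝ) ^ (k + 1) * (X : ℝ) ^ k) * this
        _ ≤ C * (m : ℝ) ^ (k + 1) * (X : ℝ) ^ k := by
            have : 0 ≤ C * (m : ℝ) ^ (k + 1) * (X : ℝ) ^ k := by positivity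
            linarith
  push Not at hcase
  -- the root of the density
  obtain ⟨δ, hδ1, hδ⟩ : ∃ δ : ℝ, 1 ≤ δ ∧ δ ^ k * m = N := by
    refine ⟨((N : ℝ) / m) ^ ((1 : ℝ) / k), ?_, ?_⟩
    · apply Real.one_le_rpow _ (by positivity)
      rw [le_div_iff₀ hmR]; linarith
    · rw [← Real.rpow_natCast, ← Real.rpow_mul (by positivity),
        one_div_mul_cancel (by positivity), Real.rpow_one, div_mul_cancel₀ _ hmR.ne']
  have hδ0 : 0 < δ := by linarith
  obtain ⟨j, rfl⟩ : ∃ j, k = j + 1 := ⟨k - 1, by omega⟩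
  have hKd1 : 1 ≤ K * δ ^ j := by
    have := one_le_pow₀ (n := j) hδ1
    nlinarith
  obtain ⟨M, hM1, hM2⟩ : ∃ M : ℕ, K * δ ^ j ≤ M ∧ (M : ℝ) ≤ 2 * (K * δ ^ j) := by
    refine ⟨⌈K * δ ^ j⌉₊, Nat.le_ceil _, ?_⟩
    have := Nat.ceil_lt_add_one (a := K * δ ^ j) (by linarith)
    linarith
  have hMR : (0 : ℝ) < M := by linarith
  have hMpos : 0 < M := by exact_mod_cast hMR
  -- bad sets
  let bad : ℝ × ℝ → Finset ι := fun p => A.filter (fun a => p ∈ Sp a ∧ ∀ q ∈ Sp a, q ≠ p →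
      M < (A.filter (fun b => p ∈ Sp b ∧ q ∈ Sp b)).card)
  have hbad : ∀ p ∈ P \ H, ((bad p).card : ℝ) ≤ (N : ℝ) / m / 4 := by
    intro p hp
    obtain ⟨hp1, hp2⟩ := Finset.mem_sdiff.mp hp
    have hdeg : deg p * m ≤ 4 * (j + 1 + 1) * N := by
      by_contra h
      exact hp2 (Finset.mem_filter.mpr ⟨hp1, not_le.mp h⟩)
    have hdegR : (deg p : ℝ) * m ≤ 4 * ((j + 1 : ℕ) + 1) * N := by exact_mod_cast hdeg
    have hdeg2 : (deg p : ℝ) ≤ 4 * ((j + 1 : ℕ) + 1) * δ ^ (j + 1) := by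
      rw [← hδ] at hdegR
      refine le_of_mul_le_mul_right ?_ hmR
      linarith
    refine (ps_bad (j + 1) P A Sp hcard hsub hinj p M hMpos).trans ?_
    have hb : ((j + 1 : ℕ) : ℝ) * (deg p : ℝ) / M ≤ δ / 4 := by
      rw [div_le_iff₀ hMR]
      calc ((j + 1 : ℕ) : ℝ) * (deg p : ℝ)
          ≤ ((j + 1 : ℕ) : ℝ) * (4 * ((j + 1 : ℕ) + 1) * δ ^ (j + 1)) := by gcongr
        _ = δ / 4 * (K * δ ^ j) := by rw [hK]; ring
        _ ≤ δ / 4 * M := by gcongr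
    calc (((j + 1 : ℕ) : ℝ) * (deg p : ℝ) / M) ^ (j + 1) ≤ (δ / 4) ^ (j + 1) := by gcongr
      _ = δ ^ (j + 1) * ((1 / 4) ^ j * (1 / 4)) := by
          rw [div_eq_mul_one_div, mul_pow, pow_succ (1 / 4 : ℝ)]
      _ ≤ δ ^ (j + 1) * (1 * (1 / 4)) := by
          gcongr; exact pow_le_one₀ (by norm_num) (by norm_num)
      _ = (N : ℝ) / m / 4 := by rw [← hδ]; field_simp
  set Bad := (P \ H).biUnion bad with hBad
  have hBadcard : (Bad.card : ℝ) ≤ N / 4 := by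
    calc (Bad.card : ℝ) ≤ ∑ p ∈ P \ H, ((bad p).card : ℝ) := by
          exact_mod_cast Finset.card_biUnion_le
      _ ≤ ∑ p ∈ P \ H, (N : ℝ) / m / 4 := Finset.sum_le_sum hbad
      _ = (P \ H).card * ((N : ℝ) / m / 4) := by rw [Finset.sum_const, nsmul_eq_mul]
      _ ≤ m * ((N : ℝ) / m / 4) := by
          have : ((P \ H).card : ℝ) ≤ m := by
            rw [hm]; exact_mod_cast Finset.card_le_card Finset.sdiff_subset
          gcongr
      _ = N / 4 := by field_simp
  set G := (A \ A') \ Bad with hG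
  have hGcard : (N : ℝ) / 4 ≤ G.card := by
    have h1 : N ≤ A'.card + Bad.card + G.card := by
      have : A ⊆ A' ∪ Bad ∪ G := by
        intro a ha
        by_cases h1 : a ∈ A'
        · exact Finset.mem_union_left _ (Finset.mem_union_left _ h1)
        by_cases h2 : a ∈ Bad
        · exact Finset.mem_union_left _ (Finset.mem_union_right _ h2)
        · exact Finset.mem_union_right _ (Finset.mem_sdiff.mpr ⟨Finset.mem_sdiff.mpr ⟨ha, h1⟩, h2⟩)
      rw [hN]
      refine (Finset.card_le_card this).trans ((Finset.card_union_le _ _).trans ?_)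
      have := Finset.card_union_le A' Bad
      omega
    have h1R : (N : ℝ) ≤ A'.card + Bad.card + G.card := by exact_mod_cast h1
    have h2R : (2 : ℝ) * A'.card ≤ N := by exact_mod_cast hcase.le
    linarith
  have hGA : ∀ a ∈ G, a ∈ A := fun a ha =>
    (Finset.mem_sdiff.mp (Finset.mem_sdiff.mp ha).1).1
  have hpq : ∀ a, ∃ pq : (ℝ × ℝ) × (ℝ × ℝ), a ∈ G → pq.1 ∈ Sp a ∧ pq.2 ∈ Sp a ∧ pq.1 ≠ pq.2 ∧
      (A.filter (fun b => pq.1 ∈ Sp b ∧ pq.2 ∈ Sp b)).card ≤ M := by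
    intro a
    by_cases ha : a ∈ G
    · have haA := hGA a ha
      have ha' : a ∉ A' := (Finset.mem_sdiff.mp (Finset.mem_sdiff.mp ha).1).2
      have haB : a ∉ Bad := (Finset.mem_sdiff.mp ha).2
      have : ¬ Sp a ⊆ H := fun h => ha' (Finset.mem_filter.mpr ⟨haA, h⟩)
      obtain ⟨p, hp, hpH⟩ := Finset.not_subset.mp this
      have hnb : a ∉ bad p := fun h => haB (Finset.mem_biUnion.mpr
        ⟨p, Finset.mem_sdiff.mpr ⟨hsub a haA hp, hpH⟩, h⟩)
      have : ¬ ∀ q ∈ Sp a, q ≠ p → M < (A.filter (fun b => p ∈ Sp b ∧ q ∈ Sp b)).card :=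
        fun h => hnb (Finset.mem_filter.mpr ⟨haA, hp, h⟩)
      push Not at this
      obtain ⟨q, hq, hqp, hle⟩ := this
      exact ⟨(p, q), fun _ => ⟨hp, hq, hqp.symm, hle⟩⟩
    · exact ⟨default, fun h => absurd h ha⟩
  choose pq hpq using hpq
  have hcross := ps_crossing (fun a => (pq a).1) (fun a => (pq a).2) T P G M hMpos
    (fun a ha => (hpq a ha).2.2.1)
    (fun a ha => hjoin a (hGA a ha) _ (hpq a ha).1 _ (hpq a ha).2.1)
    (fun a ha => by
      refine le_trans (Finset.card_le_card ?_) (hpq a ha).2.2.2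
      intro b hb
      obtain ⟨hbG, hbe⟩ := Finset.mem_filter.mp hb
      have h1 := (hpq b hbG).1
      have h2 := (hpq b hbG).2.1
      rw [Sym2.eq_iff] at hbe
      refine Finset.mem_filter.mpr ⟨hGA b hbG, ?_⟩
      rcases hbe with ⟨e1, e2⟩ | ⟨e1, e2⟩
      · rw [← e1, ← e2]; exact ⟨h1, h2⟩
      · rw [← e1, ← e2]; exact ⟨h2, h1⟩)
    (fun a ha => ⟨hsub a (hGA a ha) (hpq a ha).1, hsub a (hGA a ha) (hpq a ha).2.1⟩)
  have hXle : (psX G (fun a => (pq a).1) (fun a => (pq a).2) T).card ≤ X := by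
    refine le_trans (Finset.card_le_card ?_) hX
    rintro ⟨a, b⟩ hab
    obtain ⟨h1, h2, -, -, -, h3⟩ := Finset.mem_filter.mp hab
    obtain ⟨h4, h5⟩ := Finset.mem_product.mp h1
    refine Finset.mem_filter.mpr ⟨Finset.mem_product.mpr ⟨hGA _ h4, hGA _ h5⟩, ?_, h3⟩
    intro h
    have h : a = b := h
    subst h
    exact h2 rfl
  rw [← hm] at hcross
  rcases hcross with h | h
  · left
    have hR : (G.card : ℝ) ≤ 16 * M * m := by exact_mod_cast h
    have h1 : δ ^ (j + 1) * m ≤ 128 * K * δ ^ j * m := by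
      rw [hδ]
      have : (M : ℝ) * m ≤ 2 * (K * δ ^ j) * m := by gcongr
      nlinarith
    have h2 : δ ≤ 128 * K := by
      have h3 := le_of_mul_le_mul_right h1 hmR
      rw [pow_succ, mul_comm] at h3
      exact le_of_mul_le_mul_right h3 (by positivity)
    rw [← hδ, hC]
    gcongr
    linarith
  · right
    have hR : (G.card : ℝ) ^ 3 ≤ 2048 * M * (m : ℝ) ^ 2 * X := by
      have : G.card ^ 3 ≤ 2048 * M * m ^ 2 * X := h.trans (by gcongr)
      exact_mod_cast this
    have h1 : ((N : ℝ) / 4) ^ 3 ≤ 2048 * (2 * (K * δ ^ j)) * (m : ℝ) ^ 2 * X := by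
      calc ((N : ℝ) / 4) ^ 3 ≤ (G.card : ℝ) ^ 3 := by gcongr
        _ ≤ _ := hR
        _ ≤ _ := by gcongr
    have h2 : δ ^ (2 * (j + 1) + 1) * m ≤ 262144 * K * X := by
      rw [← hδ] at h1
      have hpos : 0 < δ ^ j * (m : ℝ) ^ 2 := by positivity
      refine le_of_mul_le_mul_right ?_ hpos
      have e : δ ^ (2 * (j + 1) + 1) * m * (δ ^ j * (m : ℝ) ^ 2) = 64 * (δ ^ (j + 1) * m / 4) ^ 3 := by
        ring
      rw [e]
      nlinarith
    calc (N : ℝ) ^ (2 * (j + 1) + 1)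
        = (δ ^ (2 * (j + 1) + 1) * m) ^ (j + 1) * (m : ℝ) ^ (j + 1 + 1) := by
          rw [← hδ, mul_pow, mul_pow, ← pow_mul, ← pow_mul, mul_assoc, ← pow_add]
          congr 2 <;> ring
      _ ≤ (262144 * K * X) ^ (j + 1) * (m : ℝ) ^ (j + 1 + 1) := by gcongr
      _ = C * (m : ℝ) ^ (j + 1 + 1) * (X : ℝ) ^ (j + 1) := by rw [hC, mul_pow]; ring

lemma ps_curve (k : ℕ) (γ : Set (ℝ × ℝ)) (hγ : IsSimpleCurve γ) (P : Finset (ℝ × ℝ)) :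
    ∃ (Sp : ℕ → Finset (ℝ × ℝ)) (T : ℕ → Set (ℝ × ℝ)),
      (∀ i < (P.filter (fun p => p ∈ γ)).card / (k + 1),
        (Sp i).card = k + 1 ∧ Sp i ⊆ P ∧ (∀ x ∈ Sp i, x ∈ T i) ∧ T i ⊆ γ ∧
        ∀ x ∈ Sp i, ∀ y ∈ Sp i, JoinedIn (T i) x y) ∧
      ∀ i < (P.filter (fun p => p ∈ γ)).card / (k + 1),
        ∀ j < (P.filter (fun p => p ∈ γ)).card / (k + 1), i < j → T i ∩ T j = ∅ := by
  obtain ⟨f, hf, hfi, rfl⟩ := hγ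
  set Q := P.filter (fun p => p ∈ Set.range f) with hQ
  let g : ℝ → ℝ × ℝ := Set.IccExtend zero_le_one f
  have hg : Continuous g := hf.Icc_extend'
  have hgv : ∀ x (hx : x ∈ Set.Icc (0:ℝ) 1), g x = f ⟨x, hx⟩ := fun x hx =>
    Set.IccExtend_of_mem _ _ hx
  have hgi : Set.InjOn g (Set.Icc (0:ℝ) 1) := by
    intro x hx y hy h
    rw [hgv x hx, hgv y hy] at h
    exact congrArg Subtype.val (hfi h)
  have hex : ∀ p : ℝ × ℝ, ∃ t : ℝ, p ∈ Q → t ∈ Set.Icc (0:ℝ) 1 ∧ g t = p := by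
    intro p
    by_cases hp : p ∈ Q
    · obtain ⟨t, ht⟩ := (Finset.mem_filter.mp hp).2
      exact ⟨t, fun _ => ⟨t.2, by rw [hgv _ t.2]; exact ht⟩⟩
    · exact ⟨0, fun h => absurd h hp⟩
  choose u hu using hex
  set S := Q.image u with hS
  have hScard : S.card = Q.card := by
    apply Finset.card_image_of_injOn
    intro p hp q hq h
    rw [← (hu p hp).2, ← (hu q hq).2, h]
  have hSmem : ∀ t ∈ S, t ∈ Set.Icc (0:ℝ) 1 ∧ g t ∈ Q := by
    intro t ht
    obtain ⟨p, hp, rfl⟩ := Finset.mem_image.mp ht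
    exact ⟨(hu p hp).1, by rw [(hu p hp).2]; exact hp⟩
  let e := S.orderEmbOfFin hScard
  let t : ℕ → ℝ := fun n => if h : n < Q.card then e ⟨n, h⟩ else 0
  have htm : ∀ n < Q.card, t n ∈ S := by
    intro n hn
    simp only [t, dif_pos hn]
    exact Finset.orderEmbOfFin_mem _ _ _
  have htlt : ∀ a b, a < b → b < Q.card → t a < t b := by
    intro a b hab hb
    simp only [t, dif_pos hb, dif_pos (hab.trans hb)]
    exact e.strictMono hab
  have htle : ∀ a b, a ≤ b → b < Q.card → t a ≤ t b := by
    intro a b hab hb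
    rcases hab.eq_or_lt with rfl | h
    · exact le_rfl
    · exact (htlt a b h hb).le
  have hbd : ∀ i < Q.card / (k + 1), i * (k + 1) + k < Q.card := by
    intro i hi
    have := (Nat.le_div_iff_mul_le (show 0 < k + 1 from Nat.succ_pos k)).mp (Nat.succ_le_of_lt hi)
    rw [Nat.succ_mul] at this
    omega
  have hsubI : ∀ i < Q.card / (k + 1),
      Set.Icc (t (i * (k + 1))) (t (i * (k + 1) + k)) ⊆ Set.Icc (0:ℝ) 1 := by
    intro i hi
    have := hbd i hi
    exact Set.Icc_subset_Icc (hSmem _ (htm _ (by omega))).1.1 (hSmem _ (htm _ this)).1.2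
  refine ⟨fun i => (Finset.range (k + 1)).image (fun j => g (t (i * (k + 1) + j))),
    fun i => g '' Set.Icc (t (i * (k + 1))) (t (i * (k + 1) + k)), ?_, ?_⟩
  · intro i hi
    have hb := hbd i hi
    have hST : ∀ x ∈ (Finset.range (k + 1)).image (fun j => g (t (i * (k + 1) + j))),
        x ∈ g '' Set.Icc (t (i * (k + 1))) (t (i * (k + 1) + k)) := by
      intro x hx
      obtain ⟨j, hj, rfl⟩ := Finset.mem_image.mp hx
      have hj := Finset.mem_range.mp hj
      exact ⟨_, ⟨htle _ _ (by omega) (by omega), htle _ _ (by omega) (by omega)⟩, rfl⟩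
    refine ⟨?_, ?_, hST, ?_, ?_⟩
    · rw [Finset.card_image_of_injOn, Finset.card_range]
      intro a ha b hb' h
      have ha : a < k + 1 := by simpa using ha
      have hb' : b < k + 1 := by simpa using hb'
      have h : g (t (i * (k + 1) + a)) = g (t (i * (k + 1) + b)) := h
      have h2 := hgi (hSmem _ (htm (i * (k + 1) + a) (by omega))).1
        (hSmem _ (htm (i * (k + 1) + b) (by omega))).1 h
      rcases lt_trichotomy a b with hab | hab | hab
      · exact absurd h2 (htlt _ _ (by omega) (by omega)).ne
      · exact hab
      · exact absurd h2 (htlt _ _ (by omega) (by omega)).ne'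
    · intro x hx
      obtain ⟨j, hj, rfl⟩ := Finset.mem_image.mp hx
      have hj := Finset.mem_range.mp hj
      exact (Finset.mem_filter.mp (hSmem _ (htm (i * (k + 1) + j) (by omega))).2).1
    · rintro _ ⟨x, hx, rfl⟩
      rw [hgv x (hsubI i hi hx)]
      exact ⟨_, rfl⟩
    · intro x hx y hy
      have hpc : IsPathConnected (Set.Icc (t (i * (k + 1))) (t (i * (k + 1) + k))) :=
        (convex_Icc _ _).isPathConnected (Set.nonempty_Icc.mpr (htle _ _ (by omega) hb))
      exact (hpc.image hg).joinedIn _ (hST x hx) _ (hST y hy)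
  · intro i hi j hj hij
    rw [Set.eq_empty_iff_forall_notMem]
    rintro _ ⟨⟨x, hx, rfl⟩, ⟨y, hy, hxy⟩⟩
    have h := hgi (hsubI j hj hy) (hsubI i hi hx) hxy
    subst h
    have h1 : i * (k + 1) + k < j * (k + 1) := by
      have : (i + 1) * (k + 1) ≤ j * (k + 1) := Nat.mul_le_mul_right _ hij
      rw [Nat.succ_mul] at this
      omega
    have := hbd j hj
    exact absurd (htlt _ _ h1 (by omega)) (not_lt.mpr (hy.1.trans hx.2))

lemma ps_root (k : ℕ) (N m n D : ℝ) (hN : 0 ≤ N) (hm : 0 ≤ m) (hn : 0 ≤ n) (hD : 1 ≤ D)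
    (h : N ^ (2 * k + 1) ≤ D * m ^ (k + 1) * n ^ (2 * k)) :
    N ≤ D * (m ^ (((k:ℝ) + 1) / (2 * (k:ℝ) + 1)) * n ^ ((2 * (k:ℝ)) / (2 * (k:ℝ) + 1))) := by
  have h0 : (0:ℝ) < 2 * k + 1 := by positivity
  have hpow : ∀ (x : ℝ) (a : ℝ), 0 ≤ x → (x ^ (a / (2 * (k:ℝ) + 1))) ^ (2 * k + 1) = x ^ a := by
    intro x a hx
    rw [← Real.rpow_natCast, ← Real.rpow_mul hx]
    congr 1
    push_cast
    field_simp
  refine le_of_pow_le_pow_left₀ (n := 2 * k + 1) (by omega) (by positivity) ?_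
  rw [mul_pow, mul_pow, hpow _ _ hm, hpow _ _ hn]
  have e1 : m ^ ((k:ℝ) + 1) = m ^ (k + 1) := by
    rw [← Real.rpow_natCast]; push_cast; rfl
  have e2 : n ^ (2 * (k:ℝ)) = n ^ (2 * k) := by
    rw [← Real.rpow_natCast]; push_cast; rfl
  rw [e1, e2]
  refine h.trans ?_
  rw [mul_assoc]
  have : D ≤ D ^ (2 * k + 1) := le_self_pow₀ hD (by omega)
  gcongr

lemma ps_final (k : ℕ) (hk : 1 ≤ k) (P : Finset (ℝ × ℝ)) (C : Finset (Set (ℝ × ℝ)))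
    (hC : KIntersecting C k) : ∃ N : ℕ, incidences P C ≤ (k + 1) * N + k * C.card ∧
    ((N : ℝ) ≤ (262144 * (16 * (k + 1) * k)) ^ k * P.card ∨
    (N : ℝ) ^ (2 * k + 1) ≤
      (262144 * (16 * (k + 1) * k)) ^ k * (P.card : ℝ) ^ (k + 1) *
        ((k * C.card ^ 2 : ℕ) : ℝ) ^ k) := by
  obtain ⟨hsc, hitr⟩ := hC
  let d : Set (ℝ × ℝ) → ℕ := fun γ => (P.filter (fun p => p ∈ γ)).card
  have hex : ∀ γ : Set (ℝ × ℝ), ∃ (Sp : ℕ → Finset (ℝ × ℝ)) (T : ℕ → Set (ℝ × ℝ)), γ ∈ C →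
      (∀ i < d γ / (k + 1),
        (Sp i).card = k + 1 ∧ Sp i ⊆ P ∧ (∀ x ∈ Sp i, x ∈ T i) ∧ T i ⊆ γ ∧
        ∀ x ∈ Sp i, ∀ y ∈ Sp i, JoinedIn (T i) x y) ∧
      ∀ i < d γ / (k + 1), ∀ j < d γ / (k + 1), i < j → T i ∩ T j = ∅ := by
    intro γ
    by_cases h : γ ∈ C
    · obtain ⟨Sp, T, h1⟩ := ps_curve k γ (hsc γ h) P
      exact ⟨Sp, T, fun _ => h1⟩
    · exact ⟨default, default, fun h' => absurd h' h⟩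
  choose Sp T hST using hex
  let A : Finset (Σ _ : Set (ℝ × ℝ), ℕ) := C.sigma (fun γ => Finset.range (d γ / (k + 1)))
  have hA : ∀ a ∈ A, a.1 ∈ C ∧ a.2 < d a.1 / (k + 1) := by
    intro a ha
    obtain ⟨h1, h2⟩ := Finset.mem_sigma.mp ha
    exact ⟨h1, Finset.mem_range.mp h2⟩
  have hprop := fun a (ha : a ∈ A) => (hST a.1 (hA a ha).1).1 a.2 (hA a ha).2
  have hsame : ∀ a ∈ A, ∀ b ∈ A, a.1 = b.1 → ∀ x, x ∈ T a.1 a.2 → x ∈ T b.1 b.2 → a = b := by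
    rintro ⟨γ, i⟩ ha ⟨γ', j⟩ hb h x hx hy
    have h : γ = γ' := h
    subst h
    have hd := (hST γ (hA _ ha).1).2
    rcases lt_trichotomy i j with hij | hij | hij
    · have := hd i (hA _ ha).2 j (hA _ hb).2 hij
      exact absurd (show x ∈ T γ i ∩ T γ j from ⟨hx, hy⟩) (by rw [this]; exact id)
    · rw [hij]
    · have := hd j (hA _ hb).2 i (hA _ ha).2 hij
      exact absurd (show x ∈ T γ j ∩ T γ i from ⟨hy, hx⟩) (by rw [this]; exact id)
  refine ⟨A.card, ?_, ?_⟩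
  · rw [Finset.card_sigma, incidences, Finset.mul_sum, mul_comm k, ← smul_eq_mul C.card,
      ← Finset.sum_const, ← Finset.sum_add_distrib]
    refine Finset.sum_le_sum fun γ _ => ?_
    rw [Finset.card_range]
    have h1 := Nat.div_add_mod (d γ) (k + 1)
    have h2 := Nat.mod_lt (d γ) (show 0 < k + 1 from Nat.succ_pos k)
    have h3 : (P.filter (fun p => p ∈ γ)).card = d γ := rfl
    rw [h3]
    omega
  · refine ps_chunks k hk (fun a : (Σ _ : Set (ℝ × ℝ), ℕ) => T a.1 a.2) (fun a => Sp a.1 a.2)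
      (k * C.card ^ 2) P.card P A rfl (fun a ha => (hprop a ha).1) (fun a ha => (hprop a ha).2.1)
      (fun a ha => (hprop a ha).2.2.2.2) ?_ ?_
    · intro a ha b hb hab
      have hab : Sp a.1 a.2 = Sp b.1 b.2 := hab
      obtain ⟨a1, a2, a3, a4, -⟩ := hprop a ha
      obtain ⟨b1, b2, b3, b4, -⟩ := hprop b hb
      by_cases h : a.1 = b.1
      · obtain ⟨x, hx⟩ : (Sp a.1 a.2).Nonempty := Finset.card_pos.mp (by omega)
        exact hsame a ha b hb h x (a3 x hx) (b3 x (hab ▸ hx))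
      · exfalso
        obtain ⟨hfin, hle⟩ := hitr _ (hA a ha).1 _ (hA b hb).1 h
        have hss : (↑(Sp a.1 a.2) : Set (ℝ × ℝ)) ⊆ a.1 ∩ b.1 := fun x hx =>
          ⟨a4 (a3 x hx), b4 (b3 x (hab ▸ hx))⟩
        have := Set.ncard_le_ncard hss hfin
        rw [Set.ncard_coe_finset] at this
        omega
    · set Y := (A ×ˢ A).filter (fun ab => ab.1 ≠ ab.2 ∧
        (T ab.1.1 ab.1.2 ∩ T ab.2.1 ab.2.2).Nonempty) with hY
      have hmemY : ∀ y ∈ Y, y.1 ∈ A ∧ y.2 ∈ A ∧ y.1 ≠ y.2 ∧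
          (T y.1.1 y.1.2 ∩ T y.2.1 y.2.2).Nonempty := by
        intro y hy
        obtain ⟨h1, h2, h3⟩ := Finset.mem_filter.mp hy
        obtain ⟨h4, h5⟩ := Finset.mem_product.mp h1
        exact ⟨h4, h5, h2, h3⟩
      have hpt : ∀ y, ∃ x : ℝ × ℝ, y ∈ Y → x ∈ T y.1.1 y.1.2 ∧ x ∈ T y.2.1 y.2.2 := by
        intro y
        by_cases hy : y ∈ Y
        · obtain ⟨x, hx⟩ := (hmemY y hy).2.2.2
          exact ⟨x, fun _ => hx⟩
        · exact ⟨0, fun h => absurd h hy⟩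
      choose pt hpt using hpt
      have hne : ∀ y ∈ Y, y.1.1 ≠ y.2.1 := by
        intro y hy h
        obtain ⟨h1, h2, h3, -⟩ := hmemY y hy
        exact h3 (hsame _ h1 _ h2 h _ (hpt y hy).1 (hpt y hy).2)
      have key : Y.card ≤ k * (C ×ˢ C).card := by
        refine Finset.card_le_mul_card_image_of_maps_to
          (f := fun y => (y.1.1, y.2.1)) (t := C ×ˢ C) ?_ k ?_
        · intro y hy
          obtain ⟨h1, h2, -⟩ := hmemY y hy
          exact Finset.mem_product.mpr ⟨(hA _ h1).1, (hA _ h2).1⟩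
        · rintro ⟨γ, γ'⟩ hγ
          obtain ⟨hγ1, hγ2⟩ := Finset.mem_product.mp hγ
          by_cases h : γ = γ'
          · rw [Finset.filter_eq_empty_iff.mpr]
            · exact Nat.zero_le _
            · intro y hy he
              rw [Prod.mk.injEq] at he
              exact hne y hy (by rw [he.1, he.2, h])
          · obtain ⟨hfin, hle⟩ := hitr _ hγ1 _ hγ2 h
            refine le_trans ?_ hle
            rw [Set.ncard_eq_toFinset_card _ hfin]
            refine Finset.card_le_card_of_injOn pt ?_ ?_
            · intro y hy
              obtain ⟨hyY, he⟩ := Finset.mem_filter.mp hy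
              rw [Prod.mk.injEq] at he
              obtain ⟨h1, h2, -⟩ := hmemY y hyY
              have p1 := (hprop _ h1).2.2.2.1 (hpt y hyY).1
              have p2 := (hprop _ h2).2.2.2.1 (hpt y hyY).2
              rw [he.1] at p1
              rw [he.2] at p2
              simpa using ⟨p1, p2⟩
            · intro y hy z hz hyz
              obtain ⟨hyY, hey⟩ := Finset.mem_filter.mp hy
              obtain ⟨hzY, hez⟩ := Finset.mem_filter.mp hz
              rw [Prod.mk.injEq] at hey hez
              obtain ⟨y1, y2, -⟩ := hmemY y hyY
              obtain ⟨z1, z2, -⟩ := hmemY z hzY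
              have q1 := hpt y hyY
              have q2 := hpt z hzY
              rw [← hyz] at q2
              exact Prod.ext
                (hsame _ y1 _ z1 (hey.1.trans hez.1.symm) _ q1.1 q2.1)
                (hsame _ y2 _ z2 (hey.2.trans hez.2.symm) _ q1.2 q2.2)
      rw [Finset.card_product, ← pow_two] at key
      convert key

theorem pach_sharir_general (k : ℕ) (hk : 1 ≤ k) :
    ∃ c : ℝ, 0 < c ∧
      ∀ P : Finset (ℝ × ℝ), ∀ C : Finset (Set (ℝ × ℝ)),
        KIntersecting C k →
        (incidences P C : ℝ) ≤
          c * ((P.card : ℝ) ^ (((k:ℝ) + 1) / (2 * (k:ℝ) + 1)) *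
                 (C.card : ℝ) ^ ((2 * (k:ℝ)) / (2 * (k:ℝ) + 1)) +
               (P.card : ℝ) + (C.card : ℝ)) := by
  have hk' : (1 : ℝ) ≤ k := by exact_mod_cast hk
  obtain ⟨C0, hC0⟩ : ∃ C0 : ℝ, C0 = (262144 * (16 * ((k:ℝ) + 1) * k)) ^ k := ⟨_, rfl⟩
  have hC1 : 1 ≤ C0 := by
    rw [hC0]; exact one_le_pow₀ (by nlinarith)
  have hkk : (1 : ℝ) ≤ (k : ℝ) ^ k := one_le_pow₀ hk'
  obtain ⟨D, hD⟩ : ∃ D : ℝ, D = C0 * (k : ℝ) ^ k := ⟨_, rfl⟩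
  have hD1 : 1 ≤ D := by rw [hD]; nlinarith
  have hDC : C0 ≤ D := by rw [hD]; nlinarith
  refine ⟨((k : ℝ) + 1) * D, by positivity, ?_⟩
  intro P C hC
  obtain ⟨N, hN1, hN2⟩ := ps_final k hk P C hC
  rw [← hC0] at hN2
  have hI : (incidences P C : ℝ) ≤ (k + 1) * N + k * C.card := by exact_mod_cast hN1
  set R : ℝ := (P.card : ℝ) ^ (((k:ℝ) + 1) / (2 * (k:ℝ) + 1)) *
                 (C.card : ℝ) ^ ((2 * (k:ℝ)) / (2 * (k:ℝ) + 1)) with hR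
  have hR0 : 0 ≤ R := by positivity
  have hP0 : (0 : ℝ) ≤ P.card := Nat.cast_nonneg _
  have hc0 : (0 : ℝ) ≤ C.card := Nat.cast_nonneg _
  have hNle : (N : ℝ) ≤ D * (R + P.card) := by
    rcases hN2 with h | h
    · calc (N : ℝ) ≤ C0 * P.card := h
        _ ≤ D * P.card := by gcongr
        _ ≤ D * (R + P.card) := by gcongr; linarith
    · have h2 := ps_root k N P.card C.card D (Nat.cast_nonneg _) hP0 hc0 hD1 (by
        refine h.trans (le_of_eq ?_)
        rw [hD]; push_cast
        rw [mul_pow, ← pow_mul]; ring)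
      rw [← hR] at h2
      calc (N : ℝ) ≤ D * R := h2
        _ ≤ D * (R + P.card) := by gcongr; linarith
  calc (incidences P C : ℝ) ≤ (k + 1) * N + k * C.card := hI
    _ ≤ (k + 1) * (D * (R + P.card)) + (k + 1) * (D * C.card) := by
        have : (C.card : ℝ) ≤ D * C.card := le_mul_of_one_le_left hc0 hD1
        gcongr
        linarith
    _ = _ := by ring
end

section
/- For every integer k ≥ 1 there exists a constant c_k > 0 such that the following holds: if P is a finite set of points in ℝ², C is a k-intersecting family of simple curves, ℓ ≥ 2 is an integer, and for p ∈ P we write d(p) for the number of curves of C containing p, then the sum of d(p) over all points p ∈ P with d(p) ≥ ℓ is at most c_k · ( |C|² / ℓ^(1 + 1/k) + |C| ). -/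
open scoped Classical

/-! ### Topology: `K₅` cannot be drawn with disjoint independent edges -/

lemma exists_continuous_log (f : ℝ × ℝ → ℂ) (hf : Continuous f) (h0 : ∀ z, f z ≠ 0) :
    ∃ L : ℝ × ℝ → ℂ, Continuous L ∧ ∀ z, Complex.exp (L z) = f z := by
  let g : C(ℝ × ℝ, {z : ℂ // z ≠ 0}) := ⟨fun z => ⟨f z, h0 z⟩, by fun_prop⟩
  obtain ⟨F, ⟨-, hF⟩, -⟩ := Complex.isCoveringMap_exp.existsUnique_continuousMap_lifts g
    (0, 0) (Complex.log (f (0, 0))) (by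
      apply Subtype.ext
      simp [g, Complex.exp_log (h0 _)])
  refine ⟨F, F.continuous, fun z => ?_⟩
  have := congrFun hF z
  simpa [g] using congrArg Subtype.val this

lemma log_change_unique (L₁ L₂ : ℝ → ℂ) (h₁ : Continuous L₁) (h₂ : Continuous L₂) (c : ℂ)
    (h : ∀ t, Complex.exp (L₁ t) = c * Complex.exp (L₂ t)) :
    L₁ 1 - L₁ 0 = L₂ 1 - L₂ 0 := by
  have key : (fun t => L₁ t - L₂ t) = fun _ => L₁ 0 - L₂ 0 := by
    refine Complex.isCoveringMap_exp.eq_of_comp_eq (h₁.sub h₂) continuous_const ?_ 0 rfl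
    funext t
    apply Subtype.ext
    simp [Complex.exp_sub, h]
  have := congrFun key 1
  linear_combination this

set_option linter.unusedSimpArgs false

section K5

variable (x : Fin 5 → ℂ)

/-- A chosen logarithm of `x a - x b`, compatible with swapping. -/
noncomputable def logDiff (a b : Fin 5) : ℂ :=
  if a < b then Complex.log (x a - x b) else Complex.log (x b - x a) + Real.pi * Complex.I

/-- The sign appearing when swapping the arguments of `logDiff`. -/
def sgn5 (a b : Fin 5) : ℤ := if a < b then -1 else 1

lemma exp_logDiff (hx : Function.Injective x) {a b : Fin 5} (hab : a ≠ b) :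
    Complex.exp (logDiff x a b) = x a - x b := by
  have h1 : x a - x b ≠ 0 := sub_ne_zero.2 (fun h => hab (hx h))
  have h2 : x b - x a ≠ 0 := sub_ne_zero.2 (fun h => hab (hx h.symm))
  unfold logDiff
  split_ifs
  · rw [Complex.exp_log h1]
  · rw [Complex.exp_add, Complex.exp_log h2, Complex.exp_pi_mul_I]; ring

lemma logDiff_swap {a b : Fin 5} (hab : a ≠ b) :
    logDiff x a b - logDiff x b a = (sgn5 a b : ℂ) * (Real.pi * Complex.I) := by
  unfold logDiff sgn5
  rcases lt_or_gt_of_ne hab with h | h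
  · simp [h, not_lt.2 h.le]
  · simp [h, not_lt.2 h.le]

lemma exists_winding (hx : Function.Injective x) (q : ℝ → ℂ) (v j k : Fin 5)
    (hvj : v ≠ j) (hvk : v ≠ k) (q0 : q 0 = x j) (q1 : q 1 = x k) :
    ∃ n : ℤ, ∀ (L : ℝ → ℂ) (c : ℂ), Continuous L → c ≠ 0 →
      (∀ t, Complex.exp (L t) = c * (x v - q t)) →
      L 1 - L 0 = logDiff x v k - logDiff x v j + n * (2 * Real.pi * Complex.I) := by
  by_cases hex : ∃ (L : ℝ → ℂ) (c : ℂ), Continuous L ∧ c ≠ 0 ∧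
      (∀ t, Complex.exp (L t) = c * (x v - q t))
  · obtain ⟨L₀, c₀, hL₀, hc₀, h₀⟩ := hex
    have e1 : Complex.exp (L₀ 1 - L₀ 0) = Complex.exp (logDiff x v k - logDiff x v j) := by
      rw [Complex.exp_sub, Complex.exp_sub, h₀, h₀, q0, q1, exp_logDiff x hx hvj,
        exp_logDiff x hx hvk]
      rw [mul_div_mul_left _ _ hc₀]
    obtain ⟨n, hn⟩ := Complex.exp_eq_exp_iff_exists_int.1 e1
    refine ⟨n, fun L c hL hc h => ?_⟩
    rw [← hn]
    apply log_change_unique L L₀ hL hL₀ (c / c₀)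
    intro t
    rw [h, h₀]
    field_simp
  · refine ⟨0, fun L c hL hc h => ?_⟩
    exact absurd ⟨L, c, hL, hc, h⟩ hex

theorem k5_not_drawable (p : Fin 5 → Fin 5 → ℝ → ℂ)
    (hx : Function.Injective x)
    (hp : ∀ i j, i < j → Continuous (p i j) ∧ p i j 0 = x i ∧ p i j 1 = x j)
    (hd : ∀ i j k l, i < j → k < l → i ≠ k → i ≠ l → j ≠ k → j ≠ l →
      ∀ s t, p i j s ≠ p k l t) : False := by
  have hw : ∀ v j k : Fin 5, ∃ n : ℤ, v ≠ j → v ≠ k → j < k → ∀ (L : ℝ → ℂ) (c : ℂ),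
      Continuous L → c ≠ 0 → (∀ t, Complex.exp (L t) = c * (x v - p j k t)) →
      L 1 - L 0 = logDiff x v k - logDiff x v j + n * (2 * Real.pi * Complex.I) := by
    intro v j k
    by_cases h : v ≠ j ∧ v ≠ k ∧ j < k
    · obtain ⟨n, hn⟩ := exists_winding x hx (p j k) v j k h.1 h.2.1 (hp j k h.2.2).2.1
        (hp j k h.2.2).2.2
      exact ⟨n, fun _ _ _ => hn⟩
    · exact ⟨0, fun a b c => absurd ⟨a, b, c⟩ h⟩
  choose N hN using hw
  have cell : ∀ i j k l : Fin 5, i < j → k < l → i ≠ k → i ≠ l → j ≠ k → j ≠ l →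
      2 * (N i k l + N l i j - N j k l - N k i j) + sgn5 i l - sgn5 i k + sgn5 l j + sgn5 j k
        = 0 := by
    intro i j k l hij hkl hik hil hjk hjl
    obtain ⟨cij, pij0, pij1⟩ := hp i j hij
    obtain ⟨ckl, pkl0, pkl1⟩ := hp k l hkl
    obtain ⟨L, hL, hLe⟩ := exists_continuous_log (fun z => p i j z.1 - p k l z.2)
      (by fun_prop) (fun z => sub_ne_zero.2 (hd i j k l hij hkl hik hil hjk hjl _ _))
    have a1 := hN i k l hik hil hkl (fun t => L (0, t)) 1 (by fun_prop) one_ne_zero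
      (fun t => by rw [hLe, pij0]; ring)
    have a2 := hN j k l hjk hjl hkl (fun t => L (1, t)) 1 (by fun_prop) one_ne_zero
      (fun t => by rw [hLe, pij1]; ring)
    have a3 := hN k i j hik.symm hjk.symm hij (fun t => L (t, 0)) (-1) (by fun_prop) (by norm_num)
      (fun t => by rw [hLe, pkl0]; ring)
    have a4 := hN l i j hil.symm hjl.symm hij (fun t => L (t, 1)) (-1) (by fun_prop) (by norm_num)
      (fun t => by rw [hLe, pkl1]; ring)
    have s1 := logDiff_swap x hil
    have s2 := logDiff_swap x hik
    have s3 := logDiff_swap x hjl.symm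
    have s4 := logDiff_swap x hjk
    have hpi : (Real.pi * Complex.I : ℂ) ≠ 0 := by
      simp [Real.pi_ne_zero]
    have : ((2 * (N i k l + N l i j - N j k l - N k i j) + sgn5 i l - sgn5 i k + sgn5 l j
        + sgn5 j k : ℤ) : ℂ) * (Real.pi * Complex.I) = 0 := by
      push_cast
      linear_combination (-1) * a1 + a2 + a3 - a4 - s1 + s2 - s3 - s4
    have := (mul_eq_zero.1 this).resolve_right hpi
    exact_mod_cast this
  have quad : ∀ a b c d : Fin 5, a < b → b < c → c < d →
      (N a c d + N d a b - N b c d - N c a b) + (N a b d + N d a c - N c b d - N b a c) +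
      (N a b c + N c a d - N d b c - N b a d) = -1 := by
    intro a b c d hab hbc hcd
    have hac := hab.trans hbc
    have hbd := hbc.trans hcd
    have had := hab.trans hbd
    have c1 := cell a b c d hab hcd hac.ne had.ne hbc.ne hbd.ne
    have c2 := cell a c b d hac hbd hab.ne had.ne hbc.ne' hcd.ne
    have c3 := cell a d b c had hbc hab.ne hac.ne hbd.ne' hcd.ne'
    simp only [sgn5, hab, hac, had, hbc, hbd, hcd, not_lt.2 hab.le, not_lt.2 hac.le,
      not_lt.2 had.le, not_lt.2 hbc.le, not_lt.2 hbd.le, not_lt.2 hcd.le, if_true, if_false]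
      at c1 c2 c3
    omega
  have q1 := quad 0 1 2 3 (by decide) (by decide) (by decide)
  have q2 := quad 0 1 2 4 (by decide) (by decide) (by decide)
  have q3 := quad 0 1 3 4 (by decide) (by decide) (by decide)
  have q4 := quad 0 2 3 4 (by decide) (by decide) (by decide)
  have q5 := quad 1 2 3 4 (by decide) (by decide) (by decide)
  omega

end K5

/-! ### Mader's argument: drawable graphs have linearly many edges -/

/-- A drawing of a graph by path connected sets, where independent edges are disjoint. -/
def IsDrawing {V : Type*} (G : SimpleGraph V) (x : V → ℂ) (A : V → V → Set ℂ) : Prop :=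
  Function.Injective x ∧
  (∀ u v, G.Adj u v → IsPathConnected (A u v) ∧ x u ∈ A u v ∧ x v ∈ A u v) ∧
  (∀ a b c d, G.Adj a b → G.Adj c d → a ≠ c → a ≠ d → b ≠ c → b ≠ d →
    Disjoint (A a b) (A c d))

lemma not_isDrawing_k5 {V : Type*} (G : SimpleGraph V) (x : V → ℂ) (A : V → V → Set ℂ)
    (h : IsDrawing G x A) (f : Fin 5 → V) (hf : ∀ i j, i < j → G.Adj (f i) (f j)) : False := by
  obtain ⟨hx, hA, hd⟩ := h
  have hinj : Function.Injective f := by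
    intro i j hij
    by_contra hne
    rcases lt_or_gt_of_ne hne with h | h
    · exact (hf _ _ h).ne hij
    · exact (hf _ _ h).ne hij.symm
  have hpath : ∀ i j, ∃ q : ℝ → ℂ, i < j → Continuous q ∧ q 0 = x (f i) ∧ q 1 = x (f j) ∧
      ∀ t, q t ∈ A (f i) (f j) := by
    intro i j
    by_cases hij : i < j
    · obtain ⟨h1, h2, h3⟩ := hA _ _ (hf i j hij)
      obtain ⟨γ, hγ⟩ := h1.joinedIn _ h2 _ h3
      refine ⟨γ.extend, fun _ => ⟨γ.continuous_extend, by simp, by simp, fun t => ?_⟩⟩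
      exact hγ _
    · exact ⟨fun _ => 0, fun h => absurd h hij⟩
  choose p hp using hpath
  refine k5_not_drawable (fun i => x (f i)) p (hx.comp hinj)
    (fun i j hij => ⟨(hp i j hij).1, (hp i j hij).2.1, (hp i j hij).2.2.1⟩) ?_
  intro i j k l hij hkl hik hil hjk hjl s t hst
  have hdis := hd _ _ _ _ (hf i j hij) (hf k l hkl) (hinj.ne hik) (hinj.ne hil) (hinj.ne hjk)
    (hinj.ne hjl)
  exact Set.disjoint_left.1 hdis ((hp i j hij).2.2.2 s) (hst ▸ (hp k l hkl).2.2.2 t)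

section Mader

variable {V : Type*}

/-- Contract the vertex `v` into `u`. -/
def contractInto (G : SimpleGraph V) (u v : V) : SimpleGraph V where
  Adj a b := a ≠ v ∧ b ≠ v ∧ a ≠ b ∧ (G.Adj a b ∨ (a = u ∧ G.Adj v b) ∨ (b = u ∧ G.Adj v a))
  symm := ⟨by
    rintro a b ⟨h1, h2, h3, h4⟩
    refine ⟨h2, h1, h3.symm, ?_⟩
    rcases h4 with h | h | h
    · exact Or.inl h.symm
    · exact Or.inr (Or.inr h)
    · exact Or.inr (Or.inl h)⟩
  loopless := ⟨fun a h => h.2.2.1 rfl⟩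

lemma IsDrawing.contract {G : SimpleGraph V} {x : V → ℂ} {A : V → V → Set ℂ}
    (h : IsDrawing G x A) {u v : V} (huv : G.Adj u v) :
    IsDrawing (contractInto G u v) x
      (fun a b => if G.Adj a b then A a b else A u v ∪ A v (if a = u then b else a)) := by
  obtain ⟨hx, hA, hd⟩ := h
  have huni : ∀ w, G.Adj v w → IsPathConnected (A u v ∪ A v w) := fun w hw =>
    (hA _ _ huv).1.union (hA _ _ hw).1 ⟨x v, (hA _ _ huv).2.2, (hA _ _ hw).2.1⟩
  refine ⟨hx, ?_, ?_⟩
  · rintro a b ⟨h1, h2, h3, h4⟩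
    by_cases hab : G.Adj a b
    · simpa [hab] using hA a b hab
    · rcases h4 with h | ⟨rfl, h⟩ | ⟨rfl, h⟩
      · exact absurd h hab
      · simp only [hab, if_false, if_true]
        exact ⟨huni _ h, Or.inl (hA _ _ huv).2.1, Or.inr (hA _ _ h).2.2⟩
      · simp only [hab, if_false, h3]
        exact ⟨huni _ h, Or.inr (hA _ _ h).2.2, Or.inl (hA _ _ huv).2.1⟩
  · -- description of each contracted edge
    have desc : ∀ a b, (contractInto G u v).Adj a b → ∀ z,
        z ∈ (if G.Adj a b then A a b else A u v ∪ A v (if a = u then b else a)) →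
        ∃ c d, G.Adj c d ∧ z ∈ A c d ∧ (c = a ∨ c = b ∨ (c = v ∧ (a = u ∨ b = u))) ∧
          (d = a ∨ d = b ∨ (d = v ∧ (a = u ∨ b = u))) := by
      rintro a b ⟨h1, h2, h3, h4⟩ z hz
      by_cases hab : G.Adj a b
      · simp only [hab, if_true] at hz
        exact ⟨a, b, hab, hz, Or.inl rfl, Or.inr (Or.inl rfl)⟩
      · rcases h4 with h | ⟨rfl, h⟩ | ⟨rfl, h⟩
        · exact absurd h hab
        · simp only [hab, if_false, if_true] at hz
          rcases hz with hz | hz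
          · exact ⟨a, v, huv, hz, by simp, by simp⟩
          · exact ⟨v, b, h, hz, by simp, by simp⟩
        · simp only [hab, if_false, h3] at hz
          rcases hz with hz | hz
          · exact ⟨b, v, huv, hz, by simp, by simp⟩
          · exact ⟨v, a, h, hz, by simp, by simp⟩
    intro a b c d hab hcd hac had hbc hbd
    rw [Set.disjoint_left]
    intro z hz hz'
    obtain ⟨a', b', e1, z1, p1, p2⟩ := desc a b hab z hz
    obtain ⟨c', d', e2, z2, p3, p4⟩ := desc c d hcd z hz'
    have hav := hab.1
    have hbv := hab.2.1
    have hcv := hcd.1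
    have hdv := hcd.2.1
    refine Set.disjoint_left.1 (hd a' b' c' d' e1 e2 ?_ ?_ ?_ ?_) z1 z2 <;>
      clear hd desc hA huni z1 z2 hz hz' e1 e2 hab hcd hx huv <;> grind

/-- Number of ordered adjacent pairs inside `S`. -/
noncomputable def adjPairs (G : SimpleGraph V) (S : Finset V) : ℕ :=
  ∑ a ∈ S, (S.filter (fun b => G.Adj a b)).card

lemma adjPairs_contract (G : SimpleGraph V) (S : Finset V) {u v : V} (hu : u ∈ S) (hv : v ∈ S)
    (huv : G.Adj u v) :
    adjPairs G S ≤ adjPairs (contractInto G u v) (S.erase v) +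
      2 * (1 + (S.filter (fun b => G.Adj u b ∧ G.Adj v b)).card) := by
  set S' := S.erase v with hS'
  have hS : S = insert v S' := (Finset.insert_erase hv).symm
  have hvS' : v ∉ S' := Finset.notMem_erase v S
  have huS' : u ∈ S' := Finset.mem_erase.2 ⟨huv.ne, hu⟩
  set d := (S'.filter (fun b => G.Adj v b)).card with hd
  set Q := S'.filter (fun b => b ≠ u ∧ G.Adj v b ∧ ¬ G.Adj u b) with hQ
  have h1 : adjPairs G S = adjPairs G S' + 2 * d := by
    unfold adjPairs
    rw [hS, Finset.sum_insert hvS']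
    have e1 : ((insert v S').filter (fun b => G.Adj v b)).card = d := by
      rw [Finset.filter_insert, if_neg (fun h => h.ne rfl)]
    have e2 : ∀ a ∈ S', ((insert v S').filter (fun b => G.Adj a b)).card =
        (S'.filter (fun b => G.Adj a b)).card + (if G.Adj v a then 1 else 0) := by
      intro a ha
      rw [Finset.filter_insert]
      by_cases h : G.Adj a v
      · rw [if_pos h, if_pos h.symm, Finset.card_insert_of_notMem]
        simp [hvS']
      · rw [if_neg h, if_neg (fun h' => h h'.symm)]; rfl
    rw [e1, Finset.sum_congr rfl e2, Finset.sum_add_distrib, ← Finset.card_filter]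
    omega
  have h2 : adjPairs G S' + 2 * Q.card ≤ adjPairs (contractInto G u v) S' := by
    unfold adjPairs
    have e2 : ∀ a ∈ S', (S'.filter (fun b => G.Adj a b)).card + (if a = u then Q.card else 0) +
        (if a ∈ Q then 1 else 0) ≤ (S'.filter (fun b => (contractInto G u v).Adj a b)).card := by
      intro a ha
      have hav : a ≠ v := fun h => hvS' (h ▸ ha)
      by_cases hau : a = u
      · have haQ : a ∉ Q := by simp [hQ, hau]
        rw [if_pos hau, if_neg haQ, add_zero, ← Finset.card_union_of_disjoint]
        · apply Finset.card_le_card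
          intro b hb
          rw [Finset.mem_union, Finset.mem_filter, hQ, Finset.mem_filter] at hb
          rw [Finset.mem_filter]
          rcases hb with ⟨hb, hb2⟩ | ⟨hb, hb2, hb3, hb4⟩
          · exact ⟨hb, hav, fun h => hvS' (h ▸ hb), hb2.ne, Or.inl hb2⟩
          · exact ⟨hb, hav, fun h => hvS' (h ▸ hb), fun h => hb2 (h ▸ hau),
              Or.inr (Or.inl ⟨hau, hb3⟩)⟩
        · rw [Finset.disjoint_left]
          intro b hb hb'
          rw [hQ, Finset.mem_filter] at hb'
          rw [Finset.mem_filter] at hb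
          exact hb'.2.2.2 (hau ▸ hb.2)
      · rw [if_neg hau, add_zero]
        by_cases haQ : a ∈ Q
        · rw [if_pos haQ]
          rw [hQ, Finset.mem_filter] at haQ
          rw [← Finset.card_insert_of_notMem (a := u) (by
            rw [Finset.mem_filter]; exact fun h => haQ.2.2.2 h.2.symm)]
          apply Finset.card_le_card
          intro b hb
          rw [Finset.mem_filter]
          rcases Finset.mem_insert.1 hb with hb | hb
          · rw [hb]
            exact ⟨huS', hav, huv.ne, hau, Or.inr (Or.inr ⟨rfl, haQ.2.2.1⟩)⟩
          · rw [Finset.mem_filter] at hb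
            exact ⟨hb.1, hav, fun h => hvS' (h ▸ hb.1), hb.2.ne, Or.inl hb.2⟩
        · rw [if_neg haQ, add_zero]
          apply Finset.card_le_card
          intro b hb
          rw [Finset.mem_filter] at hb ⊢
          exact ⟨hb.1, hav, fun h => hvS' (h ▸ hb.1), hb.2.ne, Or.inl hb.2⟩
    have e3 := Finset.sum_le_sum e2
    rw [Finset.sum_add_distrib, Finset.sum_add_distrib, Finset.sum_ite_eq' S' u, if_pos huS',
      ← Finset.card_filter, Finset.filter_mem_eq_inter,
      Finset.inter_eq_right.2 (show Q ⊆ S' from Finset.filter_subset _ _)] at e3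
    omega
  have h3 : d ≤ 1 + (S.filter (fun b => G.Adj u b ∧ G.Adj v b)).card + Q.card := by
    have : S'.filter (fun b => G.Adj v b) ⊆
        ({u} ∪ S.filter (fun b => G.Adj u b ∧ G.Adj v b)) ∪ Q := by
      intro b hb
      rw [Finset.mem_filter] at hb
      have hbS := Finset.mem_of_mem_erase hb.1
      simp only [Finset.mem_union, Finset.mem_singleton, Finset.mem_filter, hQ]
      by_cases h1 : b = u
      · exact Or.inl (Or.inl h1)
      · by_cases h2 : G.Adj u b
        · exact Or.inl (Or.inr ⟨hbS, h2, hb.2⟩)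
        · exact Or.inr ⟨hb.1, h1, hb.2, h2⟩
    refine (Finset.card_le_card this).trans ((Finset.card_union_le _ _).trans ?_)
    have := Finset.card_union_le ({u} : Finset V) (S.filter (fun b => G.Adj u b ∧ G.Adj v b))
    rw [Finset.card_singleton] at this
    omega
  omega

/-- The constants in Mader's argument. -/
def maderC : ℕ → ℕ
  | 0 => 0
  | n + 1 => 2 * (maderC n + 1)

lemma mader (n : ℕ) : ∀ (s : ℕ) (G : SimpleGraph V) (x : V → ℂ) (A : V → V → Set ℂ)
    (_ : IsDrawing G x A) (S : Finset V) (_ : S.card = s) (T : Finset V) (_ : T.card + n = 3)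
    (_ : ∀ a ∈ T, ∀ b ∈ T, a ≠ b → G.Adj a b) (_ : ∀ a ∈ T, ∀ b ∈ S, G.Adj a b),
    adjPairs G S ≤ maderC n * S.card := by
  induction n with
  | zero =>
    intro s G x A hD S hs T hT hTT hTS
    by_contra hcon
    have hpos : adjPairs G S ≠ 0 := by
      intro h0; apply hcon; rw [h0]; exact Nat.zero_le _
    obtain ⟨a, ha, hne⟩ := Finset.exists_ne_zero_of_sum_ne_zero hpos
    obtain ⟨b, hb⟩ := Finset.card_ne_zero.1 hne
    rw [Finset.mem_filter] at hb
    obtain ⟨t0, t1, t2, h01, h02, h12, rfl⟩ := Finset.card_eq_three.1 (by simpa using hT)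
    refine not_isDrawing_k5 G x A hD ![t0, t1, t2, a, b] ?_
    have := hTT t0 (by simp) t1 (by simp) h01
    have := hTT t0 (by simp) t2 (by simp) h02
    have := hTT t1 (by simp) t2 (by simp) h12
    have := hTS t0 (by simp) a ha
    have := hTS t1 (by simp) a ha
    have := hTS t2 (by simp) a ha
    have := hTS t0 (by simp) b hb.1
    have := hTS t1 (by simp) b hb.1
    have := hTS t2 (by simp) b hb.1
    have := hb.2
    intro i j hij
    fin_cases i <;> fin_cases j <;> first | (exact absurd hij (by decide)) | assumption
  | succ n ih =>
    intro s
    induction s with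
    | zero =>
      intro G x A hD S hs T hT hTT hTS
      rw [Finset.card_eq_zero] at hs
      subst hs
      simp [adjPairs]
    | succ s ihs =>
      intro G x A hD S hs T hT hTT hTS
      by_cases hlow : ∃ u ∈ S, ∃ v ∈ S, G.Adj u v ∧
          (S.filter (fun b => G.Adj u b ∧ G.Adj v b)).card ≤ maderC n
      · obtain ⟨u, hu, v, hv, huv, hc⟩ := hlow
        have h1 := adjPairs_contract G S hu hv huv
        have hvT : v ∉ T := fun h => (hTS v h v hv).ne rfl
        have hcard : (S.erase v).card = s := by rw [Finset.card_erase_of_mem hv, hs]; rfl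
        have h2 := ihs (contractInto G u v) x _ (hD.contract huv) (S.erase v) hcard T hT
          (fun a ha b hb hab => ⟨fun h => hvT (h ▸ ha), fun h => hvT (h ▸ hb), hab,
            Or.inl (hTT a ha b hb hab)⟩)
          (fun a ha b hb => ⟨fun h => hvT (h ▸ ha), (Finset.mem_erase.1 hb).1,
            (hTS a ha b (Finset.mem_erase.1 hb).2).ne,
            Or.inl (hTS a ha b (Finset.mem_erase.1 hb).2)⟩)
        rw [hs]
        rw [hcard] at h2
        simp only [maderC] at h2 ⊢
        nlinarith
      · push Not at hlow
        by_cases hpos : adjPairs G S = 0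
        · rw [hpos]; exact Nat.zero_le _
        obtain ⟨u, hu, hne⟩ := Finset.exists_ne_zero_of_sum_ne_zero hpos
        exfalso
        set S₁ := S.filter (fun b => G.Adj u b) with hS₁
        have huT : u ∉ T := fun h => (hTS u h u hu).ne rfl
        have h1 := ih S₁.card G x A hD S₁ rfl (insert u T)
          (by rw [Finset.card_insert_of_notMem huT]; omega)
          (by
            intro a ha b hb hab
            rcases Finset.mem_insert.1 ha with rfl | ha
            · rcases Finset.mem_insert.1 hb with rfl | hb
              · exact absurd rfl hab
              · exact (hTS b hb _ hu).symm
            · rcases Finset.mem_insert.1 hb with hbu | hb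
              · rw [hbu]; exact hTS a ha _ hu
              · exact hTT a ha b hb hab)
          (by
            intro a ha b hb
            rw [hS₁, Finset.mem_filter] at hb
            rcases Finset.mem_insert.1 ha with rfl | ha
            · exact hb.2
            · exact hTS a ha b hb.1)
        have h2 : S₁.card * (maderC n + 1) ≤ adjPairs G S₁ := by
          rw [← smul_eq_mul]
          apply Finset.card_nsmul_le_sum
          intro v hv
          rw [hS₁, Finset.mem_filter] at hv
          have := hlow u hu v hv.1 hv.2
          rw [hS₁, Finset.filter_filter]
          exact this
        have h3 : 0 < S₁.card := Nat.pos_of_ne_zero hne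
        nlinarith

end Mader

/-! ### A crossing lemma for multigraphs -/

lemma card_constrained {α : Type*} [Fintype α] (r : ℕ) (T : Finset α) (a : α → Fin r) :
    r ^ T.card * (Finset.univ.filter (fun f : α → Fin r => ∀ z ∈ T, f z = a z)).card
      = r ^ Fintype.card α := by
  have h1 : (Finset.univ.filter (fun f : α → Fin r => ∀ z ∈ T, f z = a z)) =
      Fintype.piFinset (fun z => if z ∈ T then {a z} else Finset.univ) := by
    ext f
    simp only [Finset.mem_filter, Finset.mem_univ, true_and, Fintype.mem_piFinset]
    refine forall_congr' fun z => ?_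
    by_cases hz : z ∈ T <;> simp [hz]
  rw [h1, Fintype.card_piFinset]
  have h2 : ∀ z, (if z ∈ T then ({a z} : Finset (Fin r)) else Finset.univ).card =
      if z ∈ T then 1 else r := by
    intro z
    by_cases hz : z ∈ T <;> simp [hz]
  rw [Finset.prod_congr rfl (fun z _ => h2 z)]
  have h3 : r ^ T.card = ∏ z : α, if z ∈ T then r else 1 := by
    rw [Finset.prod_ite_mem, Finset.univ_inter, Finset.prod_const]
  rw [h3, ← Finset.prod_mul_distrib]
  have h4 : ∀ z : α, ((if z ∈ T then r else 1) * if z ∈ T then 1 else r) = r := by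
    intro z
    by_cases hz : z ∈ T <;> simp [hz]
  rw [Finset.prod_congr rfl (fun z _ => h4 z), Finset.prod_const, Finset.card_univ]

lemma sum_constrained {α β : Type*} [Fintype α] (r t : ℕ) (B : Finset β) (T : β → Finset α)
    (hT : ∀ b ∈ B, (T b).card = t) (a : β → α → Fin r)
    [∀ f : α → Fin r, DecidablePred (fun b => ∀ z ∈ T b, f z = a b z)] :
    r ^ t * ∑ f : α → Fin r, (B.filter (fun b => ∀ z ∈ T b, f z = a b z)).card
      = B.card * r ^ Fintype.card α := by
  have h1 : ∑ f : α → Fin r, (B.filter (fun b => ∀ z ∈ T b, f z = a b z)).card =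
      ∑ b ∈ B, (Finset.univ.filter (fun f : α → Fin r => ∀ z ∈ T b, f z = a b z)).card := by
    simp only [Finset.card_filter]
    rw [Finset.sum_comm]
  rw [h1, Finset.mul_sum, ← smul_eq_mul (B.card), ← Finset.sum_const]
  refine Finset.sum_congr rfl fun b hb => ?_
  rw [← hT b hb]
  convert card_constrained r (T b) (a b)

section Crossing

variable {V E : Type*} (u w : E → V) (A : E → Set ℂ)

/-- Two edges without common endpoint whose arcs meet. -/
def Crosses (e e' : E) : Prop :=
  u e ≠ u e' ∧ u e ≠ w e' ∧ w e ≠ u e' ∧ w e ≠ w e' ∧ (A e ∩ A e').Nonempty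

/-- Ordered pairs of crossing edges. -/
noncomputable def crossPairs (F : Finset E) : Finset (E × E) :=
  (F ×ˢ F).filter (fun p => Crosses u w A p.1 p.2)

lemma mem_crossPairs (F : Finset E) (p : E × E) :
    p ∈ crossPairs u w A F ↔ (p.1 ∈ F ∧ p.2 ∈ F) ∧ Crosses u w A p.1 p.2 := by
  simp [crossPairs]

lemma crossPairs_filter (F : Finset E) (p : E → Prop) [DecidablePred p]
    [DecidablePred (fun q : E × E => p q.1 ∧ p q.2)] :
    crossPairs u w A (F.filter p) = (crossPairs u w A F).filter (fun q => p q.1 ∧ p q.2) := by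
  ext ⟨a, b⟩
  simp only [mem_crossPairs, Finset.mem_filter]
  tauto

lemma planar_bound (x : V → ℂ) (hx : Function.Injective x) (F : Finset E) (S : Finset V)
    (hne : ∀ e ∈ F, u e ≠ w e)
    (hA : ∀ e ∈ F, IsPathConnected (A e) ∧ x (u e) ∈ A e ∧ x (w e) ∈ A e)
    (hS : ∀ e ∈ F, u e ∈ S ∧ w e ∈ S)
    (hsimple : ∀ e ∈ F, ∀ e' ∈ F, s(u e, w e) = s(u e', w e') → e = e')
    (hcr : crossPairs u w A F = ∅) : F.card ≤ 14 * S.card := by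
  let G : SimpleGraph V :=
    { Adj := fun a b => ∃ e ∈ F, s(u e, w e) = s(a, b)
      symm := ⟨fun a b ⟨e, he, h⟩ => ⟨e, he, h.trans Sym2.eq_swap⟩⟩
      loopless := ⟨fun a ⟨e, he, h⟩ => hne e he (by
        rcases Sym2.eq_iff.1 h with h | h <;> rw [h.1, h.2])⟩ }
  let A' : V → V → Set ℂ := fun a b => if h : G.Adj a b then A h.choose else ∅
  have hD : IsDrawing G x A' := by
    refine ⟨hx, ?_, ?_⟩
    · intro a b hab
      have h1 := hab.choose_spec
      have h2 := hA _ h1.1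
      simp only [A', dif_pos hab]
      refine ⟨h2.1, ?_⟩
      generalize Exists.choose hab = e at h1 h2 ⊢
      rcases Sym2.eq_iff.1 h1.2 with h | h
      · rw [← h.1, ← h.2]; exact h2.2
      · rw [← h.1, ← h.2]; exact ⟨h2.2.2, h2.2.1⟩
    · intro a b c d hab hcd hac had hbc hbd
      simp only [A', dif_pos hab, dif_pos hcd]
      have h1 := hab.choose_spec
      have h2 := hcd.choose_spec
      by_contra hdis
      rw [Set.not_disjoint_iff_nonempty_inter] at hdis
      generalize Exists.choose hab = e at h1 hdis
      generalize Exists.choose hcd = e' at h2 hdis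
      have : (e, e') ∈ crossPairs u w A F := by
        simp only [crossPairs, Finset.mem_filter, Finset.mem_product]
        refine ⟨⟨h1.1, h2.1⟩, ?_⟩
        have e1 := Sym2.eq_iff.1 h1.2
        have e2 := Sym2.eq_iff.1 h2.2
        refine ⟨?_, ?_, ?_, ?_, hdis⟩ <;> rcases e1 with e1 | e1 <;> rcases e2 with e2 | e2 <;>
          simp only [e1.1, e1.2, e2.1, e2.2] <;> assumption
      rw [hcr] at this
      simp at this
  have hm := mader 3 S.card G x A' hD S rfl ∅ (by simp) (by simp) (by simp)
  have h14 : maderC 3 = 14 := rfl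
  rw [h14] at hm
  refine le_trans ?_ hm
  unfold adjPairs
  rw [← Finset.card_sigma]
  refine Finset.card_le_card_of_injOn (fun e => ⟨u e, w e⟩) ?_ ?_
  · intro e he
    simp only [Finset.coe_sigma, Set.mem_sigma_iff, Finset.mem_coe, Finset.mem_filter]
    exact ⟨(hS e he).1, (hS e he).2, e, he, rfl⟩
  · intro e he e' he' h
    simp only [Sigma.mk.injEq, heq_eq_eq] at h
    exact hsimple e he e' he' (by rw [h.1, h.2])

lemma linear_crossing (x : V → ℂ) (hx : Function.Injective x) (F : Finset E) (S : Finset V)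
    (hne : ∀ e ∈ F, u e ≠ w e)
    (hA : ∀ e ∈ F, IsPathConnected (A e) ∧ x (u e) ∈ A e ∧ x (w e) ∈ A e)
    (hS : ∀ e ∈ F, u e ∈ S ∧ w e ∈ S)
    (hsimple : ∀ e ∈ F, ∀ e' ∈ F, s(u e, w e) = s(u e', w e') → e = e') :
    F.card ≤ (crossPairs u w A F).card + 14 * S.card := by
  induction F using Finset.strongInduction with
  | H F ih =>
    by_cases hcr : crossPairs u w A F = ∅
    · exact (planar_bound u w A x hx F S hne hA hS hsimple hcr).trans (Nat.le_add_left _ _)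
    · obtain ⟨⟨e, e'⟩, hee⟩ := Finset.nonempty_iff_ne_empty.2 hcr
      have hee2 := hee
      simp only [crossPairs, Finset.mem_filter, Finset.mem_product] at hee2
      have he : e ∈ F := hee2.1.1
      have h1 := ih (F.erase e) (Finset.erase_ssubset he)
        (fun a ha => hne a (Finset.mem_of_mem_erase ha))
        (fun a ha => hA a (Finset.mem_of_mem_erase ha))
        (fun a ha => hS a (Finset.mem_of_mem_erase ha))
        (fun a ha b hb => hsimple a (Finset.mem_of_mem_erase ha) b (Finset.mem_of_mem_erase hb))
      have h2 : (crossPairs u w A (F.erase e)).card < (crossPairs u w A F).card := by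
        apply Finset.card_lt_card
        rw [Finset.ssubset_iff_of_subset]
        · refine ⟨(e, e'), hee, ?_⟩
          simp [crossPairs]
        · intro p hp
          simp only [crossPairs, Finset.mem_filter, Finset.mem_product, Finset.mem_erase] at hp ⊢
          exact ⟨⟨hp.1.1.2, hp.1.2.2⟩, hp.2⟩
      have h3 := Finset.card_erase_add_one he
      omega

lemma multi_crossing [Fintype V] (x : V → ℂ) (hx : Function.Injective x) (F : Finset E)
    (S : Finset V) (M : ℕ) (hM : 0 < M)
    (hne : ∀ e ∈ F, u e ≠ w e)
    (hA : ∀ e ∈ F, IsPathConnected (A e) ∧ x (u e) ∈ A e ∧ x (w e) ∈ A e)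
    (hS : ∀ e ∈ F, u e ∈ S ∧ w e ∈ S)
    (hmult : ∀ z : Sym2 V, (F.filter (fun e => s(u e, w e) = z)).card ≤ M) :
    M * F.card ≤ (crossPairs u w A F).card + 14 * M ^ 2 * S.card := by
  have hidx : ∃ idx : E → Fin M, ∀ e ∈ F, ∀ e' ∈ F, s(u e, w e) = s(u e', w e') →
      idx e = idx e' → e = e' := by
    have : ∀ z : Sym2 V, ∃ g : E → Fin M, ∀ e ∈ F.filter (fun e => s(u e, w e) = z),
        ∀ e' ∈ F.filter (fun e => s(u e, w e) = z), g e = g e' → e = e' := by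
      intro z
      refine ⟨fun e => if h : e ∈ F.filter (fun e => s(u e, w e) = z) then
        Fin.castLE (hmult z) ((F.filter (fun e => s(u e, w e) = z)).equivFin ⟨e, h⟩)
        else ⟨0, hM⟩, ?_⟩
      intro e he e' he' h
      beta_reduce at h
      rw [dif_pos he, dif_pos he'] at h
      have := (Finset.equivFin _).injective (Fin.castLE_injective _ h)
      exact congrArg Subtype.val this
    choose g hg using this
    refine ⟨fun e => g s(u e, w e) e, fun e he e' he' h h' => ?_⟩
    refine hg s(u e, w e) e (by simp [he]) e' (by simp [he', h]) ?_
    simp only at h'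
    rw [h'] 
    rw [h]
  obtain ⟨idx, hidx⟩ := hidx
  obtain ⟨val, hval⟩ : ∃ val : E × E → Sym2 V → Fin M, ∀ q z,
      val q z = if z = s(u q.1, w q.1) then idx q.1 else idx q.2 := ⟨_, fun _ _ => rfl⟩
  have key : ∀ f : Sym2 V → Fin M,
      (F.filter (fun e => ∀ z ∈ ({s(u e, w e)} : Finset (Sym2 V)), f z = idx e)).card ≤
      ((crossPairs u w A F).filter (fun q => ∀ z ∈ ({s(u q.1, w q.1), s(u q.2, w q.2)} :
        Finset (Sym2 V)), f z = val q z)).card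
        + 14 * S.card := by
    intro f
    simp only [Finset.mem_singleton, forall_eq]
    have h1 := linear_crossing u w A x hx (F.filter (fun e => f s(u e, w e) = idx e)) S
      (fun e he => hne e (Finset.mem_of_mem_filter e he))
      (fun e he => hA e (Finset.mem_of_mem_filter e he))
      (fun e he => hS e (Finset.mem_of_mem_filter e he))
      (fun e he e' he' h => hidx e (Finset.mem_of_mem_filter e he) e'
        (Finset.mem_of_mem_filter e' he') h (by
          rw [← (Finset.mem_filter.1 he).2, ← (Finset.mem_filter.1 he').2, h]))
    rw [crossPairs_filter] at h1
    refine h1.trans (Nat.add_le_add_right (Finset.card_le_card ?_) _)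
    intro q hq
    rw [Finset.mem_filter] at hq ⊢
    refine ⟨hq.1, fun z hz => ?_⟩
    rw [Finset.mem_insert, Finset.mem_singleton] at hz
    rw [hval]
    by_cases h : z = s(u q.1, w q.1)
    · rw [if_pos h, h]; exact hq.2.1
    · rw [if_neg h, hz.resolve_left h]; exact hq.2.2
  have s1 : M ^ 1 * (∑ f : Sym2 V → Fin M,
      (F.filter (fun e => ∀ z ∈ ({s(u e, w e)} : Finset (Sym2 V)), f z = idx e)).card) =
        F.card * M ^ Fintype.card (Sym2 V) := by
   convert sum_constrained M 1 F (fun e => ({s(u e, w e)} : Finset (Sym2 V)))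
    (fun b _ => Finset.card_singleton _) (fun e _ => idx e)
  have s2 : M ^ 2 * (∑ f : Sym2 V → Fin M,
      ((crossPairs u w A F).filter (fun q => ∀ z ∈ ({s(u q.1, w q.1), s(u q.2, w q.2)} :
        Finset (Sym2 V)), f z = val q z)).card) =
        (crossPairs u w A F).card * M ^ Fintype.card (Sym2 V) := by
   convert sum_constrained M 2 (crossPairs u w A F)
    (fun q => ({s(u q.1, w q.1), s(u q.2, w q.2)} : Finset (Sym2 V)))
    (fun q hq => by
      apply Finset.card_pair
      intro h
      simp only [mem_crossPairs, Crosses] at hq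
      rcases Sym2.eq_iff.1 h with h | h
      · exact hq.2.1 h.1
      · exact hq.2.2.1 h.1)
    val
  have s3 := Finset.sum_le_sum (fun f (_ : f ∈ (Finset.univ : Finset (Sym2 V → Fin M))) => key f)
  rw [Finset.sum_add_distrib, Finset.sum_const, Finset.card_univ, Fintype.card_fun,
    Fintype.card_fin, smul_eq_mul] at s3
  have hpos : 0 < M ^ Fintype.card (Sym2 V) := pow_pos hM _
  refine Nat.le_of_mul_le_mul_right ?_ hpos
  calc M * F.card * M ^ Fintype.card (Sym2 V) = M * (F.card * M ^ Fintype.card (Sym2 V)) := by ring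
    _ ≤ _ := by
      rw [← s1]
      have := Nat.mul_le_mul_left (M ^ 2) s3
      rw [mul_add, s2] at this
      calc _ = _ := by ring
        _ ≤ _ := this
        _ = _ := by ring

lemma crossing_lemma [Fintype V] (x : V → ℂ) (hx : Function.Injective x) (F : Finset E)
    (M r : ℕ) (hM : 0 < M) (hr : 0 < r)
    (hne : ∀ e ∈ F, u e ≠ w e)
    (hA : ∀ e ∈ F, IsPathConnected (A e) ∧ x (u e) ∈ A e ∧ x (w e) ∈ A e)
    (hmult : ∀ z : Sym2 V, (F.filter (fun e => s(u e, w e) = z)).card ≤ M) :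
    M * r ^ 2 * F.card ≤ (crossPairs u w A F).card + 14 * M ^ 2 * r ^ 3 * Fintype.card V := by
  let o : Fin r := ⟨0, hr⟩
  have key : ∀ f : V → Fin r,
      M * (F.filter (fun e => ∀ z ∈ ({u e, w e} : Finset V), f z = o)).card ≤
      ((crossPairs u w A F).filter (fun q => ∀ z ∈ ({u q.1, w q.1, u q.2, w q.2} :
        Finset V), f z = o)).card
        + 14 * M ^ 2 *
          ((Finset.univ : Finset V).filter (fun v => ∀ z ∈ ({v} : Finset V), f z = o)).card := by
    intro f
    have h1 := multi_crossing u w A x hx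
      (F.filter (fun e => ∀ z ∈ ({u e, w e} : Finset V), f z = o))
      ((Finset.univ : Finset V).filter (fun v => ∀ z ∈ ({v} : Finset V), f z = o)) M hM
      (fun e he => hne e (Finset.mem_of_mem_filter e he))
      (fun e he => hA e (Finset.mem_of_mem_filter e he))
      (fun e he => by
        have := (Finset.mem_filter.1 he).2
        simp only [Finset.mem_insert, Finset.mem_singleton, forall_eq_or_imp, forall_eq] at this
        simpa using this)
      (fun z => (Finset.card_le_card
        (Finset.filter_subset_filter _ (Finset.filter_subset _ _))).trans (hmult z))
    rw [crossPairs_filter] at h1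
    refine h1.trans (Nat.add_le_add_right (Finset.card_le_card ?_) _)
    intro q hq
    rw [Finset.mem_filter] at hq ⊢
    refine ⟨hq.1, ?_⟩
    simp only [Finset.mem_insert, Finset.mem_singleton, forall_eq_or_imp, forall_eq] at hq ⊢
    tauto
  have s1 := sum_constrained r 2 F (fun e => ({u e, w e} : Finset V))
    (fun e he => Finset.card_pair (hne e he)) (fun _ _ => o)
  have s2 := sum_constrained r 4 (crossPairs u w A F)
    (fun q => ({u q.1, w q.1, u q.2, w q.2} : Finset V))
    (fun q hq => by
      simp only [mem_crossPairs, Crosses] at hq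
      obtain ⟨⟨h1, h2⟩, h3, h4, h5, h6, -⟩ := hq
      have h7 := hne _ h1
      have h8 := hne _ h2
      rw [Finset.card_insert_of_notMem (by simp [*]), Finset.card_insert_of_notMem (by simp [*]),
        Finset.card_pair h8])
    (fun _ _ => o)
  have s4 := sum_constrained r 1 (Finset.univ : Finset V) (fun v => ({v} : Finset V))
    (fun v _ => Finset.card_singleton v) (fun _ _ => o)
  have s3 := Finset.sum_le_sum (fun f (_ : f ∈ (Finset.univ : Finset (V → Fin r))) => key f)
  rw [Finset.sum_add_distrib, ← Finset.mul_sum, ← Finset.mul_sum] at s3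
  have hpos : 0 < r ^ Fintype.card V := pow_pos hr _
  refine Nat.le_of_mul_le_mul_right ?_ hpos
  rw [Finset.card_univ] at s4
  have := Nat.mul_le_mul_left (r ^ 4) s3
  rw [mul_add, s2] at this
  calc _ = M * r ^ 2 * (F.card * r ^ Fintype.card V) := by ring
    _ = _ := by rw [← s1]
    _ = _ := by ring
    _ ≤ _ := this
    _ = (crossPairs u w A F).card * r ^ Fintype.card V + 14 * M ^ 2 * r ^ 3 *
        (r ^ 1 * ∑ f : V → Fin r, ((Finset.univ : Finset V).filter
          (fun v => ∀ z ∈ ({v} : Finset V), f z = o)).card) := by ring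
    _ = _ := by rw [s4]; ring

end Crossing

/-! ### From curves to combinatorial data -/

lemma curve_layout (γ : Set (ℝ × ℝ)) (hγ : IsSimpleCurve γ) (Q : Finset (ℝ × ℝ)) :
    ∃ (pt : ℕ → ℝ × ℝ) (arc : ℕ → Set (ℝ × ℝ)),
      (∀ i < (Q.filter (fun p => p ∈ γ)).card, pt i ∈ Q ∧ pt i ∈ γ) ∧
      (∀ i < (Q.filter (fun p => p ∈ γ)).card, ∀ j < (Q.filter (fun p => p ∈ γ)).card,
        pt i = pt j → i = j) ∧
      (∀ i, i + 1 < (Q.filter (fun p => p ∈ γ)).card →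
        IsPathConnected (arc i) ∧ pt i ∈ arc i ∧ pt (i + 1) ∈ arc i ∧ arc i ⊆ γ) ∧
      (∀ i, i + 1 < (Q.filter (fun p => p ∈ γ)).card → ∀ x ∈ arc i, x ∈ Q →
        x = pt i ∨ x = pt (i + 1)) ∧
      (∀ i, i + 1 < (Q.filter (fun p => p ∈ γ)).card →
        ∀ j, j + 1 < (Q.filter (fun p => p ∈ γ)).card → ∀ x ∈ arc i, x ∈ arc j → x ∉ Q →
        i = j) := by
  obtain ⟨F, hFc, hFi, hFγ⟩ : ∃ F : ℝ → ℝ × ℝ, Continuous F ∧ Set.InjOn F (Set.Icc 0 1) ∧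
      γ = F '' Set.Icc 0 1 := by
    obtain ⟨f, hfc, hfi, rfl⟩ := hγ
    refine ⟨Set.IccExtend (zero_le_one) f, hfc.Icc_extend', ?_, ?_⟩
    · intro s hs t ht h
      rw [Set.IccExtend_of_mem _ _ hs, Set.IccExtend_of_mem _ _ ht] at h
      exact congrArg Subtype.val (hfi h)
    · ext p
      constructor
      · rintro ⟨s, rfl⟩
        exact ⟨s, s.2, Set.IccExtend_val _ _ _⟩
      · rintro ⟨s, hs, rfl⟩
        exact ⟨⟨s, hs⟩, (Set.IccExtend_of_mem _ _ hs).symm⟩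
  have hg : ∀ p : ℝ × ℝ, ∃ s : ℝ, p ∈ γ → s ∈ Set.Icc (0:ℝ) 1 ∧ F s = p := by
    intro p
    by_cases hp : p ∈ γ
    · rw [hFγ] at hp
      obtain ⟨s, hs, h⟩ := hp
      exact ⟨s, fun _ => ⟨hs, h⟩⟩
    · exact ⟨0, fun h => absurd h hp⟩
  choose g hg using hg
  obtain ⟨t, ht⟩ : ∃ t, t = (Q.filter (fun p => p ∈ γ)).card := ⟨_, rfl⟩
  obtain ⟨T, hT⟩ : ∃ T, T = (Q.filter (fun p => p ∈ γ)).image g := ⟨_, rfl⟩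
  have hTc : T.card = t := by
    rw [hT, ht]
    apply Finset.card_image_of_injOn
    intro p hp q hq h
    simp only [Finset.coe_filter, Set.mem_ofPred_eq] at hp hq
    rw [← (hg p hp.2).2, ← (hg q hq.2).2, h]
  have hTm : ∀ s, s ∈ T ↔ s ∈ Set.Icc (0:ℝ) 1 ∧ F s ∈ Q := by
    intro s
    rw [hT, Finset.mem_image]
    constructor
    · rintro ⟨p, hp, rfl⟩
      rw [Finset.mem_filter] at hp
      exact ⟨(hg p hp.2).1, by rw [(hg p hp.2).2]; exact hp.1⟩
    · rintro ⟨hs, hQ⟩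
      have : F s ∈ γ := by rw [hFγ]; exact ⟨s, hs, rfl⟩
      exact ⟨F s, Finset.mem_filter.2 ⟨hQ, this⟩, hFi (hg _ this).1 hs (hg _ this).2⟩
  rw [← ht]
  obtain ⟨τ, hτm, hτs, hτr⟩ : ∃ τ : ℕ → ℝ, (∀ i < t, τ i ∈ T) ∧
      (∀ i < t, ∀ j < t, i < j → τ i < τ j) ∧ (∀ s ∈ T, ∃ i < t, τ i = s) := by
    refine ⟨fun i => if h : i < t then T.orderEmbOfFin hTc ⟨i, h⟩ else 0, ?_, ?_, ?_⟩
    · intro i hi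
      simp only [hi, dif_pos]
      exact Finset.orderEmbOfFin_mem _ _ _
    · intro i hi j hj hij
      simp only [hi, hj, dif_pos]
      exact (T.orderEmbOfFin hTc).strictMono hij
    · intro s hs
      have : s ∈ Set.range (T.orderEmbOfFin hTc) := by
        rw [Finset.range_orderEmbOfFin]; exact hs
      obtain ⟨i, hi⟩ := this
      exact ⟨i, i.2, by simp only [i.2, dif_pos]; exact hi⟩
  have hτm' : ∀ i < t, ∀ j < t, i ≤ j → τ i ≤ τ j := by
    intro i hi j hj hij
    rcases hij.eq_or_lt with h | h
    · rw [h]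
    · exact (hτs i hi j hj h).le
  have hI : ∀ i, i + 1 < t → Set.Icc (τ i) (τ (i + 1)) ⊆ Set.Icc 0 1 := fun i hi =>
    Set.Icc_subset_Icc ((hTm _).1 (hτm i (by omega))).1.1 ((hTm _).1 (hτm (i + 1) hi)).1.2
  refine ⟨fun i => F (τ i), fun i => F '' Set.Icc (τ i) (τ (i + 1)), ?_, ?_, ?_, ?_, ?_⟩
  · intro i hi
    have := (hTm _).1 (hτm i hi)
    exact ⟨this.2, by rw [hFγ]; exact ⟨_, this.1, rfl⟩⟩
  · intro i hi j hj h
    have := hFi ((hTm _).1 (hτm i hi)).1 ((hTm _).1 (hτm j hj)).1 h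
    by_contra hne
    rcases lt_or_gt_of_ne hne with h' | h'
    · exact absurd this (hτs i hi j hj h').ne
    · exact absurd this (hτs j hj i hi h').ne'
  · intro i hi
    have hle := hτm' i (by omega) (i + 1) hi (by omega)
    refine ⟨?_, ⟨_, Set.left_mem_Icc.2 hle, rfl⟩, ⟨_, Set.right_mem_Icc.2 hle, rfl⟩, ?_⟩
    · exact ((convex_Icc _ _).isPathConnected (Set.nonempty_Icc.2 hle)).image hFc
    · rw [hFγ]
      exact Set.image_mono (hI i hi)
  · rintro i hi x ⟨s, hs, rfl⟩ hQ
    obtain ⟨j, hj, rfl⟩ := hτr s ((hTm s).2 ⟨hI i hi hs, hQ⟩)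
    have h1 : i ≤ j := by
      by_contra h
      exact absurd hs.1 (not_le.2 (hτs j hj i (by omega) (by omega)))
    have h2 : j ≤ i + 1 := by
      by_contra h
      exact absurd hs.2 (not_le.2 (hτs (i + 1) hi j hj (by omega)))
    rcases h1.eq_or_lt with h | h
    · left; rw [h]
    · right; rw [show j = i + 1 by omega]
  · have main : ∀ i, i + 1 < t → ∀ j, j + 1 < t → ∀ x ∈ F '' Set.Icc (τ i) (τ (i + 1)),
        x ∈ F '' Set.Icc (τ j) (τ (j + 1)) → x ∉ Q → ¬ i < j := by
      rintro i hi j hj x ⟨s, hs, rfl⟩ ⟨s', hs', h⟩ hQ hij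
      have := hFi (hI j hj hs') (hI i hi hs) h
      subst this
      have h1 := hτm' (i + 1) hi j (by omega) hij
      have h2 : s' = τ j := le_antisymm (hs.2.trans h1) hs'.1
      apply hQ
      rw [h2]
      exact ((hTm _).1 (hτm j (by omega))).2
    intro i hi j hj x hx hx' hQ
    have h1 := main i hi j hj x hx hx' hQ
    have h2 := main j hj i hi x hx' hx hQ
    omega

lemma crossing_plane {E : Type*} (u w : E → ℝ × ℝ) (A : E → Set (ℝ × ℝ))
    (Q : Finset (ℝ × ℝ)) (F : Finset E) (M r : ℕ) (hM : 0 < M) (hr : 0 < r)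
    (hQ : ∀ e ∈ F, u e ∈ Q ∧ w e ∈ Q)
    (hne : ∀ e ∈ F, u e ≠ w e)
    (hA : ∀ e ∈ F, IsPathConnected (A e) ∧ u e ∈ A e ∧ w e ∈ A e)
    (hmult : ∀ p q : ℝ × ℝ, p ≠ q →
      (F.filter (fun e => s(u e, w e) = s(p, q))).card ≤ M) :
    M * r ^ 2 * F.card ≤ ((F ×ˢ F).filter (fun q => u q.1 ≠ u q.2 ∧ u q.1 ≠ w q.2 ∧
        w q.1 ≠ u q.2 ∧ w q.1 ≠ w q.2 ∧ (A q.1 ∩ A q.2).Nonempty)).card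
      + 14 * M ^ 2 * r ^ 3 * Q.card := by
  rcases F.eq_empty_or_nonempty with rfl | ⟨e0, he0⟩
  · simp
  obtain ⟨φ, hφ⟩ : ∃ φ : ℝ × ℝ → {p // p ∈ Q}, ∀ p ∈ Q, (φ p : ℝ × ℝ) = p := by
    refine ⟨fun p => if h : p ∈ Q then ⟨p, h⟩ else ⟨u e0, (hQ e0 he0).1⟩, fun p hp => ?_⟩
    simp [hp]
  have hφi : ∀ p ∈ Q, ∀ q ∈ Q, φ p = φ q → p = q := by
    intro p hp q hq h
    rw [← hφ p hp, ← hφ q hq, h]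
  let ψ : ℝ × ℝ → ℂ := fun p => Complex.equivRealProdCLM.symm p
  have hψc : Continuous ψ := Complex.equivRealProdCLM.symm.continuous
  have hψi : Function.Injective ψ := Complex.equivRealProdCLM.symm.injective
  have h := crossing_lemma (fun e => φ (u e)) (fun e => φ (w e)) (fun e => ψ '' A e)
    (fun v : {p // p ∈ Q} => ψ v) (fun a b h => Subtype.ext (hψi h)) F M r hM hr ?_ ?_ ?_
  · rw [Fintype.card_coe] at h
    refine h.trans (Nat.add_le_add_right (Finset.card_le_card ?_) _)
    intro q hq
    rw [mem_crossPairs] at hq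
    obtain ⟨⟨h1, h2⟩, h3, h4, h5, h6, x, ⟨y, hy, rfl⟩, ⟨z, hz, hz'⟩⟩ := hq
    rw [Finset.mem_filter, Finset.mem_product]
    refine ⟨⟨h1, h2⟩, fun h => h3 (congrArg φ h), fun h => h4 (congrArg φ h),
      fun h => h5 (congrArg φ h), fun h => h6 (congrArg φ h), y, hy, ?_⟩
    rw [← hψi hz']; exact hz
  · intro e he h
    exact hne e he (hφi _ (hQ e he).1 _ (hQ e he).2 h)
  · intro e he
    refine ⟨(hA e he).1.image hψc, ⟨u e, (hA e he).2.1, ?_⟩, ⟨w e, (hA e he).2.2, ?_⟩⟩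
    · simp only [hφ _ (hQ e he).1]
    · simp only [hφ _ (hQ e he).2]
  · intro z
    have hm : ∀ z : Sym2 {p // p ∈ Q},
        (F.filter (fun e => s(φ (u e), φ (w e)) = z)).card ≤ M := by
      intro z
      induction z using Sym2.ind with
      | _ p q =>
        by_cases hpq : (p : ℝ × ℝ) = q
        · rw [Finset.card_eq_zero.2]
          · exact Nat.zero_le _
          · rw [Finset.filter_eq_empty_iff]
            intro e he h
            have hpq' : p = q := Subtype.ext hpq
            subst hpq'
            apply hne e he
            apply hφi _ (hQ e he).1 _ (hQ e he).2
            rcases Sym2.eq_iff.1 h with h | h <;> rw [h.1, h.2]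
        · refine le_trans (Finset.card_le_card ?_) (hmult p q hpq)
          intro e he
          rw [Finset.mem_filter] at he ⊢
          refine ⟨he.1, ?_⟩
          have h1 := hQ e he.1
          rcases Sym2.eq_iff.1 he.2 with h | h
          · rw [← h.1, ← h.2, hφ _ h1.1, hφ _ h1.2]
          · rw [← h.1, ← h.2, hφ _ h1.1, hφ _ h1.2, Sym2.eq_swap]
    convert hm z

/-- Combinatorial data extracted from a family of curves and a finite point set. -/
lemma family_layout (C : Finset (Set (ℝ × ℝ))) (k : ℕ) (hC : KIntersecting C k)
    (Q : Finset (ℝ × ℝ)) :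
    ∃ pt : Set (ℝ × ℝ) → ℕ → ℝ × ℝ,
      (∀ γ ∈ C, ∀ i < (Q.filter (fun p => p ∈ γ)).card, pt γ i ∈ Q ∧ pt γ i ∈ γ) ∧
      (∀ γ ∈ C, ∀ i < (Q.filter (fun p => p ∈ γ)).card,
        ∀ j < (Q.filter (fun p => p ∈ γ)).card, pt γ i = pt γ j → i = j) ∧
      (∀ F : Finset (Set (ℝ × ℝ) × ℕ),
        (∀ e ∈ F, e.1 ∈ C ∧ e.2 + 1 < (Q.filter (fun p => p ∈ e.1)).card) →
        ∀ M r : ℕ, 0 < M → 0 < r →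
        (∀ p q : ℝ × ℝ, p ≠ q →
          (F.filter (fun e => s(pt e.1 e.2, pt e.1 (e.2 + 1)) = s(p, q))).card ≤ M) →
        M * r ^ 2 * F.card ≤ k * C.card ^ 2 + 14 * M ^ 2 * r ^ 3 * Q.card) := by
  have hl : ∀ γ : Set (ℝ × ℝ), ∃ (pt : ℕ → ℝ × ℝ) (arc : ℕ → Set (ℝ × ℝ)), γ ∈ C →
      (∀ i < (Q.filter (fun p => p ∈ γ)).card, pt i ∈ Q ∧ pt i ∈ γ) ∧
      (∀ i < (Q.filter (fun p => p ∈ γ)).card, ∀ j < (Q.filter (fun p => p ∈ γ)).card,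
        pt i = pt j → i = j) ∧
      (∀ i, i + 1 < (Q.filter (fun p => p ∈ γ)).card →
        IsPathConnected (arc i) ∧ pt i ∈ arc i ∧ pt (i + 1) ∈ arc i ∧ arc i ⊆ γ) ∧
      (∀ i, i + 1 < (Q.filter (fun p => p ∈ γ)).card → ∀ x ∈ arc i, x ∈ Q →
        x = pt i ∨ x = pt (i + 1)) ∧
      (∀ i, i + 1 < (Q.filter (fun p => p ∈ γ)).card →
        ∀ j, j + 1 < (Q.filter (fun p => p ∈ γ)).card → ∀ x ∈ arc i, x ∈ arc j → x ∉ Q →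
        i = j) := by
    intro γ
    by_cases h : γ ∈ C
    · obtain ⟨pt, arc, h'⟩ := curve_layout γ (hC.1 γ h) Q
      exact ⟨pt, arc, fun _ => h'⟩
    · exact ⟨fun _ => 0, fun _ => ∅, fun h' => absurd h' h⟩
  choose pt arc hl using hl
  refine ⟨pt, fun γ hγ => (hl γ hγ).1, fun γ hγ => (hl γ hγ).2.1, ?_⟩
  intro F hF M r hM hr hmult
  have h := crossing_plane (fun e : Set (ℝ × ℝ) × ℕ => pt e.1 e.2) (fun e => pt e.1 (e.2 + 1))
    (fun e => arc e.1 e.2) Q F M r hM hr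
    (fun e he => ⟨((hl e.1 (hF e he).1).1 _ (by have := (hF e he).2; omega)).1,
      ((hl e.1 (hF e he).1).1 _ (hF e he).2).1⟩)
    (fun e he h => by
      have := (hl e.1 (hF e he).1).2.1 _ (by have := (hF e he).2; omega) _ (hF e he).2 h
      omega)
    (fun e he => by
      have := (hl e.1 (hF e he).1).2.2.1 _ (hF e he).2
      exact ⟨this.1, this.2.1, this.2.2.1⟩) hmult
  refine h.trans (Nat.add_le_add_right ?_ _)
  -- count the crossings
  obtain ⟨X, hX⟩ : ∃ X, X = ((F ×ˢ F).filter (fun q => pt q.1.1 q.1.2 ≠ pt q.2.1 q.2.2 ∧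
      pt q.1.1 q.1.2 ≠ pt q.2.1 (q.2.2 + 1) ∧ pt q.1.1 (q.1.2 + 1) ≠ pt q.2.1 q.2.2 ∧
      pt q.1.1 (q.1.2 + 1) ≠ pt q.2.1 (q.2.2 + 1) ∧
      (arc q.1.1 q.1.2 ∩ arc q.2.1 q.2.2).Nonempty)) := ⟨_, rfl⟩
  rw [← hX]
  have hx : ∀ q : (Set (ℝ × ℝ) × ℕ) × (Set (ℝ × ℝ) × ℕ), ∃ x : ℝ × ℝ, q ∈ X →
      x ∈ arc q.1.1 q.1.2 ∧ x ∈ arc q.2.1 q.2.2 ∧ x ∉ Q := by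
    intro q
    by_cases hq : q ∈ X
    · have hq' := hq
      rw [hX, Finset.mem_filter, Finset.mem_product] at hq'
      obtain ⟨⟨h1, h2⟩, h3, h4, h5, h6, x, hx1, hx2⟩ := hq'
      refine ⟨x, fun _ => ⟨hx1, hx2, fun hxQ => ?_⟩⟩
      rcases (hl _ (hF _ h1).1).2.2.2.1 _ (hF _ h1).2 x hx1 hxQ with h | h <;>
        rcases (hl _ (hF _ h2).1).2.2.2.1 _ (hF _ h2).2 x hx2 hxQ with h' | h'
      · exact h3 (h.symm.trans h')
      · exact h4 (h.symm.trans h')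
      · exact h5 (h.symm.trans h')
      · exact h6 (h.symm.trans h')
    · exact ⟨0, fun h => absurd h hq⟩
  choose x hx using hx
  have hXF : ∀ q ∈ X, q.1 ∈ F ∧ q.2 ∈ F := by
    intro q hq
    rw [hX, Finset.mem_filter, Finset.mem_product] at hq
    exact hq.1
  have hXne : ∀ q ∈ X, q.1.1 ≠ q.2.1 := by
    rintro ⟨⟨γ, i⟩, ⟨γ', j⟩⟩ hq h
    simp only at h
    subst h
    have h1 := hx _ hq
    have h2 := hXF _ hq
    have h3 := (hl _ (hF _ h2.1).1).2.2.2.2 i (hF _ h2.1).2 j (hF _ h2.2).2 _ h1.1 h1.2.1 h1.2.2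
    subst h3
    rw [hX, Finset.mem_filter] at hq
    exact hq.2.1 rfl
  have hfin : ∀ g : Set (ℝ × ℝ) × Set (ℝ × ℝ), ∃ S : Finset (ℝ × ℝ),
      (g ∈ C.offDiag → ∀ y, y ∈ g.1 → y ∈ g.2 → y ∈ S) ∧ S.card ≤ k := by
    intro g
    by_cases hg : g ∈ C.offDiag
    · have hg' := hg
      rw [Finset.mem_offDiag] at hg'
      have := hC.2 g.1 hg'.1 g.2 hg'.2.1 hg'.2.2
      refine ⟨this.1.toFinset, fun _ y h1 h2 => by simp [h1, h2], ?_⟩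
      rw [← Set.ncard_eq_toFinset_card _ this.1]
      exact this.2
    · exact ⟨∅, fun h => absurd h hg, by simp⟩
  choose S hS hSk using hfin
  have h1 : X.card ≤ (C.offDiag.sigma S).card := by
    refine Finset.card_le_card_of_injOn (fun q => ⟨(q.1.1, q.2.1), x q⟩) ?_ ?_
    · intro q hq
      have hq : q ∈ X := hq
      have h2 := hXF q hq
      have h3 : (q.1.1, q.2.1) ∈ C.offDiag :=
        Finset.mem_offDiag.2 ⟨(hF _ h2.1).1, (hF _ h2.2).1, hXne q hq⟩
      refine Finset.mem_coe.2 (Finset.mem_sigma.2 ⟨h3, ?_⟩)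
      exact hS _ h3 _ (((hl _ (hF _ h2.1).1).2.2.1 _ (hF _ h2.1).2).2.2.2 (hx q hq).1)
        (((hl _ (hF _ h2.2).1).2.2.1 _ (hF _ h2.2).2).2.2.2 (hx q hq).2.1)
    · rintro ⟨⟨γ, i⟩, ⟨γ', j⟩⟩ hq ⟨⟨δ, i'⟩, ⟨δ', j'⟩⟩ hq' h
      have hq := Finset.mem_coe.1 hq
      have hq' := Finset.mem_coe.1 hq'
      simp only [Sigma.mk.injEq, Prod.mk.injEq, heq_eq_eq] at h
      obtain ⟨⟨rfl, rfl⟩, h⟩ := h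
      have a1 := hx _ hq
      have a2 := hx _ hq'
      rw [← h] at a2
      have b1 := hXF _ hq
      have b2 := hXF _ hq'
      have c1 := (hl _ (hF _ b1.1).1).2.2.2.2 i (hF _ b1.1).2 i' (hF _ b2.1).2 _ a1.1 a2.1 a1.2.2
      have c2 := (hl _ (hF _ b1.2).1).2.2.2.2 j (hF _ b1.2).2 j' (hF _ b2.2).2 _
        a1.2.1 a2.2.1 a1.2.2
      rw [c1, c2]
  refine h1.trans ?_
  rw [Finset.card_sigma]
  calc ∑ a ∈ C.offDiag, (S a).card ≤ ∑ a ∈ C.offDiag, k := Finset.sum_le_sum fun a _ => hSk a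
    _ = C.offDiag.card * k := by rw [Finset.sum_const, smul_eq_mul]
    _ ≤ C.card ^ 2 * k := by
      apply Nat.mul_le_mul_right
      rw [Finset.offDiag_card, sq]
      exact Nat.sub_le _ _
    _ = _ := mul_comm _ _

lemma incidence_double (C : Finset (Set (ℝ × ℝ))) (Q : Finset (ℝ × ℝ)) :
    ∑ γ ∈ C, (Q.filter (fun p => p ∈ γ)).card = ∑ p ∈ Q, (C.filter (fun γ => p ∈ γ)).card := by
  simp only [Finset.card_filter]
  exact Finset.sum_comm

/-- The basic estimate for a set of points whose degrees are at most `2 * D`. -/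
lemma dyadic_raw (C : Finset (Set (ℝ × ℝ))) (k : ℕ) (hC : KIntersecting C k)
    (Q : Finset (ℝ × ℝ)) (D M h : ℕ) (hM : 0 < M) (hh : 0 < h)
    (hD : ∀ p ∈ Q, (C.filter (fun γ => p ∈ γ)).card ≤ 2 * D)
    (hMh : 4 * D < (M + 1) * (h + 1)) :
    ∃ e : ℕ, ∑ p ∈ Q, (C.filter (fun γ => p ∈ γ)).card ≤
        k * C.card + Q.card * h ^ k + k * e ∧
      ∀ r : ℕ, 0 < r → M * r ^ 2 * e ≤ k * C.card ^ 2 + 14 * M ^ 2 * r ^ 3 * Q.card := by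
  obtain ⟨pt, hptQ, hpti, hcr⟩ := family_layout C k hC Q
  obtain ⟨t, ht⟩ : ∃ t : Set (ℝ × ℝ) → ℕ, ∀ γ, (Q.filter (fun p => p ∈ γ)).card = t γ :=
    ⟨_, fun _ => rfl⟩
  rw [← incidence_double]
  simp only [ht] at hptQ hpti hcr ⊢
  have htQ : ∀ γ, t γ ≤ Q.card := fun γ => by rw [← ht]; exact Finset.card_filter_le _ _
  obtain ⟨N, hN⟩ : ∃ N, N = Q.card := ⟨_, rfl⟩
  obtain ⟨Ed, hEd⟩ : ∃ Ed, Ed = (C ×ˢ Finset.range N).filter (fun e => e.2 + 1 < t e.1) :=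
    ⟨_, rfl⟩
  have hEdm : ∀ e, e ∈ Ed ↔ e.1 ∈ C ∧ e.2 + 1 < t e.1 := by
    intro e
    rw [hEd, Finset.mem_filter, Finset.mem_product, Finset.mem_range]
    have := htQ e.1
    constructor
    · rintro ⟨⟨h1, -⟩, h2⟩; exact ⟨h1, h2⟩
    · rintro ⟨h1, h2⟩; exact ⟨⟨h1, by omega⟩, h2⟩
  obtain ⟨mult, hmult⟩ : ∃ mult : Sym2 (ℝ × ℝ) → ℕ, ∀ z,
      mult z = (Ed.filter (fun e => s(pt e.1 e.2, pt e.1 (e.2 + 1)) = z)).card :=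
    ⟨_, fun _ => rfl⟩
  obtain ⟨Hn, hHn⟩ : ∃ Hn : ℝ × ℝ → Finset (ℝ × ℝ), ∀ p,
      Hn p = Q.filter (fun q => M < mult s(p, q)) := ⟨_, fun _ => rfl⟩
  have hHc : ∀ p ∈ Q, (Hn p).card ≤ h := by
    intro p hp
    by_contra hcon
    push Not at hcon
    have h1 : (M + 1) * (Hn p).card ≤ 2 * (C.filter (fun γ => p ∈ γ)).card := by
      calc (M + 1) * (Hn p).card = ∑ q ∈ Hn p, (M + 1) := by
            rw [Finset.sum_const, smul_eq_mul, mul_comm]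
        _ ≤ ∑ q ∈ Hn p, mult s(p, q) := by
            apply Finset.sum_le_sum
            intro q hq
            rw [hHn, Finset.mem_filter] at hq
            exact hq.2
        _ = ((Hn p).biUnion (fun q => Ed.filter
              (fun e => s(pt e.1 e.2, pt e.1 (e.2 + 1)) = s(p, q)))).card := by
            rw [Finset.card_biUnion]
            · exact Finset.sum_congr rfl fun q _ => hmult _
            · intro q _ q' _ hne
              rw [Function.onFun, Finset.disjoint_left]
              intro e he he'
              rw [Finset.mem_filter] at he he'
              exact hne (Sym2.congr_right.1 (he.2.symm.trans he'.2))
        _ ≤ (Ed.filter (fun e => pt e.1 e.2 = p) ∪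
              Ed.filter (fun e => pt e.1 (e.2 + 1) = p)).card := by
            apply Finset.card_le_card
            intro e he
            rw [Finset.mem_biUnion] at he
            obtain ⟨q, -, he⟩ := he
            rw [Finset.mem_filter] at he
            rw [Finset.mem_union, Finset.mem_filter, Finset.mem_filter]
            rcases Sym2.eq_iff.1 he.2 with h | h
            · left; exact ⟨he.1, h.1⟩
            · right; exact ⟨he.1, h.2⟩
        _ ≤ _ := Finset.card_union_le _ _
        _ ≤ (C.filter (fun γ => p ∈ γ)).card + (C.filter (fun γ => p ∈ γ)).card := by
            apply Nat.add_le_add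
            · apply Finset.card_le_card_of_injOn Prod.fst
              · intro e he
                rw [Finset.mem_coe, Finset.mem_filter, hEdm] at he
                rw [Finset.mem_coe, Finset.mem_filter]
                refine ⟨he.1.1, ?_⟩
                rw [← he.2]
                exact (hptQ _ he.1.1 _ (by omega)).2
              · rintro ⟨γ, i⟩ he ⟨γ', j⟩ he' hee
                rw [Finset.mem_coe, Finset.mem_filter, hEdm] at he he'
                simp only at hee he he'
                subst hee
                rw [hpti γ he.1.1 i (by omega) j (by omega) (he.2.trans he'.2.symm)]
            · apply Finset.card_le_card_of_injOn Prod.fst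
              · intro e he
                rw [Finset.mem_coe, Finset.mem_filter, hEdm] at he
                rw [Finset.mem_coe, Finset.mem_filter]
                refine ⟨he.1.1, ?_⟩
                rw [← he.2]
                exact (hptQ _ he.1.1 _ (by omega)).2
              · rintro ⟨γ, i⟩ he ⟨γ', j⟩ he' hee
                rw [Finset.mem_coe, Finset.mem_filter, hEdm] at he he'
                simp only at hee he he'
                subst hee
                have := hpti γ he.1.1 (i + 1) (by omega) (j + 1) (by omega)
                  (he.2.trans he'.2.symm)
                rw [show i = j by omega]
        _ = _ := by ring
    have h2 := hD p hp
    have h3 : (M + 1) * (h + 1) ≤ (M + 1) * (Hn p).card := Nat.mul_le_mul_left _ hcon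
    omega
  have hidx : ∀ p, ∃ g : ℝ × ℝ → Fin h, p ∈ Q → ∀ q ∈ Hn p, ∀ q' ∈ Hn p, g q = g q' → q = q' := by
    intro p
    by_cases hp : p ∈ Q
    · refine ⟨fun q => if hq : q ∈ Hn p then Fin.castLE (hHc p hp) ((Hn p).equivFin ⟨q, hq⟩)
        else ⟨0, hh⟩, fun _ q hq q' hq' h => ?_⟩
      beta_reduce at h
      rw [dif_pos hq, dif_pos hq'] at h
      exact congrArg Subtype.val ((Finset.equivFin _).injective (Fin.castLE_injective _ h))
    · exact ⟨fun _ => ⟨0, hh⟩, fun h => absurd h hp⟩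
  choose idx hidx using hidx
  -- the light edges
  obtain ⟨L, hL⟩ : ∃ L, L = Ed.filter (fun e => mult s(pt e.1 e.2, pt e.1 (e.2 + 1)) ≤ M) :=
    ⟨_, rfl⟩
  -- windows
  obtain ⟨W, hW⟩ : ∃ W, W = (C ×ˢ Finset.range N).filter (fun e => e.2 + k < t e.1) :=
    ⟨_, rfl⟩
  have hWm : ∀ e, e ∈ W ↔ e.1 ∈ C ∧ e.2 + k < t e.1 := by
    intro e
    rw [hW, Finset.mem_filter, Finset.mem_product, Finset.mem_range]
    have := htQ e.1
    constructor
    · rintro ⟨⟨h1, -⟩, h2⟩; exact ⟨h1, h2⟩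
    · rintro ⟨h1, h2⟩; exact ⟨⟨h1, by omega⟩, h2⟩
  have hWc : ∑ γ ∈ C, t γ ≤ k * C.card + W.card := by
    have : W.card = ∑ γ ∈ C, (t γ - k) := by
      have h1 : W.card = (C.sigma (fun γ => Finset.range (t γ - k))).card := by
        refine Finset.card_bij (fun e _ => ⟨e.1, e.2⟩) ?_ ?_ ?_
        · intro e he
          rw [hWm] at he
          rw [Finset.mem_sigma, Finset.mem_range]
          exact ⟨he.1, by simp only; omega⟩
        · rintro ⟨a, b⟩ _ ⟨c, d⟩ _ h
          simpa using h
        · rintro ⟨a, b⟩ hb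
          rw [Finset.mem_sigma, Finset.mem_range] at hb
          exact ⟨(a, b), (hWm _).2 ⟨hb.1, by have := hb.2; simp only at this ⊢; omega⟩, rfl⟩
      rw [h1, Finset.card_sigma]
      simp
    rw [this, show k * C.card = ∑ γ ∈ C, k by rw [Finset.sum_const, smul_eq_mul, mul_comm],
      ← Finset.sum_add_distrib]
    apply Finset.sum_le_sum
    intro γ _
    omega
  obtain ⟨Wb, hWb⟩ : ∃ Wb, Wb = W.filter (fun e => ∀ j < k,
      M < mult s(pt e.1 (e.2 + j), pt e.1 (e.2 + j + 1))) := ⟨_, rfl⟩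
  have hWbc : Wb.card ≤ Q.card * h ^ k := by
    have h1 : Wb.card ≤ (Q ×ˢ (Finset.univ : Finset (Fin k → Fin h))).card := by
      apply Finset.card_le_card_of_injOn
        (fun e => (pt e.1 e.2, fun j : Fin k =>
          idx (pt e.1 (e.2 + j)) (pt e.1 (e.2 + j + 1))))
      · intro e he
        rw [Finset.mem_coe, hWb, Finset.mem_filter, hWm] at he
        rw [Finset.mem_coe, Finset.mem_product]
        exact ⟨(hptQ _ he.1.1 _ (by omega)).1, Finset.mem_univ _⟩
      · rintro ⟨γ, i⟩ he ⟨γ', i'⟩ he' hee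
        rw [Finset.mem_coe, hWb, Finset.mem_filter, hWm] at he he'
        simp only [Prod.mk.injEq] at hee he he'
        obtain ⟨⟨hγ, hi⟩, hhv⟩ := he
        obtain ⟨⟨hγ', hi'⟩, hhv'⟩ := he'
        have hsame : ∀ j ≤ k, pt γ (i + j) = pt γ' (i' + j) := by
          intro j
          induction j with
          | zero => intro _; simpa using hee.1
          | succ j ih =>
            intro hj
            have ih := ih (by omega)
            have h2 := congrFun hee.2 ⟨j, by omega⟩
            simp only at h2
            rw [← ih] at h2
            have hpQ := (hptQ γ hγ (i + j) (by omega)).1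
            refine hidx (pt γ (i + j)) hpQ _ ?_ _ ?_ h2
            · rw [hHn, Finset.mem_filter]
              exact ⟨(hptQ γ hγ _ (by omega)).1, hhv j (by omega)⟩
            · rw [hHn, Finset.mem_filter]
              refine ⟨(hptQ γ' hγ' _ (by omega)).1, ?_⟩
              rw [ih]
              exact hhv' j (by omega)
        have hγγ : γ = γ' := by
          by_contra hne
          obtain ⟨hf, hc⟩ := hC.2 γ hγ γ' hγ' hne
          rw [Set.ncard_eq_toFinset_card _ hf] at hc
          have h3 : (Finset.range (k + 1)).card ≤ hf.toFinset.card := by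
            apply Finset.card_le_card_of_injOn (fun j => pt γ (i + j))
            · intro j hj
              rw [Finset.mem_coe, Finset.mem_range] at hj
              rw [Finset.mem_coe, Set.Finite.mem_toFinset]
              refine ⟨(hptQ γ hγ _ (by omega)).2, ?_⟩
              simp only
              rw [hsame j (by omega)]
              exact (hptQ γ' hγ' _ (by omega)).2
            · intro j hj j' hj' hjj
              rw [Finset.mem_coe, Finset.mem_range] at hj hj'
              have := hpti γ hγ (i + j) (by omega) (i + j') (by omega) hjj
              omega
          rw [Finset.card_range] at h3
          omega
        subst hγγ
        rw [hpti γ hγ i (by omega) i' (by omega) hee.1]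
    rw [Finset.card_product, Finset.card_univ, Fintype.card_fun, Fintype.card_fin,
      Fintype.card_fin] at h1
    exact h1
  have hWg : (W \ Wb).card ≤ k * L.card := by
    have hj : ∀ e : Set (ℝ × ℝ) × ℕ, ∃ j : ℕ, e ∈ W \ Wb →
        j < k ∧ mult s(pt e.1 (e.2 + j), pt e.1 (e.2 + j + 1)) ≤ M := by
      intro e
      by_cases he : e ∈ W \ Wb
      · rw [Finset.mem_sdiff, hWb, Finset.mem_filter] at he
        have : ∃ j < k, mult s(pt e.1 (e.2 + j), pt e.1 (e.2 + j + 1)) ≤ M := by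
          by_contra hcon
          push Not at hcon
          exact he.2 ⟨he.1, hcon⟩
        obtain ⟨j, hj, h⟩ := this
        exact ⟨j, fun _ => ⟨hj, h⟩⟩
      · exact ⟨0, fun h => absurd h he⟩
    choose j hj using hj
    rw [show k * L.card = (Finset.range k ×ˢ L).card by
      rw [Finset.card_product, Finset.card_range]]
    apply Finset.card_le_card_of_injOn (fun e => (j e, (e.1, e.2 + j e)))
    · intro e he
      have he := Finset.mem_coe.1 he
      have h1 := hj e he
      rw [Finset.mem_sdiff, hWm] at he
      rw [Finset.mem_coe, Finset.mem_product, Finset.mem_range, hL, Finset.mem_filter, hEdm]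
      exact ⟨h1.1, ⟨he.1.1, by have := he.1.2; simp only; omega⟩, h1.2⟩
    · rintro ⟨γ, i⟩ _ ⟨γ', i'⟩ _ h
      simp only [Prod.mk.injEq] at h
      obtain ⟨h1, h2, h3⟩ := h
      rw [Prod.mk.injEq]
      exact ⟨h2, by omega⟩
  refine ⟨L.card, ?_, ?_⟩
  · have h1 : W.card ≤ (W \ Wb).card + Wb.card := by
      rw [← Finset.card_sdiff_add_card_inter W Wb]
      exact Nat.add_le_add_left (Finset.card_le_card Finset.inter_subset_right) _
    omega
  · intro r hr
    apply hcr L ?_ M r hM hr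
    · intro p q _
      by_cases hne : (L.filter (fun e => s(pt e.1 e.2, pt e.1 (e.2 + 1)) = s(p, q))).Nonempty
      · obtain ⟨e, he⟩ := hne
        rw [Finset.mem_filter, hL, Finset.mem_filter] at he
        refine le_trans ?_ he.1.2
        rw [he.2, hmult]
        apply Finset.card_le_card
        apply Finset.filter_subset_filter
        rw [hL]
        exact Finset.filter_subset _ _
      · rw [Finset.not_nonempty_iff_eq_empty.1 hne]
        simp
    · intro e he
      rw [hL, Finset.mem_filter, hEdm] at he
      exact he.1

lemma pairs_bound (C : Finset (Set (ℝ × ℝ))) (k : ℕ) (hC : KIntersecting C k)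
    (Q : Finset (ℝ × ℝ)) (hQ : ∀ p ∈ Q, 2 ≤ (C.filter (fun γ => p ∈ γ)).card) :
    ∑ p ∈ Q, (C.filter (fun γ => p ∈ γ)).card ≤ k * C.card ^ 2 := by
  calc ∑ p ∈ Q, (C.filter (fun γ => p ∈ γ)).card
      ≤ ∑ p ∈ Q, (C.offDiag.filter (fun g => p ∈ g.1 ∧ p ∈ g.2)).card := by
        apply Finset.sum_le_sum
        intro p hp
        have h1 : C.offDiag.filter (fun g => p ∈ g.1 ∧ p ∈ g.2) =
            (C.filter (fun γ => p ∈ γ)).offDiag := by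
          ext g
          simp only [Finset.mem_filter, Finset.mem_offDiag]
          tauto
        rw [h1, Finset.offDiag_card]
        have := hQ p hp
        have h2 := Nat.mul_le_mul_right (C.filter (fun γ => p ∈ γ)).card this
        omega
    _ = ∑ g ∈ C.offDiag, (Q.filter (fun p => p ∈ g.1 ∧ p ∈ g.2)).card := by
        simp only [Finset.card_filter]
        exact Finset.sum_comm
    _ ≤ ∑ g ∈ C.offDiag, k := by
        apply Finset.sum_le_sum
        intro g hg
        rw [Finset.mem_offDiag] at hg
        obtain ⟨hf, hc⟩ := hC.2 g.1 hg.1 g.2 hg.2.1 hg.2.2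
        rw [Set.ncard_eq_toFinset_card _ hf] at hc
        refine le_trans (Finset.card_le_card ?_) hc
        intro p hp
        rw [Finset.mem_filter] at hp
        rw [Set.Finite.mem_toFinset]
        exact hp.2
    _ = C.offDiag.card * k := by rw [Finset.sum_const, smul_eq_mul]
    _ ≤ C.card ^ 2 * k := by
      apply Nat.mul_le_mul_right
      rw [Finset.offDiag_card, sq]
      exact Nat.sub_le _ _
    _ = _ := mul_comm _ _

lemma kst_bound (C : Finset (Set (ℝ × ℝ))) (k : ℕ) (hC : KIntersecting C k)
    (Q : Finset (ℝ × ℝ)) :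
    (∑ γ ∈ C, ((Q.filter (fun p => p ∈ γ)).card - k)) ^ (k + 1) ≤
      C.card ^ k * Q.card ^ (k + 1) := by
  have h1 : (∑ γ ∈ C, ((Q.filter (fun p => p ∈ γ)).card - k)) ^ (k + 1) ≤
      C.card ^ k * ∑ γ ∈ C, ((Q.filter (fun p => p ∈ γ)).card - k) ^ (k + 1) := by
    have := pow_sum_le_card_mul_sum_pow (s := C)
      (f := fun γ => (((Q.filter (fun p => p ∈ γ)).card - k : ℕ) : ℝ))
      (fun i _ => Nat.cast_nonneg _) k
    exact_mod_cast this
  refine h1.trans (Nat.mul_le_mul_left _ ?_)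
  calc ∑ γ ∈ C, ((Q.filter (fun p => p ∈ γ)).card - k) ^ (k + 1)
      ≤ ∑ γ ∈ C, ((Q.filter (fun p => p ∈ γ)).card).descFactorial (k + 1) := by
        apply Finset.sum_le_sum
        intro γ _
        refine le_trans ?_ (Nat.pow_sub_le_descFactorial _ _)
        apply Nat.pow_le_pow_left
        omega
    _ = ∑ γ ∈ C, Fintype.card (Fin (k + 1) ↪ {p // p ∈ Q.filter (fun p => p ∈ γ)}) := by
        apply Finset.sum_congr rfl
        intro γ _
        rw [Fintype.card_embedding_eq, Fintype.card_fin, Fintype.card_coe]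
    _ = (C.sigma (fun γ => (Finset.univ :
          Finset (Fin (k + 1) ↪ {p // p ∈ Q.filter (fun p => p ∈ γ)})))).card := by
        rw [Finset.card_sigma]
        simp only [Finset.card_univ]
    _ ≤ (Fintype.piFinset (fun _ : Fin (k + 1) => Q)).card := by
        apply Finset.card_le_card_of_injOn (fun g j => (g.2 j : ℝ × ℝ))
        · rintro ⟨γ, g⟩ _
          rw [Finset.mem_coe, Fintype.mem_piFinset]
          intro j
          exact (Finset.mem_filter.1 (g j).2).1
        · rintro ⟨γ, g⟩ hg ⟨γ', g'⟩ hg' h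
          rw [Finset.mem_coe, Finset.mem_sigma] at hg hg'
          simp only at h hg hg'
          have hsame : ∀ j, (g j : ℝ × ℝ) = g' j := fun j => congrFun h j
          have hγγ : γ = γ' := by
            by_contra hne
            obtain ⟨hf, hc⟩ := hC.2 γ hg.1 γ' hg'.1 hne
            rw [Set.ncard_eq_toFinset_card _ hf] at hc
            have h3 : (Finset.univ : Finset (Fin (k + 1))).card ≤ hf.toFinset.card := by
              apply Finset.card_le_card_of_injOn (fun j => (g j : ℝ × ℝ))
              · intro j hj
                rw [Finset.mem_coe, Set.Finite.mem_toFinset]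
                refine ⟨(Finset.mem_filter.1 (g j).2).2, ?_⟩
                simp only
                rw [hsame j]
                exact (Finset.mem_filter.1 (g' j).2).2
              · intro j _ j' _ hjj
                exact g.injective (Subtype.ext hjj)
            rw [Finset.card_univ, Fintype.card_fin] at h3
            omega
          subst hγγ
          congr 1
          ext j : 1
          exact Subtype.ext (hsame j)
    _ = Q.card ^ (k + 1) := by
        rw [Fintype.card_piFinset_const]


lemma kst_case (C : Finset (Set (ℝ × ℝ))) (k : ℕ) (hk : 1 ≤ k) (hC : KIntersecting C k)
    (Q : Finset (ℝ × ℝ)) (l : ℕ) (s : ℝ) (hs : 0 < s) (hsl : s ^ k = l)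
    (hQ : ∀ p ∈ Q, l ≤ (C.filter (fun γ => p ∈ γ)).card) :
    ∑ p ∈ Q, (C.filter (fun γ => p ∈ γ)).card ≤ 2 * k * C.card ∨ (l : ℝ) * s ≤ 4 * C.card := by
  by_contra hcon
  push Not at hcon
  obtain ⟨h1, h2⟩ := hcon
  have h3 := kst_bound C k hC Q
  obtain ⟨S, hS⟩ : ∃ S, S = ∑ γ ∈ C, ((Q.filter (fun p => p ∈ γ)).card - k) := ⟨_, rfl⟩
  rw [← hS] at h3
  have h4 : ∑ γ ∈ C, (Q.filter (fun p => p ∈ γ)).card ≤ k * C.card + S := by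
    rw [hS, show k * C.card = ∑ γ ∈ C, k by rw [Finset.sum_const, smul_eq_mul, mul_comm],
      ← Finset.sum_add_distrib]
    apply Finset.sum_le_sum
    intro γ _
    omega
  have h5 : Q.card * l ≤ ∑ p ∈ Q, (C.filter (fun γ => p ∈ γ)).card := by
    rw [← smul_eq_mul, ← Finset.sum_const]
    exact Finset.sum_le_sum hQ
  rw [incidence_double] at h4
  have hQpos : 0 < Q.card := by
    rw [Finset.card_pos, Finset.nonempty_iff_ne_empty]
    rintro rfl
    simp at h1
  have h6 : Q.card * l ≤ 2 * S := by
    have : 2 * k * C.card = 2 * (k * C.card) := by ring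
    omega
  have h7 : l ^ (k + 1) ≤ 2 ^ (k + 1) * C.card ^ k := by
    refine Nat.le_of_mul_le_mul_left ?_ (pow_pos hQpos (k + 1))
    calc Q.card ^ (k + 1) * l ^ (k + 1) = (Q.card * l) ^ (k + 1) := by rw [mul_pow]
      _ ≤ (2 * S) ^ (k + 1) := Nat.pow_le_pow_left h6 _
      _ = 2 ^ (k + 1) * S ^ (k + 1) := by rw [mul_pow]
      _ ≤ 2 ^ (k + 1) * (C.card ^ k * Q.card ^ (k + 1)) := Nat.mul_le_mul_left _ h3
      _ = _ := by ring
  have h8 : l ^ (k + 1) ≤ (4 * C.card) ^ k := by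
    refine h7.trans ?_
    rw [mul_pow]
    apply Nat.mul_le_mul_right
    rw [show 4 = 2 ^ 2 by norm_num, ← pow_mul]
    exact Nat.pow_le_pow_right (by norm_num) (by omega)
  have h9 : ((l : ℝ) * s) ^ k ≤ (4 * C.card) ^ k := by
    rw [mul_pow, hsl, ← pow_succ]
    exact_mod_cast h8
  exact absurd (le_of_pow_le_pow_left₀ (by omega) (by positivity) h9) (not_le.2 h2)

lemma dyadic_large (C : Finset (Set (ℝ × ℝ))) (k : ℕ) (hk : 1 ≤ k) (hC : KIntersecting C k)
    (Q : Finset (ℝ × ℝ)) (D : ℕ) (s : ℝ) (hs : 952 * (k : ℝ) ≤ s) (hsD : s ^ k = D)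
    (hQ : ∀ p ∈ Q, D ≤ (C.filter (fun γ => p ∈ γ)).card ∧
      (C.filter (fun γ => p ∈ γ)).card ≤ 2 * D) :
    ((∑ p ∈ Q, (C.filter (fun γ => p ∈ γ)).card : ℕ) : ℝ) ≤
      10000000 * (k : ℝ) ^ 4 * ((C.card : ℝ) ^ 2 / (D * s) + C.card) := by
  have hk' : (1 : ℝ) ≤ k := by exact_mod_cast hk
  have hs1 : (952 : ℝ) ≤ s := by linarith
  have hs0 : 0 < s := by linarith
  have hDs : s ≤ D := by
    rw [← hsD]
    exact le_self_pow₀ (by linarith) (by omega)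
  have hD0 : (0 : ℝ) < D := by linarith
  obtain ⟨h, hh⟩ : ∃ h, h = ⌊s / 4⌋₊ := ⟨_, rfl⟩
  have hh1 : (h : ℝ) ≤ s / 4 := by rw [hh]; exact Nat.floor_le (by positivity)
  have hh2 : s / 4 < h + 1 := by rw [hh]; exact Nat.lt_floor_add_one _
  have hhpos : 0 < h := by
    have : (0 : ℝ) < h := by linarith
    exact_mod_cast this
  obtain ⟨M, hM⟩ : ∃ M, M = ⌈16 * D / s⌉₊ := ⟨_, rfl⟩
  have hM1 : 16 * D / s ≤ M := by rw [hM]; exact Nat.le_ceil _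
  have hM2 : (M : ℝ) < 16 * D / s + 1 := by rw [hM]; exact Nat.ceil_lt_add_one (by positivity)
  have hM1' : 16 * D ≤ M * s := by rwa [div_le_iff₀ hs0] at hM1
  have hM2' : M * s ≤ 17 * D := by
    have : (16 * D / s + 1) * s = 16 * D + s := by field_simp
    nlinarith
  have hMpos' : (0 : ℝ) < M := lt_of_lt_of_le (by positivity) hM1
  have hMpos : 0 < M := by exact_mod_cast hMpos'
  obtain ⟨r, hr⟩ : ∃ r, r = ⌊s / (952 * k)⌋₊ := ⟨_, rfl⟩
  have hr1 : (r : ℝ) * (952 * k) ≤ s := by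
    rw [← le_div_iff₀ (by positivity), hr]; exact Nat.floor_le (by positivity)
  have hr2 : s < (r + 1) * (952 * k) := by
    rw [← div_lt_iff₀ (by positivity), hr]; exact Nat.lt_floor_add_one _
  have hrpos : 0 < r := by
    rw [hr, Nat.floor_pos, le_div_iff₀ (by positivity)]
    linarith
  have hr0 : (1 : ℝ) ≤ r := by exact_mod_cast hrpos
  have hr3 : s ≤ r * (1904 * k) := by nlinarith
  have hMh : 4 * D < (M + 1) * (h + 1) := by
    have : (4 * D : ℝ) < (M + 1) * (h + 1) := by
      have : (M : ℝ) * (s / 4) ≤ M * (h + 1) := by gcongr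
      nlinarith
    exact_mod_cast this
  obtain ⟨e, he1, he2⟩ := dyadic_raw C k hC Q D M h hMpos hhpos (fun p hp => (hQ p hp).2) hMh
  have he2 := he2 r hrpos
  have h5 : Q.card * D ≤ ∑ p ∈ Q, (C.filter (fun γ => p ∈ γ)).card := by
    rw [← smul_eq_mul, ← Finset.sum_const]
    exact Finset.sum_le_sum fun p hp => (hQ p hp).1
  generalize (∑ p ∈ Q, (C.filter (fun γ => p ∈ γ)).card) = I at *
  generalize C.card = n at *
  generalize Q.card = m at *
  have he1' : (I : ℝ) ≤ k * n + m * (h : ℝ) ^ k + k * e := by exact_mod_cast he1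
  have he2' : (M : ℝ) * r ^ 2 * e ≤ k * n ^ 2 + 14 * M ^ 2 * r ^ 3 * m := by exact_mod_cast he2
  have h5' : (m : ℝ) * D ≤ I := by exact_mod_cast h5
  have hhk : (h : ℝ) ^ k ≤ D / 4 := by
    calc (h : ℝ) ^ k ≤ (s / 4) ^ k := by gcongr
      _ = s ^ k / 4 ^ k := div_pow _ _ _
      _ ≤ D / 4 := by
        rw [hsD]
        gcongr
        exact le_self_pow₀ (by norm_num) (by omega)
  have hm0 : (0 : ℝ) ≤ m := Nat.cast_nonneg _
  have hn0 : (0 : ℝ) ≤ n := Nat.cast_nonneg _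
  have hI0 : (0 : ℝ) ≤ I := Nat.cast_nonneg _
  have he0 : (0 : ℝ) ≤ e := Nat.cast_nonneg _
  have hX : 0 ≤ (n : ℝ) ^ 2 / (D * s) := by positivity
  have h34 : 3 * (I : ℝ) ≤ 4 * k * n + 4 * k * e := by
    have : m * (h : ℝ) ^ k ≤ m * (D / 4) := by gcongr
    linarith
  have hk4 : (k : ℝ) ≤ k ^ 4 := le_self_pow₀ hk' (by norm_num)
  by_cases hcase : (I : ℝ) ≤ 4 * k * n
  · calc (I : ℝ) ≤ 4 * k * n := hcase
      _ ≤ 10000000 * (k : ℝ) ^ 4 * n := by gcongr; linarith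
      _ ≤ _ := by gcongr; linarith
  · push Not at hcase
    have hIe : (I : ℝ) ≤ 2 * k * e := by linarith
    have hme : 28 * (M : ℝ) * r * m ≤ e := by
      have a1 : (M : ℝ) * s * m ≤ 17 * D * m := by gcongr
      have a2 : (M : ℝ) * (r * (952 * k)) * m ≤ M * s * m := by gcongr
      have a3 : (M : ℝ) * r * m * 952 * k ≤ 34 * e * k := by
        have b5 : (m : ℝ) * D ≤ 2 * k * e := h5'.trans hIe
        calc (M : ℝ) * r * m * 952 * k = M * (r * (952 * k)) * m := by ring
          _ ≤ 17 * (m * D) := by linarith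
          _ ≤ 17 * (2 * k * e) := by gcongr
          _ = _ := by ring
      have a4 : (M : ℝ) * r * m * 952 ≤ 34 * e := le_of_mul_le_mul_right a3 (by linarith)
      linarith
    have h1 : (M : ℝ) * r ^ 2 * e ≤ 2 * k * n ^ 2 := by
      have : (M : ℝ) * r ^ 2 * (28 * M * r * m) ≤ M * r ^ 2 * e := by gcongr
      have b4 : (M : ℝ) * r ^ 2 * (28 * M * r * m) = 2 * (14 * M ^ 2 * r ^ 3 * m) := by ring
      linarith
    -- multiply out
    have h2 : (16 * D) * s * e ≤ 2 * k * n ^ 2 * (1904 * k) ^ 2 := by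
      calc (16 * D) * s * e ≤ (M * s) * s * e := by gcongr
        _ = M * s ^ 2 * e := by ring
        _ ≤ M * (r * (1904 * k)) ^ 2 * e := by gcongr
        _ = (M * r ^ 2 * e) * (1904 * k) ^ 2 := by ring
        _ ≤ _ := by gcongr
    have h3 : (e : ℝ) ≤ 500000 * k ^ 3 * (n ^ 2 / (D * s)) := by
      rw [← mul_div_assoc, le_div_iff₀ (by positivity)]
      have b1 : 0 ≤ (k : ℝ) ^ 3 * n ^ 2 := by positivity
      have b2 : 16 * (e * (D * s)) ≤ 7250432 * ((k : ℝ) ^ 3 * n ^ 2) := by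
        calc 16 * (e * (D * s)) = (16 * D) * s * e := by ring
          _ ≤ _ := h2
          _ = _ := by ring
      have b3 : 500000 * (k : ℝ) ^ 3 * n ^ 2 = 500000 * ((k : ℝ) ^ 3 * n ^ 2) := by ring
      rw [b3]
      linarith
    calc (I : ℝ) ≤ 2 * k * e := hIe
      _ ≤ 2 * k * (500000 * k ^ 3 * (n ^ 2 / (D * s))) := by gcongr
      _ = 1000000 * k ^ 4 * (n ^ 2 / (D * s)) := by ring
      _ ≤ 10000000 * k ^ 4 * (n ^ 2 / (D * s) + n) := by
        gcongr
        · norm_num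
        · linarith

lemma dyadic_bound (k : ℕ) (hk : 1 ≤ k) : ∃ A : ℝ, 0 < A ∧
    ∀ (C : Finset (Set (ℝ × ℝ))) (Q : Finset (ℝ × ℝ)) (D : ℕ) (s : ℝ),
      KIntersecting C k → 2 ≤ D → 0 < s → s ^ k = D →
      (∀ p ∈ Q, D ≤ (C.filter (fun γ => p ∈ γ)).card ∧
        (C.filter (fun γ => p ∈ γ)).card ≤ 2 * D) →
      ((∑ p ∈ Q, (C.filter (fun γ => p ∈ γ)).card : ℕ) : ℝ) ≤
        A * ((C.card : ℝ) ^ 2 / (D * s) + C.card) := by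
  have hk' : (1 : ℝ) ≤ k := by exact_mod_cast hk
  refine ⟨10000000 * (k : ℝ) ^ 4 + k * (952 * k) ^ (k + 1), by positivity, ?_⟩
  intro C Q D s hC hD hs hsD hQ
  have hD0 : (0 : ℝ) < D := by
    have : 0 < D := by omega
    exact_mod_cast this
  have hX : 0 ≤ (C.card : ℝ) ^ 2 / (D * s) + C.card := by positivity
  by_cases hcase : 952 * (k : ℝ) ≤ s
  · refine (dyadic_large C k hk hC Q D s hcase hsD hQ).trans ?_
    gcongr
    have : (0 : ℝ) ≤ k * (952 * k) ^ (k + 1) := by positivity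
    linarith
  · push Not at hcase
    have h1 := pairs_bound C k hC Q (fun p hp => hD.trans (hQ p hp).1)
    have h1' : ((∑ p ∈ Q, (C.filter (fun γ => p ∈ γ)).card : ℕ) : ℝ) ≤ k * (C.card : ℝ) ^ 2 := by
      exact_mod_cast h1
    have h2 : D * s ≤ (952 * (k : ℝ)) ^ (k + 1) := by
      rw [← hsD, ← pow_succ]
      gcongr
    calc _ ≤ k * (C.card : ℝ) ^ 2 := h1'
      _ = (k * (D * s)) * ((C.card : ℝ) ^ 2 / (D * s)) := by field_simp
      _ ≤ (k * (952 * (k : ℝ)) ^ (k + 1)) * ((C.card : ℝ) ^ 2 / (D * s)) := by gcongr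
      _ ≤ (10000000 * (k : ℝ) ^ 4 + k * (952 * k) ^ (k + 1)) *
          ((C.card : ℝ) ^ 2 / (D * s) + C.card) := by
        gcongr
        · have : (0 : ℝ) ≤ 10000000 * (k : ℝ) ^ 4 := by positivity
          linarith
        · have : (0 : ℝ) ≤ C.card := Nat.cast_nonneg _
          linarith

theorem rich_points_bound (k : ℕ) (hk : 1 ≤ k) :
    ∃ c : ℝ, 0 < c ∧
      ∀ P : Finset (ℝ × ℝ), ∀ C : Finset (Set (ℝ × ℝ)), ∀ ℓ : ℕ,
        KIntersecting C k → 2 ≤ ℓ →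
        ((∑ p ∈ P.filter (fun p => ℓ ≤ (C.filter (fun γ => p ∈ γ)).card),
            (C.filter (fun γ => p ∈ γ)).card : ℕ) : ℝ) ≤
          c * ((C.card : ℝ)^2 / (ℓ : ℝ) ^ ((1:ℝ) + 1 / (k:ℝ)) + (C.card : ℝ)) := by
  obtain ⟨A, hA, hdy⟩ := dyadic_bound k hk
  have hk' : (1 : ℝ) ≤ k := by exact_mod_cast hk
  refine ⟨10 * A + 2 * k, by positivity, ?_⟩
  intro P C ℓ₀ hC hℓ₀
  have main : ∀ N ℓ : ℕ, C.card + 1 - ℓ ≤ N → 2 ≤ ℓ →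
      ((∑ p ∈ P.filter (fun p => ℓ ≤ (C.filter (fun γ => p ∈ γ)).card),
            (C.filter (fun γ => p ∈ γ)).card : ℕ) : ℝ) ≤
        10 * A * ((C.card : ℝ) ^ 2 / (ℓ * (ℓ : ℝ) ^ (1 / (k : ℝ)))) + 2 * k * C.card := by
    intro N
    induction N with
    | zero =>
      intro ℓ hN hℓ
      rw [Finset.filter_eq_empty_iff.2]
      · simp only [Finset.sum_empty, Nat.cast_zero]
        positivity
      · intro p _ h
        have := Finset.card_filter_le C (fun γ => p ∈ γ)
        omega
    | succ N ih =>
      intro ℓ hN hℓ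
      have hℓ0 : (0 : ℝ) < ℓ := by
        have : 0 < ℓ := by omega
        exact_mod_cast this
      obtain ⟨s, hs⟩ : ∃ s : ℝ, s = (ℓ : ℝ) ^ (1 / (k : ℝ)) := ⟨_, rfl⟩
      have hs0 : 0 < s := by rw [hs]; positivity
      have hsk : s ^ k = ℓ := by
        rw [hs, one_div]
        exact Real.rpow_inv_natCast_pow hℓ0.le (by omega)
      rw [← hs]
      rcases kst_case C k hk hC (P.filter (fun p => ℓ ≤ (C.filter (fun γ => p ∈ γ)).card)) ℓ s hs0
        hsk (fun p hp => (Finset.mem_filter.1 hp).2) with h | h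
      · have h' : ((∑ p ∈ P.filter (fun p => ℓ ≤ (C.filter (fun γ => p ∈ γ)).card),
            (C.filter (fun γ => p ∈ γ)).card : ℕ) : ℝ) ≤ 2 * k * C.card := by exact_mod_cast h
        refine h'.trans ?_
        have : 0 ≤ 10 * A * ((C.card : ℝ) ^ 2 / (ℓ * s)) := by positivity
        linarith
      · have ih' := ih (2 * ℓ) (by omega) (by omega)
        have hd := hdy C (P.filter (fun p => ℓ ≤ (C.filter (fun γ => p ∈ γ)).card ∧
          (C.filter (fun γ => p ∈ γ)).card ≤ 2 * ℓ)) ℓ s hC hℓ hs0 hsk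
          (fun p hp => (Finset.mem_filter.1 hp).2)
        have hsplit : (∑ p ∈ P.filter (fun p => ℓ ≤ (C.filter (fun γ => p ∈ γ)).card),
            (C.filter (fun γ => p ∈ γ)).card) ≤
            (∑ p ∈ P.filter (fun p => ℓ ≤ (C.filter (fun γ => p ∈ γ)).card ∧
              (C.filter (fun γ => p ∈ γ)).card ≤ 2 * ℓ), (C.filter (fun γ => p ∈ γ)).card) +
            (∑ p ∈ P.filter (fun p => 2 * ℓ ≤ (C.filter (fun γ => p ∈ γ)).card),
              (C.filter (fun γ => p ∈ γ)).card) := by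
          simp only [Finset.sum_filter]
          rw [← Finset.sum_add_distrib]
          apply Finset.sum_le_sum
          intro p _
          split_ifs <;> omega
        have hsplit' := (Nat.cast_le (α := ℝ)).2 hsplit
        rw [Nat.cast_add] at hsplit'
        have hmono : (C.card : ℝ) ^ 2 / ((2 * ℓ : ℕ) * ((2 * ℓ : ℕ) : ℝ) ^ (1 / (k : ℝ))) ≤
            (C.card : ℝ) ^ 2 / (ℓ * s) / 2 := by
          rw [div_div]
          apply div_le_div_of_nonneg_left (by positivity) (by positivity)
          push_cast
          have e0 : s ≤ (2 * (ℓ : ℝ)) ^ (1 / (k : ℝ)) := by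
            rw [hs]
            exact Real.rpow_le_rpow hℓ0.le (by linarith) (by positivity)
          calc (ℓ : ℝ) * s * 2 = 2 * ℓ * s := by ring
            _ ≤ _ := by gcongr
        have hn : (C.card : ℝ) ≤ 4 * ((C.card : ℝ) ^ 2 / (ℓ * s)) := by
          rw [← mul_div_assoc, le_div_iff₀ (by positivity)]
          have : (C.card : ℝ) * (ℓ * s) ≤ C.card * (4 * C.card) := by gcongr
          linarith
        have e1 : A * ((C.card : ℝ) ^ 2 / (ℓ * s) + C.card) ≤
            A * ((C.card : ℝ) ^ 2 / (ℓ * s) + 4 * ((C.card : ℝ) ^ 2 / (ℓ * s))) := by gcongr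
        have e2 := mul_le_mul_of_nonneg_left hmono (by positivity : 0 ≤ 10 * A)
        linarith
  have h := main _ ℓ₀ le_rfl hℓ₀
  have hℓ0 : (0 : ℝ) < ℓ₀ := by
    have : 0 < ℓ₀ := by omega
    exact_mod_cast this
  rw [Real.rpow_add hℓ0, Real.rpow_one]
  refine h.trans ?_
  have e1 : 0 ≤ (C.card : ℝ) ^ 2 / (ℓ₀ * (ℓ₀ : ℝ) ^ (1 / (k : ℝ))) := by positivity
  have e2 : (0 : ℝ) ≤ C.card := Nat.cast_nonneg _
  have e3 : 0 ≤ 2 * (k : ℝ) * ((C.card : ℝ) ^ 2 / (ℓ₀ * (ℓ₀ : ℝ) ^ (1 / (k : ℝ)))) := by positivity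
  have e4 : 0 ≤ 10 * A * (C.card : ℝ) := by positivity
  linarith
end
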